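/- (Simultaneous embedding over the prime field.) Let k be a field having no proper subfields (i.e., the only subfield of k is k itself, so k is isomorphic to ℚ or to 𝔽_p for some prime p). For i = 1, 2 let D_i be a division ring, finite-dimensional over its center K_i, where K_i is a field extension of k that is finitely generated as a field extension of k. Then there exists a division ring E, finite-dimensional over its center, together with injective k-algebra homomorphisms D₁ → E and D₂ → E. -/

import Mathlib

/-- A division algebra over `k`: a division ring, finite-dimensional over its center,
equipped with a `k`-algebra structure. -/
structure FinDimDivisionAlgebraOver (k : Type) [Field k] : Type 1 where
  carrier : Type
  [divisionRing : DivisionRing carrier]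
  [algebra : Algebra k carrier]
  [finiteDimensional : FiniteDimensional (Subring.center carrier) carrier]

attribute [instance] FinDimDivisionAlgebraOver.divisionRing
attribute [instance] FinDimDivisionAlgebraOver.algebra
attribute [instance] FinDimDivisionAlgebraOver.finiteDimensional


namespace CE

set_option linter.unusedSectionVars false
set_option linter.unusedVariables false
set_option linter.style.longLine false

open MvPolynomial

section sop

variable {T M V : Type} [Field T] [Field M] [Algebra T M] [Fintype V] [DecidableEq V]

/-- The semilinear ring endomorphism of a polynomial ring given by a field automorphism and
a linear substitution. -/
noncomputable def sop (σ : M ≃ₐ[T] M) (A : Matrix V V M) : MvPolynomial V M →+* MvPolynomial V M :=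
  eval₂Hom (C.comp (σ : M →+* M)) (fun v => ∑ v', C (A v' v) * X v')

theorem sop_C (σ : M ≃ₐ[T] M) (A : Matrix V V M) (m : M) : sop σ A (C m) = C (σ m) := by
  simp [sop]

theorem sop_X (σ : M ≃ₐ[T] M) (A : Matrix V V M) (v : V) :
    sop σ A (X v) = ∑ v', C (A v' v) * X v' := by
  simp [sop]

theorem sop_smul (σ : M ≃ₐ[T] M) (A : Matrix V V M) (m : M) (p : MvPolynomial V M) :
    sop σ A (m • p) = σ m • sop σ A p := by
  simp [MvPolynomial.smul_eq_C_mul, sop_C]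

theorem sop_sop (σ τ : M ≃ₐ[T] M) (A B : Matrix V V M) (p : MvPolynomial V M) :
    sop σ A (sop τ B p) = sop (σ * τ) (A * B.map σ) p := by
  have : (sop σ A).comp (sop τ B) = sop (σ * τ) (A * B.map σ) := by
    apply MvPolynomial.ringHom_ext
    · intro r; simp [sop_C]
    · intro v
      simp only [RingHom.comp_apply, sop_X, map_sum, map_mul, sop_C, Matrix.mul_apply,
        Matrix.map_apply, Finset.mul_sum, Finset.sum_mul]
      rw [Finset.sum_comm]
      refine Finset.sum_congr rfl fun i _ => Finset.sum_congr rfl fun j _ => by ring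
  exact DFunLike.congr_fun this p

theorem sop_one (p : MvPolynomial V M) : sop (1 : M ≃ₐ[T] M) (1 : Matrix V V M) p = p := by
  have : sop (1 : M ≃ₐ[T] M) (1 : Matrix V V M) = RingHom.id _ := by
    apply MvPolynomial.ringHom_ext
    · intro r; simp [sop_C]
    · intro v
      simp [sop_X, Matrix.one_apply]
  rw [this]; rfl

theorem sop_whomog {N N' : Type} [AddCommMonoid N] [AddCommMonoid N'] (w : V → N) (w' : V → N')
    (φ : N →+ N') (σ : M ≃ₐ[T] M) (A : Matrix V V M) (hA : ∀ v' v, A v' v ≠ 0 → w' v' = φ (w v))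
    {p : MvPolynomial V M} {a : N} (hp : IsWeightedHomogeneous w p a) :
    IsWeightedHomogeneous w' (sop σ A p) (φ a) := by
  rw [p.as_sum, map_sum]
  apply IsWeightedHomogeneous.sum
  intro m hm
  have hma : Finsupp.weight w m = a := hp (by simpa using hm)
  rw [monomial_eq, map_mul, sop_C, Finsupp.prod, map_prod]
  apply IsWeightedHomogeneous.C_mul
  have : φ a = ∑ v ∈ m.support, m v • φ (w v) := by
    rw [← hma, Finsupp.weight_apply, Finsupp.sum, map_sum]; simp
  rw [this]
  apply IsWeightedHomogeneous.prod
  intro v _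
  rw [map_pow, sop_X]
  apply IsWeightedHomogeneous.pow
  apply IsWeightedHomogeneous.sum
  intro v' _
  by_cases h : A v' v = 0
  · simp [h, isWeightedHomogeneous_zero]
  · rw [← hA v' v h]
    exact (isWeightedHomogeneous_X M w' v').C_mul _

theorem sop_diag {N : Type} [AddCommMonoid N] (w : V → N) (χ : Multiplicative N →* M)
    {p : MvPolynomial V M} {a : N} (hp : IsWeightedHomogeneous w p a) :
    sop (1 : M ≃ₐ[T] M) (Matrix.diagonal fun v => χ (.ofAdd (w v))) p = χ (.ofAdd a) • p := by
  conv_lhs => rw [p.as_sum, map_sum]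
  conv_rhs => rw [p.as_sum, Finset.smul_sum]
  refine Finset.sum_congr rfl fun m hm => ?_
  have hma : Finsupp.weight w m = a := hp (by simpa using hm)
  have : χ (.ofAdd a) = ∏ v ∈ m.support, χ (.ofAdd (w v)) ^ m v := by
    rw [← hma, Finsupp.weight_apply, Finsupp.sum, ofAdd_sum, map_prod]
    simp [ofAdd_nsmul]
  rw [monomial_eq, map_mul, sop_C, Finsupp.prod, map_prod, this, MvPolynomial.smul_eq_C_mul, map_prod]
  simp only [map_pow, sop_X, AlgEquiv.one_apply, Matrix.diagonal_apply]
  rw [mul_left_comm, ← Finset.prod_mul_distrib]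
  congr 1
  refine Finset.prod_congr rfl fun v _ => ?_
  rw [← mul_pow]
  refine congrArg (· ^ m v) ?_
  rw [Finset.sum_eq_single v]
  · simp
  · intro b _ hb; simp [hb]
  · simp

end sop

end CE

namespace CE

set_option linter.unusedSectionVars false
set_option linter.unusedVariables false
set_option linter.style.longLine false

open Module

theorem choose_not_dvd (p : ℕ) (hp : p.Prime) : ∀ (v y a : ℕ), p ^ v ∣ y → a < p ^ v → ¬ p ∣ (y + a).choose a := by
  have : Fact p.Prime := ⟨hp⟩
  intro v
  induction v with
  | zero =>
    intro y a _ ha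
    have : a = 0 := by simpa using ha
    subst this; simpa using hp.one_lt.ne'
  | succ v ih =>
    intro y a hy ha
    obtain ⟨y', rfl⟩ := hy
    have h := Choose.choose_modEq_choose_mod_mul_choose_div_nat (n := p^(v+1)*y' + a) (k := a) (p := p)
    have e1 : (p^(v+1)*y' + a) % p = a % p := by
      rw [pow_succ', mul_assoc, Nat.mul_add_mod]
    have e2 : (p^(v+1)*y' + a) / p = p^v*y' + a/p := by
      rw [pow_succ', mul_assoc, Nat.mul_add_div hp.pos]
    rw [e1, e2, Nat.choose_self, one_mul] at h
    rw [h.dvd_iff (dvd_refl p)]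
    exact ih _ _ (Dvd.intro _ rfl) (Nat.div_lt_of_lt_mul (by rwa [pow_succ'] at ha))

theorem exists_b (p : ℕ) (hp : p.Prime) (u y m : ℕ) (hu : ¬ p ∣ u) (hy : y ≠ 0) :
    ∃ a : ℕ, ¬ p ∣ (y + a).choose a ∧ Nat.gcd (u * y) (p ^ m) ∣ 1 + u * (a + 1) := by
  obtain ⟨v, y', hy', rfl⟩ := Nat.exists_eq_pow_mul_and_not_dvd hy p hp.one_lt.ne'
  have hcop : Nat.Coprime u (p ^ v) := (Nat.Coprime.pow_right v ((Nat.Prime.coprime_iff_not_dvd hp).2 hu).symm)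
  have hpos : 0 < p ^ v := pow_pos hp.pos v
  have hex : ∃ a < p ^ v, p ^ v ∣ 1 + u * (a + 1) := by
    have : NeZero (p^v) := ⟨hpos.ne'⟩
    refine ⟨((-(u : ZMod (p^v))⁻¹ - 1 : ZMod (p^v))).val, ZMod.val_lt _, ?_⟩
    rw [← CharP.cast_eq_zero_iff (ZMod (p^v)) (p^v)]
    push_cast
    rw [ZMod.natCast_zmod_val]
    have := ZMod.coe_mul_inv_eq_one u hcop
    linear_combination -this
  obtain ⟨a, ha, hd⟩ := hex
  refine ⟨a, choose_not_dvd p hp v _ a (Dvd.intro _ rfl) ha, dvd_trans ?_ hd⟩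
  obtain ⟨i, hi, h⟩ := (Nat.dvd_prime_pow hp).1 (Nat.gcd_dvd_right (u * (p ^ v * y')) (p ^ m))
  have h2 := Nat.gcd_dvd_left (u * (p ^ v * y')) (p ^ m)
  rw [h] at h2 ⊢
  have c1 : Nat.Coprime (p^i) u := (Nat.Coprime.pow_left i ((Nat.Prime.coprime_iff_not_dvd hp).2 hu))
  have c2 : Nat.Coprime (p^i) y' := (Nat.Coprime.pow_left i ((Nat.Prime.coprime_iff_not_dvd hp).2 hy'))
  exact c2.dvd_of_dvd_mul_right (c1.dvd_of_dvd_mul_left h2)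

section descent

variable {T M : Type} [Field T] [Field M] [Algebra T M] [FiniteDimensional T M] [IsGalois T M]

theorem exists_dual_pair (Q : Subgroup (M ≃ₐ[T] M)) [Fintype Q] [DecidableEq Q] :
    ∃ m m' : Q → M, (∀ i j, ∑ σ : Q, (σ : M ≃ₐ[T] M) (m i * m' j) = if i = j then 1 else 0) ∧
      ∀ σ : Q, ∑ i, m' i * (σ : M ≃ₐ[T] M) (m i) = if σ = 1 then 1 else 0 := by
  let F := IntermediateField.fixedField Q
  have hcard : finrank F M = Fintype.card Q := by
    rw [IntermediateField.finrank_fixedField_eq_card, Nat.card_eq_fintype_card]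
  let b : Basis Q F M := (finBasisOfFinrankEq F M hcard).reindex (Fintype.equivFin Q).symm
  have htr : ∀ x : M, ∑ σ : Q, (σ : M ≃ₐ[T] M) x = algebraMap F M (Algebra.trace F M x) := by
    intro x
    rw [trace_eq_sum_automorphisms]
    refine Fintype.sum_equiv (IntermediateField.subgroupEquivAlgEquiv Q).toEquiv _ _ fun σ => ?_
    rfl
  have h1 : ∀ i j, ∑ σ : Q, (σ : M ≃ₐ[T] M) (b i * b.traceDual j) = if i = j then 1 else 0 := by
    intro i j
    rw [htr, Basis.trace_mul_traceDual]
    split_ifs <;> simp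
  refine ⟨b, b.traceDual, h1, ?_⟩
  let A : Matrix Q Q M := fun i σ => (σ : M ≃ₐ[T] M) (b i)
  let B : Matrix Q Q M := fun σ j => (σ : M ≃ₐ[T] M) (b.traceDual j)
  have hAB : A * B = 1 := by
    ext i j
    rw [Matrix.mul_apply, Matrix.one_apply, ← h1 i j]
    simp [A, B]
  have hBA := mul_eq_one_comm.mp hAB
  intro σ
  have := congrFun (congrFun hBA 1) σ
  rw [Matrix.mul_apply, Matrix.one_apply] at this
  simp only [A, B, OneMemClass.coe_one, AlgEquiv.one_apply] at this
  rw [this]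
  simp [eq_comm]

variable {X : Type} [AddCommGroup X] [Module M X] [Module T X] [IsScalarTower T M X]
  [FiniteDimensional M X]
  {D : Type} [DivisionRing D] [Algebra T D] [FiniteDimensional T D]

theorem descent_dvd (Q : Subgroup (M ≃ₐ[T] M)) (O : Q → X →+ X)
    (hO : ∀ σ m x, O σ (m • x) = (σ : M ≃ₐ[T] M) m • O σ x)
    (hO1 : ∀ x, O 1 x = x) (hOm : ∀ σ τ x, O σ (O τ x) = O (σ * τ) x)
    (ψ : D →ₐ[T] Module.End T X)
    (hψM : ∀ d (m : M) x, ψ d (m • x) = m • ψ d x) (hψ : ∀ σ d x, O σ (ψ d x) = ψ d (O σ x)) :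
    finrank T D ∣ Q.index * finrank M X := by
  classical
  have : Fintype Q := Fintype.ofFinite _
  obtain ⟨m, m', h1, h2⟩ := exists_dual_pair Q
  have hOT : ∀ σ (t : T) x, O σ (t • x) = t • O σ x := by
    intro σ t x
    rw [← algebraMap_smul M t x, hO, AlgEquiv.commutes, algebraMap_smul]
  let W : Submodule T X :=
    { carrier := {x | ∀ σ, O σ x = x}
      add_mem' := by intro a b ha hb σ; rw [map_add, ha, hb]
      zero_mem' := by intro σ; simp
      smul_mem' := by intro t x hx σ; rw [hOT, hx] }
  have hW : ∀ x, x ∈ W ↔ ∀ σ, O σ x = x := fun x => Iff.rfl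
  have avg : ∀ x, ∑ σ, O σ x ∈ W := by
    intro x
    rw [hW]; intro τ
    rw [map_sum]; simp_rw [hOm]
    exact Fintype.sum_equiv (Equiv.mulLeft τ) _ _ (fun σ => rfl)
  let e : X ≃ₗ[T] (Q → W) :=
    { toFun := fun x i => ⟨∑ σ, O σ (m i • x), avg _⟩
      map_add' := by intro x y; ext i; simp [Finset.sum_add_distrib]
      map_smul' := by
        intro t x; ext i
        simp only [RingHom.id_apply, Pi.smul_apply, Submodule.coe_smul, Finset.smul_sum]
        refine Finset.sum_congr rfl fun σ _ => ?_
        rw [← hOT, smul_comm]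
      invFun := fun w => ∑ j, m' j • (w j : X)
      left_inv := by
        intro x
        simp only [hO, Finset.smul_sum, smul_smul]
        rw [Finset.sum_comm]
        simp_rw [← Finset.sum_smul, h2]
        rw [Finset.sum_eq_single 1] <;> simp +contextual [hO1]
      right_inv := by
        intro w
        ext i
        simp only [Finset.smul_sum, map_sum, smul_smul, hO]
        rw [Finset.sum_comm]
        have hw : ∀ (j : Q) (σ : Q), O σ (w j : X) = w j := fun j σ => (w j).2 σ
        simp_rw [hw, ← Finset.sum_smul, h1]
        simp }
  have hfinX : FiniteDimensional T X := Module.Finite.trans M X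
  let ψW : D →ₐ[T] Module.End T W :=
    { toFun := fun d => (ψ d).restrict (p := W) (q := W) (by
        intro x hx; rw [hW] at hx ⊢; intro σ; rw [hψ, hx])
      map_one' := by ext; simp
      map_mul' := by intro a b; ext; simp
      map_zero' := by ext; simp
      map_add' := by intro a b; ext; simp
      commutes' := by intro t; ext; simp }
  let _ : Module D W := Module.compHom W ψW.toRingHom
  have hsm : ∀ (d : D) (w : W), d • w = ψW d w := fun _ _ => rfl
  have : IsScalarTower T D W := ⟨fun t d w => by simp [hsm]⟩
  have hd : finrank T D ∣ finrank T W := Module.finrank_dvd_finrank_right T D W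
  have hX : finrank T X = Fintype.card Q * finrank T W := by
    rw [e.finrank_eq, Module.finrank_pi_fintype]; simp
  have hX2 : finrank T M * finrank M X = finrank T X := Module.finrank_mul_finrank T M X
  have hG : finrank T M = Q.index * Fintype.card Q := by
    rw [← IsGalois.card_aut_eq_finrank, ← Q.index_mul_card, Nat.card_eq_fintype_card]
  have hq : 0 < Fintype.card Q := Fintype.card_pos
  have : finrank T W = Q.index * finrank M X := by
    apply Nat.eq_of_mul_eq_mul_left hq
    rw [← hX, ← hX2, hG]; ring
  rwa [this] at hd

end descent

end CE

namespace CE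

set_option linter.unusedSectionVars false
set_option linter.unusedVariables false
set_option linter.style.longLine false

open Module MvPolynomial

theorem finrank_homog (M : Type) [Field M] (y b : ℕ) :
    finrank M (homogeneousSubmodule (Fin y) M b) = Nat.multichoose y b := by
  have h : homogeneousSubmodule (Fin y) M b
      = restrictSupport M ((Finset.finsuppAntidiag (Finset.univ : Finset (Fin y)) b : Finset _) : Set (Fin y →₀ ℕ)) := by
    rw [homogeneousSubmodule_eq_finsupp_supported]
    unfold restrictSupport
    congr 1
    ext d
    simp [Finsupp.degree_eq_sum]
  rw [h, Module.finrank_eq_card_basis (basisRestrictSupport M _)]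
  simp [Finset.card_finsuppAntidiag_nat_eq_multichoose]

section TW
variable {T M : Type} [Field T] [Field M] [Algebra T M] [FiniteDimensional T M] [IsGalois T M]
  {D : Type} [DivisionRing D] [Algebra T D] [FiniteDimensional T D]

def IsCob (Q : Subgroup (M ≃ₐ[T] M)) (c : Q → Q → M) (e : ℤ) : Prop :=
  ∃ f : Q → M, (∀ σ, f σ ≠ 0) ∧ ∀ σ τ, f σ * (σ : M ≃ₐ[T] M) (f τ) = c σ τ ^ e * f (σ * τ)

theorem IsCob.add {Q : Subgroup (M ≃ₐ[T] M)} {c : Q → Q → M} (hc : ∀ σ τ, c σ τ ≠ 0) {e e' : ℤ}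
    (h : IsCob Q c e) (h' : IsCob Q c e') : IsCob Q c (e + e') := by
  obtain ⟨f, hf, h⟩ := h
  obtain ⟨f', hf', h'⟩ := h'
  refine ⟨fun σ => f σ * f' σ, fun σ => mul_ne_zero (hf σ) (hf' σ), fun σ τ => ?_⟩
  rw [zpow_add₀ (hc σ τ), map_mul, mul_mul_mul_comm, h, h']; ring

theorem IsCob.zsmul {Q : Subgroup (M ≃ₐ[T] M)} {c : Q → Q → M} (hc : ∀ σ τ, c σ τ ≠ 0) {e : ℤ}
    (h : IsCob Q c e) (k : ℤ) : IsCob Q c (k * e) := by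
  obtain ⟨f, hf, h⟩ := h
  refine ⟨fun σ => f σ ^ k, fun σ => zpow_ne_zero _ (hf σ), fun σ τ => ?_⟩
  rw [mul_comm k, zpow_mul, map_zpow₀, ← mul_zpow, h, mul_zpow]

theorem exists_matAct {X : Type} [AddCommGroup X] [Module M X] [Module T X] [IsScalarTower T M X]
    {n : ℕ} (θ : D →ₐ[T] Matrix (Fin n) (Fin n) M) :
    ∃ ψ : D →ₐ[T] Module.End T (Fin n → X), ∀ d x i, ψ d x i = ∑ k, θ d i k • x k := by
  let F : D → Module.End T (Fin n → X) := fun d =>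
        { toFun := fun x i => ∑ k, θ d i k • x k
          map_add' := by intro x x'; funext i; simp [Finset.sum_add_distrib]
          map_smul' := by
            intro t x; funext i
            simp only [Pi.smul_apply, RingHom.id_apply, Finset.smul_sum]
            exact Finset.sum_congr rfl fun k _ => smul_comm _ _ _ }
  have hF : ∀ d x i, F d x i = ∑ k, θ d i k • x k := fun _ _ _ => rfl
  refine ⟨{ toFun := F, map_one' := ?_, map_mul' := ?_, map_zero' := ?_, map_add' := ?_, commutes' := ?_ }, hF⟩
  · refine LinearMap.ext fun x => funext fun i => ?_
    simp [hF, Matrix.one_apply]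
  · intro a b; refine LinearMap.ext fun x => funext fun i => ?_
    rw [Module.End.mul_apply, hF, hF]
    simp_rw [hF]
    simp only [map_mul, Matrix.mul_apply, Finset.smul_sum, Finset.sum_smul, smul_smul]
    rw [Finset.sum_comm]
  · refine LinearMap.ext fun x => funext fun i => ?_
    simp [hF]
  · intro a b; refine LinearMap.ext fun x => funext fun i => ?_
    simp [hF, Finset.sum_add_distrib, add_smul]
  · intro t; refine LinearMap.ext fun x => funext fun i => ?_
    simp [hF, Matrix.algebraMap_matrix_apply, Module.algebraMap_end_apply]

theorem sop_homog {y : ℕ} (σ : M ≃ₐ[T] M) (A : Matrix (Fin y) (Fin y) M) {b : ℕ}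
    {x : MvPolynomial (Fin y) M} (hx : x ∈ homogeneousSubmodule (Fin y) M b) :
    sop σ A x ∈ homogeneousSubmodule (Fin y) M b := by
  have hx' : IsWeightedHomogeneous (1 : Fin y → ℕ) x b := hx
  have := sop_whomog (N := ℕ) (N' := ℕ) 1 1 (AddMonoidHom.id ℕ) σ A (by simp) hx'
  exact this

theorem sop_smul_mat {y : ℕ} (σ : M ≃ₐ[T] M) (A : Matrix (Fin y) (Fin y) M) {b : ℕ} (l : M)
    {x : MvPolynomial (Fin y) M} (hx : x ∈ homogeneousSubmodule (Fin y) M b) :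
    sop σ (l • A) x = l ^ b • sop σ A x := by
  have hx2 : IsWeightedHomogeneous (1 : Fin y → ℕ) (sop σ A x) b := sop_homog σ A hx
  have h := sop_diag (T := T) (1 : Fin y → ℕ) ((powersHom M) l) hx2
  have e2 : (Matrix.diagonal fun v => (powersHom M) l (Multiplicative.ofAdd ((1 : Fin y → ℕ) v))) *
      A.map (1 : M ≃ₐ[T] M) = l • A := by
    ext i j
    simp [Matrix.diagonal_mul]
  rw [sop_sop, e2, one_mul, powersHom_apply, toAdd_ofAdd] at h
  exact h

set_option maxHeartbeats 1000000 in
theorem twisted_dvd (Q : Subgroup (M ≃ₐ[T] M)) (p : ℕ) (hp : p.Prime) (hQ : IsPGroup p Q)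
    (n : ℕ) (θ : D →ₐ[T] Matrix (Fin n) (Fin n) M)
    (N : Q → Matrix (Fin n) (Fin n) M) (hN : ∀ σ, (N σ).det ≠ 0) (hN1 : N 1 = 1)
    (hNθ : ∀ σ d, N σ * (θ d).map (σ : M ≃ₐ[T] M) = θ d * N σ)
    (c : Q → Q → M) (hc : ∀ σ τ, c σ τ ≠ 0)
    (hNc : ∀ σ τ, N σ * (N τ).map (σ : M ≃ₐ[T] M) = c σ τ • N (σ * τ))
    (y : ℕ) (A : Q → Matrix (Fin y) (Fin y) M) (hA : ∀ σ, (A σ).det ≠ 0) (hA1 : A 1 = 1)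
    (u : ℕ) (hu : ¬ p ∣ u)
    (hAc : ∀ σ τ, A σ * (A τ).map (σ : M ≃ₐ[T] M) = (c σ τ) ^ u • A (σ * τ))
    (k : ℕ) (hk : p ^ k ∣ finrank T D) : p ^ k ∣ Q.index * (n * y) := by
  classical
  have : Fintype Q := Fintype.ofFinite _
  rcases Nat.eq_zero_or_pos n with rfl | hn
  · simp
  rcases Nat.eq_zero_or_pos y with rfl | hy
  · simp
  have cancelN : ∀ σ (a b : M), a • N σ = b • N σ → a = b := by
    intro σ a b h
    have hu : IsUnit (N σ) := (Matrix.isUnit_iff_isUnit_det _).2 (isUnit_iff_ne_zero.2 (hN σ))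
    have h2 : a • (1 : Matrix (Fin n) (Fin n) M) = b • 1 := by
      apply hu.mul_left_injective
      simpa using h
    simpa using congrFun (congrFun h2 ⟨0, hn⟩) ⟨0, hn⟩
  have coc : ∀ σ τ ρ : Q, c σ τ * c (σ * τ) ρ = (σ : M ≃ₐ[T] M) (c τ ρ) * c σ (τ * ρ) := by
    intro σ τ ρ
    apply cancelN (σ * τ * ρ)
    rw [mul_smul, ← hNc, ← Matrix.smul_mul, ← hNc, mul_smul, mul_assoc σ, ← hNc σ]
    have h := congrArg (fun B : Matrix _ _ M => B.map (σ : M ≃ₐ[T] M)) (hNc τ ρ)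
    simp only [Matrix.map_mul] at h
    rw [Matrix.mul_assoc, ← Matrix.mul_smul]
    congr 1
    ext i j
    have h' := congrFun (congrFun h i) j
    simpa [Matrix.mul_apply] using h'
  have cob1 : IsCob Q c ((u * y : ℕ) : ℤ) := by
    refine ⟨fun σ => (A σ).det, hA, fun σ τ => ?_⟩
    have h := congrArg Matrix.det (hAc σ τ)
    rw [Matrix.det_mul, Matrix.det_smul, Fintype.card_fin, ← pow_mul] at h
    rw [zpow_natCast, ← h]
    congr 1
    exact AlgEquiv.map_det _ _
  have cob2 : IsCob Q c ((Fintype.card Q : ℕ) : ℤ) := by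
    refine ⟨fun σ => ∏ ρ, c σ ρ, fun σ => Finset.prod_ne_zero_iff.2 fun ρ _ => hc σ ρ, fun σ τ => ?_⟩
    dsimp only
    rw [zpow_natCast, map_prod, ← Equiv.prod_comp (Equiv.mulLeft τ) (fun ρ => c σ ρ),
      ← Finset.prod_mul_distrib, ← Finset.card_univ, ← Finset.prod_const, ← Finset.prod_mul_distrib]
    refine Finset.prod_congr rfl fun ρ _ => ?_
    rw [coc, mul_comm]; rfl
  obtain ⟨m, hm⟩ := have : Fact p.Prime := ⟨hp⟩; IsPGroup.iff_card.1 hQ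
  rw [Nat.card_eq_fintype_card] at hm
  obtain ⟨a, ha, hd⟩ := exists_b p hp u y m hu hy.ne'
  have cob3 : IsCob Q c (-((1 + u * (a + 1) : ℕ) : ℤ)) := by
    obtain ⟨q, hq⟩ := hd
    have hb := Nat.gcd_eq_gcd_ab (u * y) (p ^ m)
    have : (-((1 + u * (a + 1) : ℕ) : ℤ)) = (-(q : ℤ) * Nat.gcdA (u * y) (p ^ m)) * ((u * y : ℕ) : ℤ)
      + (-(q : ℤ) * Nat.gcdB (u * y) (p ^ m)) * ((Fintype.card Q : ℕ) : ℤ) := by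
      rw [hq, hm, Nat.cast_mul, hb]; ring
    rw [this]
    exact (cob1.zsmul hc _).add hc (cob2.zsmul hc _)
  obtain ⟨f, hf0, hf⟩ := cob3
  set b := a + 1 with hb
  have hf' : ∀ σ τ, f σ * (σ : M ≃ₐ[T] M) (f τ) * (c σ τ * (c σ τ ^ u) ^ b) = f (σ * τ) := by
    intro σ τ
    rw [hf, zpow_neg, zpow_natCast, ← pow_mul, ← pow_succ', add_comm 1]
    rw [mul_right_comm, inv_mul_cancel₀ (pow_ne_zero _ (hc σ τ)), one_mul]
  let H := homogeneousSubmodule (Fin y) M b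
  have hΨ : ∀ (σ : Q) (x : MvPolynomial (Fin y) M), x ∈ H → sop (σ : M ≃ₐ[T] M) (A σ) x ∈ H := by
    intro σ x hx
    exact sop_homog _ _ hx
  have hΨc : ∀ (σ τ : Q) (x : MvPolynomial (Fin y) M), x ∈ H →
      sop (σ : M ≃ₐ[T] M) (A σ) (sop (τ : M ≃ₐ[T] M) (A τ) x) =
        (c σ τ ^ u) ^ b • sop ((σ * τ : Q) : M ≃ₐ[T] M) (A (σ * τ)) x := by
    intro σ τ x hx
    rw [sop_sop, hAc, sop_smul_mat _ _ _ hx]; rfl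
  let O : Q → (Fin n → H) →+ (Fin n → H) := fun σ =>
    { toFun := fun x i => f σ • ∑ k, N σ i k • ⟨sop (σ : M ≃ₐ[T] M) (A σ) (x k), hΨ _ _ (x k).2⟩
      map_zero' := by ext1 i; apply Subtype.ext; simp
      map_add' := by
        intro x x'; ext1 i; apply Subtype.ext
        simp [Finset.sum_add_distrib] }
  have hOv : ∀ σ x i, ((O σ x i : H) : MvPolynomial (Fin y) M) =
      f σ • ∑ k, N σ i k • sop (σ : M ≃ₐ[T] M) (A σ) (x k) := by
    intro σ x i; simp [O]
  have hc1 : ∀ τ, c 1 τ = 1 := by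
    intro τ
    apply cancelN τ
    have h := hNc 1 τ
    rw [hN1, one_mul, one_mul] at h
    rw [← h, one_smul]
    ext i j; simp
  have hf1 : f 1 = 1 := by
    have h := hf' 1 1
    rw [hc1] at h
    simp only [OneMemClass.coe_one, AlgEquiv.one_apply, one_pow, mul_one] at h
    exact mul_left_cancel₀ (hf0 1) (by rw [h, mul_one])
  obtain ⟨ψ, hψv⟩ := exists_matAct (T := T) (X := H) θ
  have : Module.Finite M H := Module.Finite.iff_fg.2 (weightedHomogeneousSubmodule_fg M (1 : Fin y → ℕ) (by simp) b)
  have key : finrank T D ∣ Q.index * finrank M (Fin n → H) := by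
    refine descent_dvd Q O ?_ ?_ ?_ ψ ?_ ?_
    · intro σ m x
      ext1 i; apply Subtype.ext
      simp only [hOv, Pi.smul_apply, Submodule.coe_smul, sop_smul, Finset.smul_sum]
      refine Finset.sum_congr rfl fun k _ => ?_
      simp only [smul_smul]; congr 1; ring
    · intro x
      ext1 i; apply Subtype.ext
      rw [hOv]
      simp [hf1, hN1, hA1, sop_one, Matrix.one_apply]
    · intro σ τ x
      ext1 i; apply Subtype.ext
      rw [hOv, hOv]
      simp_rw [hOv, sop_smul, map_sum, sop_smul]
      have hx : ∀ k, (x k : MvPolynomial (Fin y) M) ∈ H := fun k => (x k).2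
      simp_rw [hΨc σ τ _ (hx _), Finset.smul_sum, smul_smul]
      rw [Finset.sum_comm]
      refine Finset.sum_congr rfl fun k _ => ?_
      rw [← Finset.sum_smul]
      congr 1
      have h := congrFun (congrFun (hNc σ τ) i) k
      rw [Matrix.mul_apply, Matrix.smul_apply, smul_eq_mul] at h
      rw [← hf' σ τ]
      calc _ = f σ * (σ : M ≃ₐ[T] M) (f τ) * (c σ τ ^ u) ^ b *
            ∑ j, N σ i j * (N τ).map (σ : M ≃ₐ[T] M) j k := by
            rw [Finset.mul_sum]; refine Finset.sum_congr rfl fun j _ => ?_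
            rw [Matrix.map_apply]; ring
        _ = _ := by rw [h]; ring
    · intro d m x
      ext1 i
      simp only [hψv, Pi.smul_apply, Finset.smul_sum]
      exact Finset.sum_congr rfl fun k _ => smul_comm _ _ _
    · intro σ d x
      ext1 i; apply Subtype.ext
      rw [hOv, hψv]
      simp_rw [hψv]
      simp only [Submodule.coe_sum, Submodule.coe_smul, hOv, map_sum, sop_smul, Finset.smul_sum, smul_smul]
      rw [Finset.sum_comm]
      conv_rhs => rw [Finset.sum_comm]
      refine Finset.sum_congr rfl fun k _ => ?_
      rw [← Finset.sum_smul, ← Finset.sum_smul]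
      congr 1
      have h := congrFun (congrFun (hNθ σ d) i) k
      rw [Matrix.mul_apply, Matrix.mul_apply] at h
      simp only [Matrix.map_apply] at h
      calc _ = f σ * ∑ j, N σ i j * (σ : M ≃ₐ[T] M) (θ d j k) := by
            rw [Finset.mul_sum]
            try { refine Finset.sum_congr rfl fun j _ => ?_
                  ring }
        _ = _ := by
            rw [h, Finset.mul_sum]; refine Finset.sum_congr rfl fun j _ => ?_
            ring
  rw [Module.finrank_pi_fintype] at key
  simp only [Finset.sum_const, Finset.card_univ, Fintype.card_fin, smul_eq_mul] at key
  have hH : finrank M H = (y + a).choose (a + 1) := by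
    rw [finrank_homog, Nat.multichoose_eq, hb]; congr 1
  have hch := Nat.choose_succ_right_eq (y + a) a
  rw [Nat.add_sub_cancel] at hch
  rw [hH] at key
  have h1 : p ^ k ∣ (Q.index * (n * y)) * (y + a).choose a := by
    have := Dvd.dvd.mul_right (hk.trans key) (a + 1)
    have e : Q.index * (n * (y + a).choose (a + 1)) * (a + 1) = (Q.index * (n * y)) * (y + a).choose a := by
      linear_combination Q.index * n * hch
    rwa [e] at this
  exact (Nat.Coprime.pow_left k ((Nat.Prime.coprime_iff_not_dvd hp).2 ha)).dvd_of_dvd_mul_right h1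

end TW
end CE

namespace CE

set_option linter.unusedSectionVars false
set_option linter.unusedVariables false
set_option linter.style.longLine false

open Module

theorem orbit_sum_dvd {P Ω : Type} [Group P] [Finite P] [MulAction P Ω] (s : Finset Ω) (f : Ω → ℕ) (q : ℕ)
    (hs : ∀ (g : P), ∀ a ∈ s, g • a ∈ s) (hf : ∀ (g : P), ∀ a ∈ s, f (g • a) = f a)
    (hq : ∀ a ∈ s, q ∣ (MulAction.stabilizer P a).index * f a) : q ∣ ∑ a ∈ s, f a := by
  classical
  rw [← Finset.sum_fiberwise_of_maps_to (s := s) (t := s.image (Quotient.mk (MulAction.orbitRel P Ω)))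
    (g := Quotient.mk (MulAction.orbitRel P Ω)) (fun a ha => Finset.mem_image_of_mem _ ha)]
  apply Finset.dvd_sum
  intro o ho
  obtain ⟨a, ha, rfl⟩ := Finset.mem_image.1 ho
  have hmem : ∀ b, (Quotient.mk (MulAction.orbitRel P Ω) b = Quotient.mk (MulAction.orbitRel P Ω) a)
      ↔ b ∈ MulAction.orbit P a := by
    intro b
    rw [Quotient.eq]; exact MulAction.orbitRel_apply
  have h1 : ∀ b ∈ s.filter (fun b => Quotient.mk (MulAction.orbitRel P Ω) b = Quotient.mk (MulAction.orbitRel P Ω) a), f b = f a := by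
    intro b hb
    obtain ⟨g, rfl⟩ := (hmem b).1 (Finset.mem_filter.1 hb).2
    exact hf g a ha
  rw [Finset.sum_congr rfl h1, Finset.sum_const, smul_eq_mul]
  suffices hcard : (s.filter (fun b => Quotient.mk (MulAction.orbitRel P Ω) b = Quotient.mk (MulAction.orbitRel P Ω) a)).card
      = (MulAction.stabilizer P a).index by
    rw [hcard]; exact hq a ha
  rw [MulAction.index_stabilizer, ← Set.ncard_coe_finset]
  congr 1
  ext b
  simp only [Finset.coe_filter, Set.mem_setOf_eq, hmem]
  constructor
  · exact fun h => h.2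
  · rintro ⟨g, rfl⟩
    exact ⟨hs g a ha, g, rfl⟩

theorem exists_fixed_not_dvd {P X : Type} [Group P] [Finite P] [MulAction P X] [Fintype X] (p : ℕ) (hp : p.Prime)
    (hP : IsPGroup p P) (u : X → ℕ) (hu : ∀ (g : P) x, u (g • x) = u x) (hs : ¬ p ∣ ∑ x, u x) :
    ∃ x, (∀ g : P, g • x = x) ∧ ¬ p ∣ u x := by
  by_contra! hcon
  have : Fact p.Prime := ⟨hp⟩
  apply hs
  apply orbit_sum_dvd (P := P) Finset.univ u p (by simp) (fun g a _ => hu g a)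
  intro x _
  by_cases h : ∀ g : P, g • x = x
  · exact Dvd.dvd.mul_left (hcon x h) _
  · apply Dvd.dvd.mul_right
    obtain ⟨k, hk⟩ := hP.index (MulAction.stabilizer P x)
    rw [hk]
    apply dvd_pow_self
    rintro rfl
    rw [pow_zero, Subgroup.index_eq_one] at hk
    apply h
    intro g
    have : g ∈ MulAction.stabilizer P x := by rw [hk]; trivial
    exact this

theorem stab_trivial {Γ : Type} [Group Γ] [Fintype Γ] (p : ℕ) (hp : p.Prime) (H : Subgroup Γ)
    (hH : IsPGroup p H) (α : Γ → ℕ) (hα : ∀ h ∈ H, ∀ x, α (h * x) = α x) (hs : ¬ p ∣ ∑ x, α x) :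
    H = ⊥ := by
  have : Fact p.Prime := ⟨hp⟩
  obtain ⟨k, hk⟩ := IsPGroup.iff_card.1 hH
  rw [← Subgroup.card_eq_one, hk]
  rcases Nat.eq_zero_or_pos k with rfl | hk0
  · simp
  exfalso; apply hs
  refine (dvd_pow_self p hk0.ne').trans ?_
  rw [← hk]
  apply orbit_sum_dvd (P := H) Finset.univ α _ (by simp) (fun g a _ => hα g g.2 a)
  intro x _
  apply Dvd.dvd.mul_right
  have : MulAction.stabilizer H x = ⊥ := by
    rw [eq_bot_iff]; intro g hg
    have : (g : Γ) * x = x := hg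
    simpa using this
  rw [this, Subgroup.index_bot]

theorem twisted_dvd' {T M : Type} [Field T] [Field M] [Algebra T M] [FiniteDimensional T M] [IsGalois T M]
    {D : Type} [DivisionRing D] [Algebra T D] [FiniteDimensional T D]
    (Q : Subgroup (M ≃ₐ[T] M)) (p : ℕ) (hp : p.Prime) (hQ : IsPGroup p Q)
    (n : ℕ) (θ : D →ₐ[T] Matrix (Fin n) (Fin n) M)
    (N : Q → Matrix (Fin n) (Fin n) M) (hN : ∀ σ, (N σ).det ≠ 0) (hN1 : N 1 = 1)
    (hNθ : ∀ σ d, N σ * (θ d).map (σ : M ≃ₐ[T] M) = θ d * N σ)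
    (c : Q → Q → M) (hc : ∀ σ τ, c σ τ ≠ 0)
    (hNc : ∀ σ τ, N σ * (N τ).map (σ : M ≃ₐ[T] M) = c σ τ • N (σ * τ))
    {Y : Type} [AddCommGroup Y] [Module M Y] [FiniteDimensional M Y] (s : Q → Y →+ Y)
    (hs : ∀ (σ : Q) (m : M) x, s σ (m • x) = (σ : M ≃ₐ[T] M) m • s σ x)
    (hs1 : ∀ x, s 1 x = x)
    (u : ℕ) (hu : ¬ p ∣ u)
    (hsc : ∀ σ τ x, s σ (s τ x) = (c σ τ) ^ u • s (σ * τ) x)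
    (k : ℕ) (hk : p ^ k ∣ finrank T D) : p ^ k ∣ Q.index * (n * finrank M Y) := by
  rcases Nat.eq_zero_or_pos (finrank M Y) with h0 | hpos
  · simp [h0]
  let b := finBasis M Y
  let A : Q → Matrix (Fin (finrank M Y)) (Fin (finrank M Y)) M := fun σ i j => b.repr (s σ (b j)) i
  have hsb : ∀ σ j, s σ (b j) = ∑ i, A σ i j • b i := fun σ j => (b.sum_repr (s σ (b j))).symm
  have hA1 : A 1 = 1 := by
    ext i j
    simp [A, hs1, Matrix.one_apply, Finsupp.single_apply, eq_comm]
  have hAc : ∀ σ τ, A σ * (A τ).map (σ : M ≃ₐ[T] M) = (c σ τ) ^ u • A (σ * τ) := by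
    intro σ τ
    ext i j
    have h := hsc σ τ (b j)
    rw [hsb τ, map_sum] at h
    simp_rw [hs] at h
    have h2 := congrArg (fun v => b.repr v i) h
    simp only [map_sum, map_smul, Finsupp.coe_finset_sum, Finset.sum_apply, Finsupp.smul_apply, smul_eq_mul] at h2
    rw [Matrix.mul_apply, Matrix.smul_apply, smul_eq_mul]
    rw [show A (σ * τ) i j = b.repr (s (σ * τ) (b j)) i from rfl, ← h2]
    refine Finset.sum_congr rfl fun k _ => ?_
    rw [Matrix.map_apply, mul_comm]
  refine twisted_dvd Q p hp hQ n θ N hN hN1 hNθ c hc hNc (finrank M Y) A ?_ hA1 u hu hAc k hk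
  intro σ h0
  have h := congrArg Matrix.det (hAc σ σ⁻¹)
  rw [Matrix.det_mul, h0, zero_mul, mul_inv_cancel, hA1, Matrix.det_smul, Matrix.det_one, mul_one] at h
  exact pow_ne_zero _ (pow_ne_zero _ (hc _ _)) h.symm

end CE

namespace CE

set_option linter.unusedSectionVars false
set_option linter.unusedVariables false
set_option linter.style.longLine false

open Module

/-- separating weights by a point of the torus -/
theorem exists_separating {M X : Type} [Field M] [Infinite M] [Fintype X] (W : Finset (X → ℕ)) :
    ∃ l : X → M, (∀ x, l x ≠ 0) ∧ Set.InjOn (fun a : X → ℕ => ∏ x, l x ^ a x) W := by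
  classical
  let mon : (X → ℕ) → MvPolynomial X M := fun a => MvPolynomial.monomial (Finsupp.equivFunOnFinite.symm a) 1
  let F : MvPolynomial X M := (∏ x, MvPolynomial.X x) * ∏ ab ∈ (W ×ˢ W).filter (fun ab => ab.1 ≠ ab.2), (mon ab.1 - mon ab.2)
  have hF : F ≠ 0 := by
    apply mul_ne_zero
    · exact Finset.prod_ne_zero_iff.2 fun x _ => MvPolynomial.X_ne_zero x
    · refine Finset.prod_ne_zero_iff.2 fun ab hab => ?_
      have hne := (Finset.mem_filter.1 hab).2
      intro h
      rw [sub_eq_zero] at h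
      have := MvPolynomial.monomial_left_injective (one_ne_zero (α := M)) h
      exact hne (Finsupp.equivFunOnFinite.symm.injective this)
  have : ∃ l, MvPolynomial.eval l F ≠ 0 := by
    by_contra! h
    exact hF (MvPolynomial.funext (by simpa using h))
  obtain ⟨l, hl⟩ := this
  have hm : ∀ a, MvPolynomial.eval l (mon a) = ∏ x, l x ^ a x := by
    intro a
    simp [mon, MvPolynomial.eval_monomial, Finsupp.prod_fintype]
  simp only [F, map_mul, map_prod, MvPolynomial.eval_X, map_sub] at hl
  refine ⟨l, fun x h0 => hl ?_, fun a ha b hb hab => ?_⟩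
  · rw [Finset.prod_eq_zero (Finset.mem_univ x) h0, zero_mul]
  · by_contra hne
    apply hl
    rw [Finset.prod_eq_zero (i := (a, b)) (Finset.mem_filter.2 ⟨Finset.mk_mem_product ha hb, hne⟩), mul_zero]
    rw [hm, hm, sub_eq_zero]; exact hab

section eig
variable {M R α : Type} [Field M] [AddCommGroup R] [Module M R]

theorem eig_mem (f : R →ₗ[M] R) (J : Submodule M R) (hJ : ∀ r ∈ J, f r ∈ J) (W : Finset α)
    (wt : α → Submodule M R) (χ : α → M) (hχ : Set.InjOn χ W) (hf : ∀ a, ∀ r ∈ wt a, f r = χ a • r)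
    (hJW : J ≤ ⨆ a ∈ W, wt a) : J ≤ ⨆ a ∈ W, (J ⊓ wt a) := by
  classical
  have hpoly : ∀ (P : Polynomial M), ∀ r ∈ J, Polynomial.aeval f P r ∈ J := by
    intro P r hr
    induction P using Polynomial.induction_on' with
    | add p q hp hq => rw [map_add]; exact J.add_mem hp hq
    | monomial k a =>
      rw [Polynomial.aeval_monomial]
      have : ∀ k, (f ^ k) r ∈ J := by
        intro k
        induction k with
        | zero => simpa using hr
        | succ k ih => rw [pow_succ']; exact hJ _ ih
      simpa [Module.algebraMap_end_apply] using J.smul_mem a (this k)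
  intro r hr
  have h1 := hJW hr
  rw [Submodule.mem_iSup_finset_iff_exists_sum] at h1
  obtain ⟨μ, hμ⟩ := h1
  have hpe : ∀ (P : Polynomial M) (b : α) (x) (hx : x ∈ wt b), Polynomial.aeval f P x = (P.eval (χ b)) • x := by
    intro P b x hx
    by_cases h0 : x = 0
    · simp [h0]
    · exact Module.End.aeval_apply_of_hasEigenvector ⟨Module.End.mem_eigenspace_iff.2 (hf b x hx), h0⟩
  have hcomp : ∀ a ∈ W, (μ a : R) ∈ J := by
    intro a ha
    have h2 := hpoly (Lagrange.basis W χ a) r hr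
    rw [← hμ, map_sum] at h2
    rw [Finset.sum_eq_single a] at h2
    · rw [hpe _ a _ (μ a).2, Lagrange.eval_basis_self hχ ha, one_smul] at h2
      exact h2
    · intro b hb hba
      rw [hpe _ b _ (μ b).2, Lagrange.eval_basis_of_ne hba.symm hb, zero_smul]
    · exact fun h => absurd ha h
  rw [← hμ]
  refine Submodule.sum_mem _ fun a ha => ?_
  exact Submodule.mem_iSup_of_mem a (Submodule.mem_iSup_of_mem ha ⟨hcomp a ha, (μ a).2⟩)

theorem eig_finrank (f : R →ₗ[M] R) (W : Finset α) (Ja : α → Submodule M R) [∀ a, FiniteDimensional M (Ja a)]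
    (χ : α → M) (hχ : Set.InjOn χ W) (hf : ∀ a, ∀ r ∈ Ja a, f r = χ a • r) :
    finrank M (⨆ a ∈ W, Ja a : Submodule M R) = ∑ a ∈ W, finrank M (Ja a) := by
  classical
  induction W using Finset.induction_on with
  | empty =>
    have h0 : (⨆ a ∈ (∅ : Finset α), Ja a : Submodule M R) = ⊥ := by simp
    rw [h0]; simp
  | insert a W ha ih =>
    rw [Finset.sum_insert ha, ← ih (hχ.mono (by simp)), Finset.iSup_insert]
    have hfin : FiniteDimensional M (⨆ a ∈ W, Ja a : Submodule M R) := by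
      exact Submodule.finiteDimensional_finset_sup W Ja |> fun h => by rwa [Finset.sup_eq_iSup] at h
    rw [← Submodule.finrank_sup_add_finrank_inf_eq]
    suffices h : (Ja a ⊓ ⨆ a ∈ W, Ja a : Submodule M R) = ⊥ by rw [h]; simp
    rw [eq_bot_iff]
    have h1 := (Module.End.eigenspaces_iSupIndep f) (χ a)
    have h2 : (⨆ b ∈ W, Ja b : Submodule M R) ≤ ⨆ (j : M) (_ : j ≠ χ a), Module.End.eigenspace f j := by
      refine iSup₂_le fun b hb => ?_
      have hne : χ b ≠ χ a := by
        intro h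
        have := hχ (by simp [hb]) (by simp) h
        exact ha (this ▸ hb)
      refine le_trans ?_ (le_iSup₂_of_le (χ b) hne le_rfl)
      exact fun r hr => Module.End.mem_eigenspace_iff.2 (hf b r hr)
    exact (h1.mono (fun r hr => Module.End.mem_eigenspace_iff.2 (hf a r hr)) h2).le_bot
end eig

end CE

namespace CE

set_option linter.unusedSectionVars false
set_option linter.unusedVariables false
set_option linter.style.longLine false

open Module

section claim
variable {T M : Type} [Field T] [Field M] [Algebra T M]
  {D : Type} [DivisionRing D] [Algebra T D] {n : ℕ}

/-- Block monomial matrices compatible with the twisted block representation. -/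
structure AdmB (θ : D →ₐ[T] Matrix (Fin n) (Fin n) M) {S : Type} (σ : M ≃ₐ[T] M)
    (π : Equiv.Perm ((M ≃ₐ[T] M) × S)) (B : (M ≃ₐ[T] M) × S → Matrix (Fin n) (Fin n) M) : Prop where
  det : ∀ ξ, (B ξ).det ≠ 0
  comm : ∀ d ξ, B ξ * (θ d).map (σ * ξ.1) = (θ d).map (π ξ).1 * B ξ

/-- Abstract semilinear operators with a weight grading. -/
structure OpData (T M : Type) [Field T] [Field M] [Algebra T M] (n : ℕ) (S : Type) [Fintype S] [Fintype (M ≃ₐ[T] M)]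
    (R : Type) [AddCommGroup R] [Module M R] where
  op : (M ≃ₐ[T] M) → Equiv.Perm ((M ≃ₐ[T] M) × S) → ((M ≃ₐ[T] M) × S → Matrix (Fin n) (Fin n) M) → R →+ R
  op_smul : ∀ σ π B (m : M) r, op σ π B (m • r) = σ m • op σ π B r
  op_op : ∀ σ π B τ ρ C r, op σ π B (op τ ρ C r) = op (σ * τ) (π * ρ) (fun ξ => B (ρ ξ) * (C ξ).map σ) r
  op_one : ∀ r, op 1 1 (fun _ => 1) r = r
  wt : ((M ≃ₐ[T] M) × S → ℕ) → Submodule M R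
  wt_map : ∀ σ π B a, ∀ r ∈ wt a, op σ π B r ∈ wt (a ∘ π.symm)
  wt_diag : ∀ (l : (M ≃ₐ[T] M) × S → M), (∀ ξ, l ξ ≠ 0) → ∀ a, ∀ r ∈ wt a, op 1 1 (fun ξ => l ξ • 1) r = (∏ ξ, l ξ ^ a ξ) • r

theorem map_map_mul (σ τ : M ≃ₐ[T] M) (A : Matrix (Fin n) (Fin n) M) :
    (A.map τ).map σ = A.map (σ * τ) := by ext; simp

theorem det_map_ne {σ : M ≃ₐ[T] M} {A : Matrix (Fin n) (Fin n) M} (h : A.det ≠ 0) : (A.map σ).det ≠ 0 := by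
  have : (A.map σ).det = σ A.det := (AlgEquiv.map_det σ A).symm
  rw [this]; simpa using h

theorem mat_map_mul (σ : M ≃ₐ[T] M) (A B : Matrix (Fin n) (Fin n) M) :
    (A * B).map σ = A.map σ * B.map σ := Matrix.map_mul

theorem AdmB.inv {θ : D →ₐ[T] Matrix (Fin n) (Fin n) M} {S : Type} {σ : M ≃ₐ[T] M}
    {π : Equiv.Perm ((M ≃ₐ[T] M) × S)} {B : (M ≃ₐ[T] M) × S → Matrix (Fin n) (Fin n) M} (h : AdmB θ σ π B) :
    AdmB θ σ⁻¹ π⁻¹ (fun ξ => ((B (π⁻¹ ξ))⁻¹).map (σ⁻¹ : M ≃ₐ[T] M)) := by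
  have hu : ∀ ξ, IsUnit (B ξ).det := fun ξ => isUnit_iff_ne_zero.2 (h.det ξ)
  refine ⟨fun ξ => det_map_ne ?_, fun d ξ => ?_⟩
  · rw [Matrix.det_nonsing_inv]
    exact (IsUnit.ringInverse (hu _)).ne_zero
  · have h1 := h.comm d (π⁻¹ ξ)
    set η := π⁻¹ ξ with hη
    have hξ : ξ = π η := by simp [hη]
    rw [hξ]
    have h2 : (B η)⁻¹ * (θ d).map (π η).1 = (θ d).map (σ * η.1) * (B η)⁻¹ := by
      calc (B η)⁻¹ * (θ d).map (π η).1 = (B η)⁻¹ * ((θ d).map (π η).1 * B η) * (B η)⁻¹ := by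
            rw [mul_assoc, mul_assoc, Matrix.mul_nonsing_inv _ (hu η), mul_one]
        _ = _ := by rw [← h1, ← mul_assoc, Matrix.nonsing_inv_mul _ (hu η), one_mul]
    have h3 := congrArg (fun A => A.map (σ⁻¹ : M ≃ₐ[T] M)) h2
    simp only [mat_map_mul, map_map_mul] at h3
    rw [h3]
    simp

variable (θ : D →ₐ[T] Matrix (Fin n) (Fin n) M) (GK : Subgroup (M ≃ₐ[T] M))
  (hSN : ∀ h ∈ GK, ∃ N : Matrix (Fin n) (Fin n) M, N.det ≠ 0 ∧ ∀ d, N * θ d = (θ d).map h * N)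

theorem exists_intertwiner
    (hSN : ∀ h ∈ GK, ∃ N : Matrix (Fin n) (Fin n) M, N.det ≠ 0 ∧ ∀ d, N * θ d = (θ d).map h * N)
    (g g' : M ≃ₐ[T] M) (h : g⁻¹ * g' ∈ GK) :
    ∃ N : Matrix (Fin n) (Fin n) M, N.det ≠ 0 ∧ ∀ d, N * (θ d).map g = (θ d).map g' * N := by
  obtain ⟨N, hN, hN'⟩ := hSN _ h
  refine ⟨N.map g, det_map_ne hN, fun d => ?_⟩
  have h3 := congrArg (fun A => A.map g) (hN' d)
  simp only [mat_map_mul, map_map_mul] at h3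
  simpa using h3

theorem perm_adm
    (hSN : ∀ h ∈ GK, ∃ N : Matrix (Fin n) (Fin n) M, N.det ≠ 0 ∧ ∀ d, N * θ d = (θ d).map h * N)
    {S : Type} (σ : M ≃ₐ[T] M) (π : Equiv.Perm ((M ≃ₐ[T] M) × S))
    (h : ∀ ξ, (σ * ξ.1)⁻¹ * (π ξ).1 ∈ GK) : ∃ B, AdmB θ σ π B := by
  choose B hB hB' using fun ξ => exists_intertwiner θ GK hSN _ _ (h ξ)
  exact ⟨B, hB, fun d ξ => hB' ξ d⟩

variable {S : Type} [Fintype S] [Fintype (M ≃ₐ[T] M)] {R : Type} [AddCommGroup R] [Module M R]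
  (O : OpData T M n S R) (J : Submodule M R) 
  (hJ : ∀ σ π B, AdmB θ σ π B → ∀ r ∈ J, O.op σ π B r ∈ J)

theorem OpData.op_inv {θ : D →ₐ[T] Matrix (Fin n) (Fin n) M} (O : OpData T M n S R) {σ : M ≃ₐ[T] M}
    {π : Equiv.Perm ((M ≃ₐ[T] M) × S)} {B : (M ≃ₐ[T] M) × S → Matrix (Fin n) (Fin n) M} (h : AdmB θ σ π B) (r : R) :
    O.op σ⁻¹ π⁻¹ (fun ξ => ((B (π⁻¹ ξ))⁻¹).map (σ⁻¹ : M ≃ₐ[T] M)) (O.op σ π B r) = r := by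
  have hu : ∀ ξ, IsUnit (B ξ).det := fun ξ => isUnit_iff_ne_zero.2 (h.det ξ)
  rw [O.op_op]
  convert O.op_one r using 4
  · simp
  · simp
  · rename_i ξ
    rw [← mat_map_mul]
    simp [Matrix.nonsing_inv_mul _ (hu ξ)]

theorem OpData.op_inv' {θ : D →ₐ[T] Matrix (Fin n) (Fin n) M} (O : OpData T M n S R) {σ : M ≃ₐ[T] M}
    {π : Equiv.Perm ((M ≃ₐ[T] M) × S)} {B : (M ≃ₐ[T] M) × S → Matrix (Fin n) (Fin n) M} (h : AdmB θ σ π B) (r : R) :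
    O.op σ π B (O.op σ⁻¹ π⁻¹ (fun ξ => ((B (π⁻¹ ξ))⁻¹).map (σ⁻¹ : M ≃ₐ[T] M)) r) = r := by
  have hu : ∀ ξ, IsUnit (B ξ).det := fun ξ => isUnit_iff_ne_zero.2 (h.det ξ)
  rw [O.op_op]
  convert O.op_one r using 4
  · simp
  · simp
  · rename_i ξ
    rw [map_map_mul, mul_inv_cancel]
    have : ((B (π⁻¹ ξ))⁻¹).map (1 : M ≃ₐ[T] M) = (B (π⁻¹ ξ))⁻¹ := by ext; simp
    rw [this, Matrix.mul_nonsing_inv _ (hu _)]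

theorem finrank_wt_eq
    (hJ : ∀ σ π B, AdmB θ σ π B → ∀ r ∈ J, O.op σ π B r ∈ J)
    {σ : M ≃ₐ[T] M} {π : Equiv.Perm ((M ≃ₐ[T] M) × S)}
    {B : (M ≃ₐ[T] M) × S → Matrix (Fin n) (Fin n) M} (h : AdmB θ σ π B) (a : (M ≃ₐ[T] M) × S → ℕ) :
    finrank M (J ⊓ O.wt (a ∘ π.symm) : Submodule M R) = finrank M (J ⊓ O.wt a : Submodule M R) := by
  let e : (J ⊓ O.wt a : Submodule M R) ≃+ (J ⊓ O.wt (a ∘ π.symm) : Submodule M R) :=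
    { toFun := fun r => ⟨O.op σ π B r, hJ _ _ _ h _ r.2.1, O.wt_map _ _ _ _ _ r.2.2⟩
      invFun := fun r => ⟨O.op σ⁻¹ π⁻¹ (fun ξ => ((B (π⁻¹ ξ))⁻¹).map (σ⁻¹ : M ≃ₐ[T] M)) r, hJ _ _ _ h.inv _ r.2.1, by
        have := O.wt_map σ⁻¹ π⁻¹ (fun ξ => ((B (π⁻¹ ξ))⁻¹).map (σ⁻¹ : M ≃ₐ[T] M)) _ _ r.2.2
        have e1 : (a ∘ ⇑(Equiv.symm π)) ∘ ⇑(Equiv.symm π⁻¹) = a := by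
          ext x; exact congrArg a (π.symm_apply_apply x)
        rwa [e1] at this⟩
      left_inv := fun r => Subtype.ext (O.op_inv h _)
      right_inv := fun r => Subtype.ext (O.op_inv' h _)
      map_add' := fun r r' => Subtype.ext (by simp) }
  symm
  unfold finrank
  congr 1
  exact rank_eq_of_equiv_equiv σ e σ.bijective (fun m r => Subtype.ext (by
    exact O.op_smul σ π B m r))

end claim
end CE

namespace CE

set_option linter.unusedSectionVars false
set_option linter.unusedVariables false
set_option linter.style.longLine false

open Module

section claim
variable {T M : Type} [Field T] [Field M] [Algebra T M]
  {D : Type} [DivisionRing D] [Algebra T D] {n : ℕ}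

variable (θ : D →ₐ[T] Matrix (Fin n) (Fin n) M) (GK : Subgroup (M ≃ₐ[T] M))
  (hSN : ∀ h ∈ GK, ∃ N : Matrix (Fin n) (Fin n) M, N.det ≠ 0 ∧ ∀ d, N * θ d = (θ d).map h * N)
  (hSc : ∀ A : Matrix (Fin n) (Fin n) M, (∀ d, A * θ d = θ d * A) → ∃ c : M, A = c • 1)

variable {S : Type} [Fintype S] [Fintype (M ≃ₐ[T] M)] {R : Type} [AddCommGroup R] [Module M R]
  (O : OpData T M n S R) (J : Submodule M R) [FiniteDimensional M J] [Infinite M]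
  (hJ : ∀ σ π B, AdmB θ σ π B → ∀ r ∈ J, O.op σ π B r ∈ J)

/-- the diagonal operator as a linear map -/
def OpData.lin (O : OpData T M n S R) (l : (M ≃ₐ[T] M) × S → M) : R →ₗ[M] R :=
  { toFun := O.op 1 1 (fun ξ => l ξ • 1)
    map_add' := map_add _
    map_smul' := fun m r => by rw [O.op_smul]; rfl }

theorem finrank_iSup_wt (W : Finset ((M ≃ₐ[T] M) × S → ℕ)) :
    finrank M (⨆ a ∈ W, (J ⊓ O.wt a) : Submodule M R) = ∑ a ∈ W, finrank M (J ⊓ O.wt a : Submodule M R) := by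
  obtain ⟨l, hl0, hl⟩ := exists_separating (M := M) W
  have : ∀ a, FiniteDimensional M (J ⊓ O.wt a : Submodule M R) := fun a =>
    Submodule.finiteDimensional_of_le inf_le_left
  exact eig_finrank (O.lin l) W (fun a => J ⊓ O.wt a) _ hl (fun a r hr => O.wt_diag l hl0 a r hr.2)

theorem finrank_eq_sum_wt
    (hJ : ∀ σ π B, AdmB θ σ π B → ∀ r ∈ J, O.op σ π B r ∈ J)
    (W : Finset ((M ≃ₐ[T] M) × S → ℕ)) (hW : J ≤ ⨆ a ∈ W, O.wt a) :
    finrank M J = ∑ a ∈ W, finrank M (J ⊓ O.wt a : Submodule M R) := by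
  rw [← finrank_iSup_wt]
  obtain ⟨l, hl0, hl⟩ := exists_separating (M := M) W
  have h1 : J ≤ ⨆ a ∈ W, (J ⊓ O.wt a) := by
    refine eig_mem (O.lin l) J (fun r hr => hJ 1 1 _ ⟨?_, ?_⟩ r hr) W O.wt _ hl (fun a r hr => O.wt_diag l hl0 a r hr) hW
    · intro ξ; simp [Matrix.det_smul, hl0]
    · intro d ξ; simp
  have h2 : J = ⨆ a ∈ W, (J ⊓ O.wt a) := le_antisymm h1 (iSup₂_le fun _ _ => inf_le_left)
  exact congrArg (fun A : Submodule M R => finrank M A) h2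

/-- the permutation which is trivial over one coset and translation elsewhere -/
noncomputable def piJ (GK : Subgroup (M ≃ₐ[T] M)) (S : Type) (g₀ σ : M ≃ₐ[T] M) (hσ : g₀⁻¹ * σ * g₀ ∈ GK) :
    Equiv.Perm ((M ≃ₐ[T] M) × S) := by
  classical
  have key : ∀ x, g₀⁻¹ * (σ * x) ∈ GK ↔ g₀⁻¹ * x ∈ GK := by
    intro x
    have : g₀⁻¹ * (σ * x) = (g₀⁻¹ * σ * g₀) * (g₀⁻¹ * x) := by group
    rw [this, Subgroup.mul_mem_cancel_left _ hσ]
  have key' : ∀ x, g₀⁻¹ * (σ⁻¹ * x) ∈ GK ↔ g₀⁻¹ * x ∈ GK := by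
    intro x
    rw [← key (σ⁻¹ * x)]; simp
  exact
  { toFun := fun ξ => if g₀⁻¹ * ξ.1 ∈ GK then ξ else (σ * ξ.1, ξ.2)
    invFun := fun ξ => if g₀⁻¹ * ξ.1 ∈ GK then ξ else (σ⁻¹ * ξ.1, ξ.2)
    left_inv := by
      intro ξ
      by_cases h : g₀⁻¹ * ξ.1 ∈ GK
      · simp [h]
      · simp [h, key]
    right_inv := by
      intro ξ
      by_cases h : g₀⁻¹ * ξ.1 ∈ GK
      · simp [h]
      · simp [h, key'] }

theorem piJ_apply_mem {g₀ σ : M ≃ₐ[T] M} {hσ : g₀⁻¹ * σ * g₀ ∈ GK} {ξ : (M ≃ₐ[T] M) × S} (h : g₀⁻¹ * ξ.1 ∈ GK) :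
    piJ GK S g₀ σ hσ ξ = ξ := by
  simp [piJ, h]

theorem piJ_apply_not_mem {g₀ σ : M ≃ₐ[T] M} {hσ : g₀⁻¹ * σ * g₀ ∈ GK} {ξ : (M ≃ₐ[T] M) × S} (h : ¬ g₀⁻¹ * ξ.1 ∈ GK) :
    piJ GK S g₀ σ hσ ξ = (σ * ξ.1, ξ.2) := by
  simp [piJ, h]

theorem piJ_mem {g₀ σ : M ≃ₐ[T] M} {hσ : g₀⁻¹ * σ * g₀ ∈ GK} {ξ : (M ≃ₐ[T] M) × S} :
    g₀⁻¹ * (piJ GK S g₀ σ hσ ξ).1 ∈ GK ↔ g₀⁻¹ * ξ.1 ∈ GK := by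
  by_cases h : g₀⁻¹ * ξ.1 ∈ GK
  · rw [piJ_apply_mem _ h]
  · rw [piJ_apply_not_mem _ h]
    have : g₀⁻¹ * (σ * ξ.1) = (g₀⁻¹ * σ * g₀) * (g₀⁻¹ * ξ.1) := by group
    rw [this, Subgroup.mul_mem_cancel_left _ hσ]

variable [FiniteDimensional T M] [IsGalois T M] [FiniteDimensional T D]

set_option maxHeartbeats 1000000 in
theorem claim_d
    (hSN : ∀ h ∈ GK, ∃ N : Matrix (Fin n) (Fin n) M, N.det ≠ 0 ∧ ∀ d, N * θ d = (θ d).map h * N)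
    (hSc : ∀ A : Matrix (Fin n) (Fin n) M, (∀ d, A * θ d = θ d * A) → ∃ c : M, A = c • 1)
    (hJ : ∀ σ π B, AdmB θ σ π B → ∀ r ∈ J, O.op σ π B r ∈ J)
    (p : ℕ) (hp : p.Prime) (Q : Subgroup (M ≃ₐ[T] M)) (hQ : IsPGroup p Q)
    (g₀ : M ≃ₐ[T] M) (hQg : ∀ σ ∈ Q, g₀⁻¹ * σ * g₀ ∈ GK) (uj : ℕ) (huj : ¬ p ∣ uj)
    (W : Finset ((M ≃ₐ[T] M) × S → ℕ))
    (hW : ∀ a ∈ W, ∀ σ (hσ : σ ∈ Q), a ∘ (piJ GK S g₀ σ (hQg σ hσ)).symm ∈ W)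
    (hWu : ∀ a ∈ W, ∀ [DecidablePred fun ξ : (M ≃ₐ[T] M) × S => g₀⁻¹ * ξ.1 ∈ GK], ∑ ξ with g₀⁻¹ * ξ.1 ∈ GK, a ξ = uj)
    (k : ℕ) (hk : p ^ k ∣ finrank T D) :
    p ^ k ∣ Q.index * (n * ∑ a ∈ W, finrank M (J ⊓ O.wt a : Submodule M R)) := by
  classical
  -- intertwiners over the coset
  have hN : ∀ σ : Q, ∃ N : Matrix (Fin n) (Fin n) M, N.det ≠ 0 ∧ (σ = 1 → N = 1) ∧
      ∀ d, N * (θ d).map ((σ : M ≃ₐ[T] M) * g₀) = (θ d).map g₀ * N := by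
    intro σ
    by_cases h : σ = 1
    · subst h; exact ⟨1, by simp, fun _ => rfl, fun d => by simp⟩
    · obtain ⟨N, h1, h2⟩ := exists_intertwiner θ GK hSN ((σ : M ≃ₐ[T] M) * g₀) g₀ (by
        have := GK.inv_mem (hQg σ σ.2)
        convert this using 1; group)
      exact ⟨N, h1, fun h' => absurd h' h, h2⟩
  choose N hNd hN1 hNθ using hN
  have hK : ∀ ξ : (M ≃ₐ[T] M) × S, ∃ K : Matrix (Fin n) (Fin n) M, K.det ≠ 0 ∧
      (g₀⁻¹ * ξ.1 ∈ GK → ∀ d, K * (θ d).map g₀ = (θ d).map ξ.1 * K) := by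
    intro ξ
    by_cases h : g₀⁻¹ * ξ.1 ∈ GK
    · obtain ⟨K, h1, h2⟩ := exists_intertwiner θ GK hSN g₀ ξ.1 h
      exact ⟨K, h1, fun _ => h2⟩
    · exact ⟨1, by simp, fun h' => absurd h' h⟩
  choose K hKd hKθ using hK
  have uN : ∀ σ, IsUnit (N σ).det := fun σ => isUnit_iff_ne_zero.2 (hNd σ)
  have uK : ∀ ξ, IsUnit (K ξ).det := fun σ => isUnit_iff_ne_zero.2 (hKd σ)
  have uKm : ∀ (σ : M ≃ₐ[T] M) ξ, IsUnit ((K ξ).map σ).det := fun σ ξ => isUnit_iff_ne_zero.2 (det_map_ne (hKd ξ))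
  -- the cocycle
  have hc : ∀ σ τ : Q, ∃ c : M, N σ * (N τ).map (σ : M ≃ₐ[T] M) = c • N (σ * τ) := by
    intro σ τ
    set A := N σ * (N τ).map (σ : M ≃ₐ[T] M) * (N (σ * τ))⁻¹ with hA
    have h1 : ∀ d, A * (θ d).map g₀ = (θ d).map g₀ * A := by
      intro d
      have e1 : (N (σ * τ))⁻¹ * (θ d).map g₀ = (θ d).map ((σ : M ≃ₐ[T] M) * (τ : M ≃ₐ[T] M) * g₀) * (N (σ * τ))⁻¹ := by
        calc (N (σ * τ))⁻¹ * (θ d).map g₀ = (N (σ * τ))⁻¹ * ((θ d).map g₀ * N (σ * τ)) * (N (σ * τ))⁻¹ := by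
              rw [mul_assoc, mul_assoc, Matrix.mul_nonsing_inv _ (uN _), mul_one]
          _ = _ := by rw [← hNθ, ← mul_assoc, Matrix.nonsing_inv_mul _ (uN _), one_mul]; rfl
      have e2 : (N τ).map (σ : M ≃ₐ[T] M) * (θ d).map ((σ : M ≃ₐ[T] M) * (τ : M ≃ₐ[T] M) * g₀) = (θ d).map ((σ : M ≃ₐ[T] M) * g₀) * (N τ).map (σ : M ≃ₐ[T] M) := by
        have h3 := congrArg (fun A => A.map (σ : M ≃ₐ[T] M)) (hNθ τ d)
        simp only [mat_map_mul, map_map_mul, ← mul_assoc] at h3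
        exact h3
      calc A * (θ d).map g₀ = N σ * ((N τ).map (σ : M ≃ₐ[T] M) * ((N (σ * τ))⁻¹ * (θ d).map g₀)) := by
            rw [hA]; simp only [mul_assoc]
        _ = N σ * (θ d).map ((σ : M ≃ₐ[T] M) * g₀) * (N τ).map (σ : M ≃ₐ[T] M) * (N (σ * τ))⁻¹ := by
            rw [e1, ← mul_assoc ((N τ).map _), e2]; simp only [mul_assoc]
        _ = _ := by rw [hNθ, hA]; simp only [mul_assoc]
    obtain ⟨c, hc⟩ := hSc (A.map (g₀⁻¹ : M ≃ₐ[T] M)) (fun d => by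
      have h3 := congrArg (fun A => A.map (g₀⁻¹ : M ≃ₐ[T] M)) (h1 d)
      have e4 : (θ d).map (1 : M ≃ₐ[T] M) = θ d := by ext; simp
      simp only [mat_map_mul, map_map_mul, inv_mul_cancel, e4] at h3
      exact h3)
    have hA' : A = g₀ c • 1 := by
      have h3 := congrArg (fun A => A.map g₀) hc
      simp only [map_map_mul] at h3
      have e3 : A.map ((g₀ : M ≃ₐ[T] M) * g₀⁻¹) = A := by ext; simp
      rw [e3] at h3
      rw [h3]; ext i j; simp [Matrix.one_apply, apply_ite g₀]
    refine ⟨g₀ c, ?_⟩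
    calc N σ * (N τ).map (σ : M ≃ₐ[T] M) = A * N (σ * τ) := by
          rw [hA, mul_assoc _ (N (σ * τ))⁻¹, Matrix.nonsing_inv_mul _ (uN _), mul_one]
      _ = _ := by rw [hA', smul_mul_assoc, one_mul]
  choose c hcN using hc
  have hc0 : ∀ σ τ, c σ τ ≠ 0 ∨ n = 0 := by
    intro σ τ
    by_contra! h
    have h1 := congrArg Matrix.det (hcN σ τ)
    rw [Matrix.det_mul, Matrix.det_smul, h.1, Fintype.card_fin, zero_pow h.2, zero_mul] at h1
    exact mul_ne_zero (hNd σ) (det_map_ne (hNd τ)) h1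
  rcases Nat.eq_zero_or_pos n with h0 | hn
  · simp [h0]
  replace hc0 : ∀ σ τ, c σ τ ≠ 0 := fun σ τ => (hc0 σ τ).resolve_right hn.ne'
  -- block matrices
  let π : Q → Equiv.Perm ((M ≃ₐ[T] M) × S) := fun σ => piJ GK S g₀ σ (hQg σ σ.2)
  let B : Q → (M ≃ₐ[T] M) × S → Matrix (Fin n) (Fin n) M := fun σ ξ =>
    if g₀⁻¹ * ξ.1 ∈ GK then K ξ * N σ * ((K ξ).map (σ : M ≃ₐ[T] M))⁻¹ else 1
  have hadm : ∀ σ : Q, AdmB θ σ (π σ) (B σ) := by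
    intro σ
    refine ⟨fun ξ => ?_, fun d ξ => ?_⟩
    · by_cases h : g₀⁻¹ * ξ.1 ∈ GK
      · simp only [B, h, if_true, Matrix.det_mul]
        refine mul_ne_zero (mul_ne_zero (hKd _) (hNd _)) ?_
        rw [Matrix.det_nonsing_inv]; exact (IsUnit.ringInverse (uKm _ _)).ne_zero
      · simp [B, h]
    · by_cases h : g₀⁻¹ * ξ.1 ∈ GK
      · simp only [B, h, if_true, π, piJ_apply_mem GK h]
        have e1 := hKθ ξ h d
        have e2 := congrArg (fun A => A.map (σ : M ≃ₐ[T] M)) e1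
        simp only [mat_map_mul, map_map_mul] at e2
        have e3 : ((K ξ).map (σ : M ≃ₐ[T] M))⁻¹ * (θ d).map ((σ : M ≃ₐ[T] M) * ξ.1) =
            (θ d).map ((σ : M ≃ₐ[T] M) * g₀) * ((K ξ).map (σ : M ≃ₐ[T] M))⁻¹ := by
          calc _ = ((K ξ).map (σ : M ≃ₐ[T] M))⁻¹ * ((θ d).map ((σ : M ≃ₐ[T] M) * ξ.1) * (K ξ).map (σ : M ≃ₐ[T] M)) * ((K ξ).map (σ : M ≃ₐ[T] M))⁻¹ := by
                rw [mul_assoc, mul_assoc, Matrix.mul_nonsing_inv _ (uKm _ _), mul_one]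
            _ = _ := by rw [← e2, ← mul_assoc, Matrix.nonsing_inv_mul _ (uKm _ _), one_mul]
        rw [mul_assoc, e3, ← mul_assoc, mul_assoc (K ξ), hNθ, ← mul_assoc, e1]
        simp only [mul_assoc]
      · simp only [B, h, if_false, π, piJ_apply_not_mem GK h, one_mul, mul_one]
  let Y : Submodule M R := ⨆ a ∈ W, (J ⊓ O.wt a)
  have hY : ∀ (P : R → Prop), P 0 → (∀ x y, P x → P y → P (x + y)) → (∀ a ∈ W, ∀ x ∈ J ⊓ O.wt a, P x) → ∀ y ∈ Y, P y := by
    intro P h0 hadd h y hy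
    simp only [Y] at hy
    rw [Submodule.mem_iSup_finset_iff_exists_sum] at hy
    obtain ⟨μ, rfl⟩ := hy
    exact Finset.sum_induction _ P hadd h0 (fun a ha => h a ha _ (μ a).2)
  have hsY : ∀ σ : Q, ∀ y ∈ Y, O.op σ (π σ) (B σ) y ∈ Y := by
    intro σ
    apply hY
    · simp
    · intro x y hx hy; rw [map_add]; exact Y.add_mem hx hy
    · intro a ha x hx
      exact Submodule.mem_iSup_of_mem _ (Submodule.mem_iSup_of_mem (hW a ha σ σ.2)
        ⟨hJ _ _ _ (hadm σ) x hx.1, O.wt_map _ _ _ _ _ hx.2⟩)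
  have hYJ : Y ≤ J := iSup₂_le fun _ _ => inf_le_left
  have : FiniteDimensional M Y := Submodule.finiteDimensional_of_le hYJ
  let s : Q → Y →+ Y := fun σ =>
    { toFun := fun y => ⟨O.op σ (π σ) (B σ) y, hsY σ y y.2⟩
      map_zero' := Subtype.ext (by simp)
      map_add' := fun x y => Subtype.ext (by simp) }
  rw [← finrank_iSup_wt]
  let θ' : D →ₐ[T] Matrix (Fin n) (Fin n) M := (AlgHom.mapMatrix (g₀ : M →ₐ[T] M)).comp θ
  have hθ' : ∀ d, θ' d = (θ d).map g₀ := fun d => rfl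
  refine twisted_dvd' Q p hp hQ n θ' N hNd (hN1 1 rfl) (fun σ d => ?_) c hc0 hcN s ?_ ?_ uj huj ?_ k hk
  · rw [hθ', map_map_mul]; exact hNθ σ d
  · intro σ m x; exact Subtype.ext (O.op_smul _ _ _ m x)
  · intro x
    refine Subtype.ext ?_
    change O.op 1 (π 1) (B 1) x = x
    have e1 : π 1 = 1 := by
      ext ξ : 1
      by_cases h : g₀⁻¹ * ξ.1 ∈ GK
      · simp only [π, piJ_apply_mem GK h]; rfl
      · simp only [π, piJ_apply_not_mem GK h]; simp
    have e2 : B 1 = fun _ => 1 := by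
      funext ξ
      by_cases h : g₀⁻¹ * ξ.1 ∈ GK
      · have : (K ξ).map (1 : M ≃ₐ[T] M) = K ξ := by ext; simp
        simp only [B, h, if_true, hN1 1 rfl, mul_one, OneMemClass.coe_one]
        rw [this, Matrix.mul_nonsing_inv _ (uK _)]
      · simp [B, h]
    rw [e1, e2, O.op_one]
  · intro σ τ x
    refine Subtype.ext ?_
    change O.op σ (π σ) (B σ) (O.op τ (π τ) (B τ) x) = c σ τ ^ uj • O.op (σ * τ : Q) (π (σ * τ)) (B (σ * τ)) x
    let l : (M ≃ₐ[T] M) × S → M := fun ξ => if g₀⁻¹ * ξ.1 ∈ GK then c σ τ else 1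
    have hl0 : ∀ ξ, l ξ ≠ 0 := by
      intro ξ; simp only [l]; split_ifs
      · exact hc0 σ τ
      · exact one_ne_zero
    have e1 : ∀ y ∈ Y, O.op 1 1 (fun ξ => l ξ • 1) y = c σ τ ^ uj • y := by
      apply hY
      · simp
      · intro x y hx hy; rw [map_add, hx, hy, smul_add]
      · intro a ha x hx
        rw [O.wt_diag l hl0 a x hx.2]
        congr 1
        rw [← hWu a ha, ← Finset.prod_pow_eq_pow_sum, Finset.prod_filter]
        refine Finset.prod_congr rfl fun ξ _ => ?_
        by_cases h : g₀⁻¹ * ξ.1 ∈ GK <;> simp [l, h]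
    rw [← e1 _ (hsY (σ * τ) x x.2), O.op_op, O.op_op]
    have e2 : π σ * π τ = 1 * π (σ * τ) := by
      ext ξ : 1
      rw [one_mul, Equiv.Perm.mul_apply]
      by_cases h : g₀⁻¹ * ξ.1 ∈ GK
      · simp only [π, piJ_apply_mem GK h]
      · have h' : ¬ g₀⁻¹ * (π τ ξ).1 ∈ GK := by simpa only [π, piJ_mem] using h
        have e3 : π τ ξ = (τ * ξ.1, ξ.2) := piJ_apply_not_mem GK h
        have e4 : π σ (π τ ξ) = (σ * (π τ ξ).1, (π τ ξ).2) := piJ_apply_not_mem GK h'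
        have e5 : π (σ * τ) ξ = ((σ * τ : Q) * ξ.1, ξ.2) := piJ_apply_not_mem GK h
        rw [e4, e3, e5]; simp [mul_assoc]
    have e3 : (fun ξ => B σ (π τ ξ) * (B τ ξ).map (σ : M ≃ₐ[T] M)) =
        fun ξ => l (π (σ * τ) ξ) • (1 : Matrix (Fin n) (Fin n) M) * (B (σ * τ) ξ).map (1 : M ≃ₐ[T] M) := by
      funext ξ
      have e0 : (B (σ * τ) ξ).map (1 : M ≃ₐ[T] M) = B (σ * τ) ξ := by ext; simp
      rw [e0, smul_mul_assoc, one_mul]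
      by_cases h : g₀⁻¹ * ξ.1 ∈ GK
      · have e1 : π τ ξ = ξ := piJ_apply_mem GK h
        have e2 : π (σ * τ) ξ = ξ := piJ_apply_mem GK h
        rw [e1, e2]
        have e4 : (((K ξ).map (τ : M ≃ₐ[T] M))⁻¹).map (σ : M ≃ₐ[T] M) = ((K ξ).map ((σ * τ : Q) : M ≃ₐ[T] M))⁻¹ := by
          symm
          apply Matrix.inv_eq_left_inv
          have : (K ξ).map ((σ * τ : Q) : M ≃ₐ[T] M) = ((K ξ).map (τ : M ≃ₐ[T] M)).map (σ : M ≃ₐ[T] M) := (map_map_mul _ _ _).symm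
          rw [this, ← mat_map_mul, Matrix.nonsing_inv_mul _ (uKm _ _)]
          ext i j; simp [Matrix.one_apply, apply_ite]
        simp only [B, h, if_true, l, mat_map_mul, e4]
        calc K ξ * N σ * ((K ξ).map (σ : M ≃ₐ[T] M))⁻¹ * ((K ξ).map (σ : M ≃ₐ[T] M) * (N τ).map (σ : M ≃ₐ[T] M) * ((K ξ).map ((σ * τ : Q) : M ≃ₐ[T] M))⁻¹)
            = K ξ * N σ * (((K ξ).map (σ : M ≃ₐ[T] M))⁻¹ * (K ξ).map (σ : M ≃ₐ[T] M)) * (N τ).map (σ : M ≃ₐ[T] M) * ((K ξ).map ((σ * τ : Q) : M ≃ₐ[T] M))⁻¹ := by simp only [mul_assoc]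
          _ = K ξ * (N σ * (N τ).map (σ : M ≃ₐ[T] M)) * ((K ξ).map ((σ * τ : Q) : M ≃ₐ[T] M))⁻¹ := by
              rw [Matrix.nonsing_inv_mul _ (uKm _ _)]; simp only [mul_assoc, one_mul]
          _ = _ := by rw [hcN, mul_smul_comm, smul_mul_assoc]
      · have h' : ¬ g₀⁻¹ * (π τ ξ).1 ∈ GK := by simpa only [π, piJ_mem] using h
        have h'' : ¬ g₀⁻¹ * (π (σ * τ) ξ).1 ∈ GK := by simpa only [π, piJ_mem] using h
        simp only [B, l, h, h', h'', if_false, one_smul, one_mul]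
        ext i j; simp [Matrix.one_apply, apply_ite]
    rw [e2, e3]
    simp

end claim
end CE

namespace CE

set_option linter.unusedSectionVars false
set_option linter.unusedVariables false
set_option linter.style.longLine false

open Module

theorem arith_dvd (p : ℕ) (hp : p.Prime) (k G n s δ gk i i0 iGQ c y : ℕ) (hG : G ≠ 0) (hn : n ≠ 0) (hs : s ≠ 0)
    (hδ : δ ≠ 0) (hgk : gk ≠ 0) (hk : p ^ k ∣ G * n * s) (hcard : G * n ^ 2 ∣ δ * gk)
    (hd : ∀ m, p ^ m ∣ δ → p ^ m ∣ iGQ * (n * y)) (hi : iGQ = i0 * i) (hi0 : ¬ p ∣ i0)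
    (hc : c = p ^ (gk * s).factorization p) : p ^ k ∣ c * (i * y) := by
  have : Fact p.Prime := ⟨hp⟩
  by_cases hy : y = 0
  · simp [hy]
  by_cases hii : i = 0
  · simp [hii]
  have hi00 : i0 ≠ 0 := by rintro rfl; simp at hi0
  have hc0 : c ≠ 0 := by rw [hc]; exact pow_ne_zero _ hp.ne_zero
  have h1 := hd (padicValNat p δ) pow_padicValNat_dvd
  rw [hi] at h1
  rw [padicValNat_dvd_iff_le (mul_ne_zero (mul_ne_zero hi00 hii) (mul_ne_zero hn hy)),
    padicValNat.mul (mul_ne_zero hi00 hii) (mul_ne_zero hn hy), padicValNat.mul hi00 hii,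
    padicValNat.mul hn hy, padicValNat.eq_zero_of_not_dvd hi0] at h1
  rw [padicValNat_dvd_iff_le (mul_ne_zero (mul_ne_zero hG hn) hs), padicValNat.mul (mul_ne_zero hG hn) hs,
    padicValNat.mul hG hn] at hk
  have h2 := (padicValNat_dvd_iff_le (p := p) (mul_ne_zero hδ hgk)).1 (pow_padicValNat_dvd.trans hcard)
  rw [padicValNat.mul hG (pow_ne_zero 2 hn), padicValNat.mul hδ hgk, padicValNat.pow] at h2
  have h3 : padicValNat p c = padicValNat p gk + padicValNat p s := by
    rw [hc, padicValNat.prime_pow, Nat.factorization_def _ hp, padicValNat.mul hgk hs]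
  rw [padicValNat_dvd_iff_le (mul_ne_zero hc0 (mul_ne_zero hii hy)), padicValNat.mul hc0 (mul_ne_zero hii hy),
    padicValNat.mul hii hy, h3]
  omega

section combi
variable {G S : Type} [Group G] [Fintype G] [Fintype S] (GK : Subgroup G)

open Classical in
/-- coset sums of a weight -/
noncomputable def cs (a : G × S → ℕ) : G ⧸ GK → ℕ := fun x => ∑ ξ with (ξ.1 : G ⧸ GK) = x, a ξ

theorem cs_perm (a : G × S → ℕ) (π : Equiv.Perm (G × S)) (e : Equiv.Perm (G ⧸ GK))
    (h : ∀ ξ, ((π ξ).1 : G ⧸ GK) = e (ξ.1 : G ⧸ GK)) (x : G ⧸ GK) :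
    cs GK (a ∘ π.symm) x = cs GK a (e.symm x) := by
  classical
  unfold cs
  symm
  refine Finset.sum_bij (fun ξ _ => π ξ) ?_ ?_ ?_ ?_
  · intro ξ hξ
    simp only [Finset.mem_filter, Finset.mem_univ, true_and] at hξ ⊢
    rw [h, hξ]; simp
  · intro ξ _ η _ h; exact π.injective h
  · intro ξ hξ
    refine ⟨π.symm ξ, ?_, by simp⟩
    simp only [Finset.mem_filter, Finset.mem_univ, true_and] at hξ ⊢
    rw [← hξ]
    have := h (π.symm ξ)
    rw [Equiv.apply_symm_apply] at this
    rw [this]; simp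
  · intro ξ _; simp

theorem sum_cs [Fintype (G ⧸ GK)] (a : G × S → ℕ) : ∑ x, cs GK a x = ∑ ξ, a ξ := by
  classical
  unfold cs
  exact Finset.sum_fiberwise _ _ _

theorem sum_comp_symm {X : Type} [Fintype X] (a : X → ℕ) (π : Equiv.Perm X) : ∑ ξ, (a ∘ π.symm) ξ = ∑ ξ, a ξ :=
  Equiv.sum_comp π.symm a

theorem sum_res (g₀ : G) [Fintype GK] (a : G × S → ℕ) :
    ∑ y : GK × S, a (g₀ * y.1, y.2) = cs GK a (g₀ : G ⧸ GK) := by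
  classical
  unfold cs
  refine Finset.sum_bij (fun y _ => (g₀ * y.1, y.2)) ?_ ?_ ?_ ?_
  · intro y _
    simp only [Finset.mem_filter, Finset.mem_univ, true_and]
    rw [eq_comm, QuotientGroup.eq]; simp
  · intro x _ y _ h
    simp only [Prod.mk.injEq, mul_right_inj] at h
    exact Prod.ext (Subtype.ext h.1) h.2
  · intro ξ hξ
    simp only [Finset.mem_filter, Finset.mem_univ, true_and] at hξ
    rw [eq_comm, QuotientGroup.eq] at hξ
    exact ⟨(⟨_, hξ⟩, ξ.2), Finset.mem_univ _, by simp⟩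
  · intro _ _; rfl

/-- left translation inside a coset -/
noncomputable def pc [Group S] (g₀ : G) (γ : GK × S) : Equiv.Perm (G × S) := by
  classical
  have key : ∀ (h : GK) x, g₀⁻¹ * (g₀ * h * g₀⁻¹ * x) ∈ GK ↔ g₀⁻¹ * x ∈ GK := by
    intro h x
    have : g₀⁻¹ * (g₀ * h * g₀⁻¹ * x) = h * (g₀⁻¹ * x) := by group
    rw [this, Subgroup.mul_mem_cancel_left _ h.2]
  exact
  { toFun := fun ξ => if g₀⁻¹ * ξ.1 ∈ GK then (g₀ * γ.1 * g₀⁻¹ * ξ.1, γ.2 * ξ.2) else ξ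
    invFun := fun ξ => if g₀⁻¹ * ξ.1 ∈ GK then (g₀ * (γ.1⁻¹ : GK) * g₀⁻¹ * ξ.1, γ.2⁻¹ * ξ.2) else ξ
    left_inv := by
      intro ξ
      by_cases h : g₀⁻¹ * ξ.1 ∈ GK
      · have h2 := (key γ.1 ξ.1).2 h
        simp only [h, if_true, h2]
        ext <;> simp [mul_assoc]
      · simp [h]
    right_inv := by
      intro ξ
      by_cases h : g₀⁻¹ * ξ.1 ∈ GK
      · have h2 := (key γ.1⁻¹ ξ.1).2 h
        simp only [h, if_true, h2]
        ext <;> simp [mul_assoc]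
      · simp [h] }

theorem pc_mem [Group S] (g₀ : G) (γ : GK × S) (ξ : G × S) : ξ.1⁻¹ * (pc GK g₀ γ ξ).1 ∈ GK := by
  by_cases h : g₀⁻¹ * ξ.1 ∈ GK
  · simp only [pc, Equiv.coe_fn_mk, h, if_true]
    have : ξ.1⁻¹ * (g₀ * γ.1 * g₀⁻¹ * ξ.1) = (g₀⁻¹ * ξ.1)⁻¹ * γ.1 * (g₀⁻¹ * ξ.1) := by group
    rw [this]
    exact GK.mul_mem (GK.mul_mem (GK.inv_mem h) γ.1.2) h
  · simp [pc, h]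

theorem pc_symm [Group S] (g₀ : G) (γ : GK × S) (y : GK × S) :
    (pc GK g₀ γ).symm (g₀ * y.1, y.2) = (g₀ * (γ⁻¹ * y).1, (γ⁻¹ * y).2) := by
  simp [pc, mul_assoc]

end combi

end CE

namespace CE

set_option linter.unusedSectionVars false
set_option linter.unusedVariables false
set_option linter.style.longLine false

open Module

section claim
variable {T M : Type} [Field T] [Field M] [Algebra T M]
  {D : Type} [DivisionRing D] [Algebra T D] {n : ℕ}

variable (θ : D →ₐ[T] Matrix (Fin n) (Fin n) M) (GK : Subgroup (M ≃ₐ[T] M))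
  (hSN : ∀ h ∈ GK, ∃ N : Matrix (Fin n) (Fin n) M, N.det ≠ 0 ∧ ∀ d, N * θ d = (θ d).map h * N)
  (hSc : ∀ A : Matrix (Fin n) (Fin n) M, (∀ d, A * θ d = θ d * A) → ∃ c : M, A = c • 1)

variable {S : Type} [Group S] [Fintype S] [Fintype (M ≃ₐ[T] M)] {R : Type} [AddCommGroup R] [Module M R]
  (O : OpData T M n S R) (J : Submodule M R) [FiniteDimensional M J] [Infinite M]
  (hJ : ∀ σ π B, AdmB θ σ π B → ∀ r ∈ J, O.op σ π B r ∈ J)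
  [FiniteDimensional T M] [IsGalois T M] [FiniteDimensional T D]
  (hn : n ≠ 0) (hcard : Nat.card (M ≃ₐ[T] M) * n ^ 2 ∣ finrank T D * Nat.card GK)

open Classical in
set_option maxHeartbeats 1000000 in
theorem claim_u
    (hSN : ∀ h ∈ GK, ∃ N : Matrix (Fin n) (Fin n) M, N.det ≠ 0 ∧ ∀ d, N * θ d = (θ d).map h * N)
    (hSc : ∀ A : Matrix (Fin n) (Fin n) M, (∀ d, A * θ d = θ d * A) → ∃ c : M, A = c • 1)
    (hJ : ∀ σ π B, AdmB θ σ π B → ∀ r ∈ J, O.op σ π B r ∈ J)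
    (hn : n ≠ 0)
    (hcard : Nat.card (M ≃ₐ[T] M) * n ^ 2 ∣ finrank T D * Nat.card GK)
    (p : ℕ) (hp : p.Prime) (k : ℕ) (hk : p ^ k ∣ Nat.card (M ≃ₐ[T] M) * n * Nat.card S)
    [Fintype ((M ≃ₐ[T] M) ⧸ GK)] (u : (M ≃ₐ[T] M) ⧸ GK → ℕ) (hu : ¬ p ∣ ∑ x, u x)
    (Q : Subgroup (M ≃ₐ[T] M)) (hQ : IsPGroup p Q) (hQu : ∀ σ ∈ Q, ∀ x, u (σ • x) = u x)
    (W : Finset ((M ≃ₐ[T] M) × S → ℕ)) (hW : ∀ a ∈ W, ∀ π : Equiv.Perm ((M ≃ₐ[T] M) × S), a ∘ π.symm ∈ W)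
    (i i0 : ℕ) (hi : Q.index = i0 * i) (hi0 : ¬ p ∣ i0) :
    p ^ k ∣ i * ∑ a ∈ W with cs GK a = u, finrank M (J ⊓ O.wt a : Submodule M R) := by
  have : Fact p.Prime := ⟨hp⟩
  obtain ⟨j, hjf, hju⟩ := exists_fixed_not_dvd (P := Q) p hp hQ u (fun g x => hQu g g.2 x) hu
  obtain ⟨g₀, rfl⟩ := QuotientGroup.mk_surjective j
  have hQg : ∀ σ ∈ Q, g₀⁻¹ * σ * g₀ ∈ GK := by
    intro σ hσ
    have h1 : ((σ * g₀ : M ≃ₐ[T] M) : (M ≃ₐ[T] M) ⧸ GK) = (g₀ : (M ≃ₐ[T] M) ⧸ GK) := hjf ⟨σ, hσ⟩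
    rw [eq_comm, QuotientGroup.eq] at h1
    rwa [← mul_assoc] at h1
  have : Fintype GK := Fintype.ofFinite _
  let res : ((M ≃ₐ[T] M) × S → ℕ) → (GK × S → ℕ) := fun a y => a (g₀ * y.1, y.2)
  have hres : ∀ a, cs GK a = u → ∑ y, res a y = u (g₀ : (M ≃ₐ[T] M) ⧸ GK) := by
    intro a ha
    rw [← ha]; exact sum_res GK g₀ a
  set Wu := W.filter (fun a => cs GK a = u) with hWu
  let f : ((M ≃ₐ[T] M) × S → ℕ) → ℕ := fun a => finrank M (J ⊓ O.wt a : Submodule M R)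
  have hinv : ∀ (γ : GK × S) a, f (a ∘ (pc GK g₀ γ).symm) = f a := by
    intro γ a
    obtain ⟨B, hB⟩ := perm_adm θ GK hSN 1 (pc GK g₀ γ) (fun ξ => by rw [one_mul]; exact pc_mem GK g₀ γ ξ)
    exact finrank_wt_eq θ O J hJ hB a
  have hpcW : ∀ (γ : GK × S), ∀ a ∈ Wu, a ∘ (pc GK g₀ γ).symm ∈ Wu := by
    intro γ a ha
    rw [hWu, Finset.mem_filter] at ha ⊢
    refine ⟨hW a ha.1 _, ?_⟩
    funext x
    rw [cs_perm GK a _ 1 (fun ξ => ?_), ← ha.2]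
    · rfl
    · rw [Equiv.Perm.one_apply, eq_comm, QuotientGroup.eq]; exact pc_mem GK g₀ γ ξ
  have hpcres : ∀ (γ : GK × S) a, res (a ∘ (pc GK g₀ γ).symm) = fun y => res a (γ⁻¹ * y) := by
    intro γ a; funext y
    simp only [res, Function.comp_apply, pc_symm]
  obtain ⟨Pi⟩ : Nonempty (Sylow p (GK × S)) := inferInstance
  letI act : MulAction Pi (GK × S → ℕ) := arrowAction
  have hact : ∀ (γ : Pi) (α : GK × S → ℕ), γ • α = fun y => α ((γ : GK × S)⁻¹ * y) := fun _ _ => rfl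
  let t : Finset (GK × S → ℕ) := Wu.image res
  have hfib : ∑ a ∈ Wu, f a = ∑ α ∈ t, ∑ a ∈ Wu with res a = α, f a :=
    (Finset.sum_fiberwise_of_maps_to (fun a ha => Finset.mem_image_of_mem res ha) f).symm
  change p ^ k ∣ i * ∑ a ∈ Wu, f a
  rw [hfib, Finset.mul_sum]
  have hmaps : ∀ (γ : Pi) α, ∀ a ∈ Wu.filter (fun a => res a = α), a ∘ (pc GK g₀ γ).symm ∈ Wu.filter (fun a => res a = γ • α) := by
    intro γ α a ha
    rw [Finset.mem_filter] at ha ⊢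
    refine ⟨hpcW γ a ha.1, ?_⟩
    rw [hpcres, hact, ha.2]
  have hle : ∀ (γ : Pi) α, ∑ a ∈ Wu with res a = α, f a ≤ ∑ a ∈ Wu with res a = γ • α, f a := by
    intro γ α
    rw [← Finset.sum_congr rfl (fun a _ => hinv γ a)]
    rw [← Finset.sum_image (g := fun a : (M ≃ₐ[T] M) × S → ℕ => a ∘ (pc GK g₀ γ).symm) (f := f)]
    · apply Finset.sum_le_sum_of_subset
      intro b hb
      obtain ⟨a, ha, rfl⟩ := Finset.mem_image.1 hb
      exact hmaps γ α a ha
    · intro a _ b _ hab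
      exact (Equiv.surjective (pc GK g₀ (γ : GK × S)).symm).injective_comp_right hab
  apply orbit_sum_dvd (P := Pi) t
  · intro γ α hα
    obtain ⟨a, ha, rfl⟩ := Finset.mem_image.1 hα
    refine Finset.mem_image.2 ⟨_, hpcW γ a ha, ?_⟩
    rw [hpcres, hact]
  · intro γ α _
    congr 1
    apply le_antisymm _ (hle γ α)
    have := hle γ⁻¹ (γ • α)
    rwa [inv_smul_smul] at this
  · intro α hα
    obtain ⟨a₁, ha₁, hα'⟩ := Finset.mem_image.1 hα
    have hsumα : ∑ y, α y = u (g₀ : (M ≃ₐ[T] M) ⧸ GK) := by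
      rw [← hα']; exact hres a₁ (Finset.mem_filter.1 ha₁).2
    have hst : MulAction.stabilizer Pi α = ⊥ := by
      have h1 := stab_trivial p hp ((MulAction.stabilizer Pi α).map (Pi : Subgroup (GK × S)).subtype)
        ((Pi.isPGroup'.to_subgroup _).map _) α (by
          rintro _ ⟨γ, hγ, rfl⟩ x
          have h2 : γ⁻¹ • α = α := by
            have : γ • α = α := hγ
            rw [inv_smul_eq_iff, this]
          have h3 := congrFun h2 x
          rw [hact] at h3
          simpa using h3) (by rw [hsumα]; exact hju)
      rwa [Subgroup.map_eq_bot_iff_of_injective _ (Subgroup.subtype_injective _)] at h1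
    rw [hst, Subgroup.index_bot]
    refine arith_dvd p hp k (Nat.card (M ≃ₐ[T] M)) n (Nat.card S) (finrank T D) (Nat.card GK) i i0 Q.index _ _
      Nat.card_pos.ne' hn Nat.card_pos.ne' finrank_pos.ne' Nat.card_pos.ne' hk hcard ?_ hi hi0 ?_
    · intro m hm
      refine claim_d θ GK O J hSN hSc hJ p hp Q hQ g₀ hQg (u (g₀ : (M ≃ₐ[T] M) ⧸ GK)) hju
        (Wu.filter fun a => res a = α) ?_ ?_ m hm
      · intro a ha σ hσ
        rw [Finset.mem_filter, hWu, Finset.mem_filter] at ha ⊢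
        refine ⟨⟨hW _ ha.1.1 _, ?_⟩, ?_⟩
        · funext x
          rw [cs_perm GK a _ (MulAction.toPerm σ) (fun ξ => ?_), ha.1.2]
          · have := hQu σ hσ (σ⁻¹ • x)
            rw [smul_inv_smul] at this
            rw [this]; rfl
          · by_cases h : g₀⁻¹ * ξ.1 ∈ GK
            · rw [piJ_apply_mem GK h]
              have h2 : (ξ.1 : (M ≃ₐ[T] M) ⧸ GK) = g₀ := by rw [eq_comm, QuotientGroup.eq]; exact h
              rw [h2]; exact (hjf ⟨σ, hσ⟩).symm
            · rw [piJ_apply_not_mem GK h]; rfl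
        · rw [← ha.2]; funext y
          simp only [res, Function.comp_apply]
          congr 1
          rw [Equiv.symm_apply_eq, piJ_apply_mem GK]
          simp
      · intro a ha hdec
        have h1 := (Finset.mem_filter.1 (Finset.mem_filter.1 ha).1).2
        rw [← h1]
        unfold cs
        apply Finset.sum_congr _ (fun _ _ => rfl)
        ext ξ
        simp only [Finset.mem_filter, Finset.mem_univ, true_and]
        rw [eq_comm, QuotientGroup.eq]
    · rw [← Nat.card_prod]; exact Sylow.card_eq_multiplicity Pi

open Classical in
theorem claim
    (hSN : ∀ h ∈ GK, ∃ N : Matrix (Fin n) (Fin n) M, N.det ≠ 0 ∧ ∀ d, N * θ d = (θ d).map h * N)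
    (hSc : ∀ A : Matrix (Fin n) (Fin n) M, (∀ d, A * θ d = θ d * A) → ∃ c : M, A = c • 1)
    (hJ : ∀ σ π B, AdmB θ σ π B → ∀ r ∈ J, O.op σ π B r ∈ J)
    (hn : n ≠ 0)
    (hcard : Nat.card (M ≃ₐ[T] M) * n ^ 2 ∣ finrank T D * Nat.card GK)
    (p : ℕ) (hp : p.Prime) (k : ℕ) (hk : p ^ k ∣ Nat.card (M ≃ₐ[T] M) * n * Nat.card S)
    (w : ℕ) (hw : ¬ p ∣ w)
    (hJW : J ≤ ⨆ a ∈ Finset.piAntidiag (Finset.univ : Finset ((M ≃ₐ[T] M) × S)) w, O.wt a) :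
    p ^ k ∣ finrank M J := by
  have : Fact p.Prime := ⟨hp⟩
  have : Fintype ((M ≃ₐ[T] M) ⧸ GK) := Fintype.ofFinite _
  rw [finrank_eq_sum_wt θ O J hJ _ hJW]
  set W := Finset.piAntidiag (Finset.univ : Finset ((M ≃ₐ[T] M) × S)) w with hWdef
  have hWmem : ∀ a, a ∈ W ↔ ∑ ξ, a ξ = w := by intro a; simp [hWdef]
  have hW : ∀ a ∈ W, ∀ π : Equiv.Perm ((M ≃ₐ[T] M) × S), a ∘ π.symm ∈ W := by
    intro a ha π
    rw [hWmem] at ha ⊢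
    rw [sum_comp_symm, ha]
  let f : ((M ≃ₐ[T] M) × S → ℕ) → ℕ := fun a => finrank M (J ⊓ O.wt a : Submodule M R)
  obtain ⟨P⟩ : Nonempty (Sylow p (M ≃ₐ[T] M)) := inferInstance
  letI act : MulAction P ((M ≃ₐ[T] M) ⧸ GK → ℕ) := arrowAction
  have hact : ∀ (g : P) (u : (M ≃ₐ[T] M) ⧸ GK → ℕ), g • u = fun x => u ((g : M ≃ₐ[T] M)⁻¹ • x) := fun _ _ => rfl
  let pg : P → Equiv.Perm ((M ≃ₐ[T] M) × S) := fun g => Equiv.prodCongr (Equiv.mulLeft (g : M ≃ₐ[T] M)) (Equiv.refl S)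
  have hinv : ∀ (g : P) a, f (a ∘ (pg g).symm) = f a := by
    intro g a
    obtain ⟨B, hB⟩ := perm_adm θ GK hSN g (pg g) (fun ξ => by simp [pg, GK.one_mem])
    exact finrank_wt_eq θ O J hJ hB a
  have hcs : ∀ (g : P) a, cs GK (a ∘ (pg g).symm) = g • cs GK a := by
    intro g a; funext x
    rw [cs_perm GK a _ (MulAction.toPerm (g : M ≃ₐ[T] M)) (fun ξ => ?_)]
    · rfl
    · simp [pg]
  let t := W.image (cs GK)
  have hfib : ∑ a ∈ W, f a = ∑ u ∈ t, ∑ a ∈ W with cs GK a = u, f a :=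
    (Finset.sum_fiberwise_of_maps_to (fun a ha => Finset.mem_image_of_mem (cs GK) ha) f).symm
  change p ^ k ∣ ∑ a ∈ W, f a
  rw [hfib]
  have hle : ∀ (g : P) u, ∑ a ∈ W with cs GK a = u, f a ≤ ∑ a ∈ W with cs GK a = g • u, f a := by
    intro g u
    rw [← Finset.sum_congr rfl (fun a _ => hinv g a)]
    rw [← Finset.sum_image (g := fun a : (M ≃ₐ[T] M) × S → ℕ => a ∘ (pg g).symm) (f := f)]
    · apply Finset.sum_le_sum_of_subset
      intro b hb
      obtain ⟨a, ha, rfl⟩ := Finset.mem_image.1 hb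
      rw [Finset.mem_filter] at ha ⊢
      exact ⟨hW a ha.1 _, by rw [hcs, ha.2]⟩
    · intro a _ b _ hab
      have h2 := congrArg (fun F : (M ≃ₐ[T] M) × S → ℕ => F ∘ (pg g)) hab
      funext x
      have := congrFun h2 x
      simpa using this
  apply orbit_sum_dvd (P := P) t
  · intro g u hu
    obtain ⟨a, ha, rfl⟩ := Finset.mem_image.1 hu
    exact Finset.mem_image.2 ⟨_, hW a ha _, hcs g a⟩
  · intro g u _
    apply le_antisymm _ (hle g u)
    have := hle g⁻¹ (g • u)
    rwa [inv_smul_smul] at this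
  · intro u hu
    obtain ⟨a₁, ha₁, hu'⟩ := Finset.mem_image.1 hu
    have hsum : ∑ x, u x = w := by
      rw [← hu', sum_cs]; exact (hWmem _).1 ha₁
    refine claim_u θ GK O J hSN hSc hJ hn hcard p hp k hk u (by rwa [hsum])
      ((MulAction.stabilizer P u).map (P : Subgroup (M ≃ₐ[T] M)).subtype)
      ((P.isPGroup'.to_subgroup _).map _) ?_ W hW (MulAction.stabilizer P u).index (P : Subgroup (M ≃ₐ[T] M)).index ?_ ?_
    · rintro _ ⟨g, hg, rfl⟩ x
      have h2 : g⁻¹ • u = u := by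
        have : g • u = u := hg
        rw [inv_smul_eq_iff, this]
      have h3 := congrFun h2 x
      rw [hact] at h3
      simpa using h3
    · rw [Subgroup.index_map_subtype, mul_comm]
    · exact P.not_dvd_index

end claim
end CE

namespace CE

set_option linter.unusedSectionVars false
set_option linter.unusedVariables false
set_option linter.style.longLine false

open Module

/-- pivots of a subspace -/
def pivots {k Y : Type} [Field k] [LinearOrder Y] (W : Submodule k (Y → k)) : Set Y :=
  {y | ∃ w ∈ W, w y ≠ 0 ∧ ∀ z, y < z → w z = 0}

theorem lp_fin {k : Type} [Field k] (n : ℕ) (W : Submodule k (Fin n → k)) :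
    finrank k W = (pivots W).ncard := by
  induction n with
  | zero =>
    have : W = ⊥ := Subsingleton.elim _ _
    subst this
    simp [Set.eq_empty_of_isEmpty]
  | succ n ih =>
    let c : (Fin n → k) →ₗ[k] (Fin (n+1) → k) :=
      { toFun := fun w => Fin.snoc (α := fun _ => k) w 0
        map_add' := by
          intro a b; funext i
          refine Fin.lastCases ?_ (fun i => ?_) i <;> simp
        map_smul' := by
          intro a b; funext i
          refine Fin.lastCases ?_ (fun i => ?_) i <;> simp }
    have hcl : ∀ w, c w (Fin.last n) = 0 := fun w => by simp [c]
    have hcc : ∀ w i, c w (Fin.castSucc i) = w i := fun w i => by simp [c]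
    let W' := W.comap c
    let e : W →ₗ[k] k := (LinearMap.proj (Fin.last n)).comp W.subtype
    have h1 := LinearMap.finrank_range_add_finrank_ker e
    have h2 : finrank k (LinearMap.ker e) = finrank k W' := by
      refine LinearEquiv.finrank_eq ?_
      refine LinearEquiv.symm (LinearEquiv.ofBijective
        (LinearMap.codRestrict (LinearMap.ker e) (LinearMap.codRestrict W (c.comp W'.subtype) (fun w => w.2)) ?_) ⟨?_, ?_⟩)
      · intro w; exact hcl w
      · intro w w' h
        have h3 : c w = c w' := congrArg (fun x => (x.1 : Fin (n+1) → k)) h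
        refine Subtype.ext (funext fun i => ?_)
        have h5 := congrFun h3 (Fin.castSucc i)
        rwa [hcc, hcc] at h5
      · rintro ⟨⟨w, hw⟩, hw0⟩
        have h4 : c (fun i => w (Fin.castSucc i)) = w := by
          funext i
          refine Fin.lastCases ?_ (fun i => ?_) i
          · rw [hcl]; exact (hw0 : w (Fin.last n) = 0).symm
          · rw [hcc]
        refine ⟨⟨fun i => w (Fin.castSucc i), ?_⟩, ?_⟩
        · change c _ ∈ W
          rw [h4]; exact hw
        · exact Subtype.ext (Subtype.ext h4)
    have h3 : pivots W = Fin.castSucc '' (pivots W') ∪ {y | y = Fin.last n ∧ y ∈ pivots W} := by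
      ext y
      refine Fin.lastCases ?_ (fun i => ?_) y
      · simp
      · simp only [Set.mem_union, Set.mem_image, Set.mem_setOf_eq, Fin.castSucc_ne_last, false_and, or_false]
        constructor
        · rintro ⟨w, hw, hwi, hz⟩
          refine ⟨i, ⟨fun i => w (Fin.castSucc i), ?_, hwi, fun z hz' => hz _ (by simpa using hz')⟩, rfl⟩
          change c _ ∈ W
          convert hw using 1
          funext j
          refine Fin.lastCases ?_ (fun j => ?_) j
          · rw [hcl]; exact (hz _ (Fin.castSucc_lt_last i)).symm
          · rw [hcc]
        · rintro ⟨j, ⟨w, hw, hwi, hz⟩, hj⟩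
          obtain rfl := Fin.castSucc_injective _ hj
          refine ⟨c w, hw, by rwa [hcc], fun z => ?_⟩
          refine Fin.lastCases ?_ (fun z => ?_) z
          · intro _; exact hcl w
          · intro h; rw [hcc]; exact hz z (by simpa using h)
    rw [h3, Set.ncard_union_eq, Set.ncard_image_of_injective _ (Fin.castSucc_injective n), ← ih, ← h1, h2, add_comm]
    · congr 1
      by_cases h : Fin.last n ∈ pivots W
      · have e1 : {y | y = Fin.last n ∧ y ∈ pivots W} = {Fin.last n} := by
          ext y; simp only [Set.mem_setOf_eq, Set.mem_singleton_iff]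
          exact ⟨fun h => h.1, fun h' => ⟨h', h' ▸ h⟩⟩
        rw [e1, Set.ncard_singleton]
        obtain ⟨w, hw, hwi, -⟩ := h
        have : LinearMap.range e = ⊤ := by
          rw [LinearMap.range_eq_top]
          intro x
          refine ⟨(x / w (Fin.last n)) • ⟨w, hw⟩, ?_⟩
          simp [e, hwi]
        rw [this, finrank_top, finrank_self]
      · have e1 : {y | y = Fin.last n ∧ y ∈ pivots W} = ∅ := by
          ext y; simp only [Set.mem_setOf_eq, Set.mem_empty_iff_false, iff_false]
          rintro ⟨rfl, h'⟩; exact h h'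
        rw [e1, Set.ncard_empty]
        have : e = 0 := by
          ext w
          by_contra hne
          exact h ⟨w, w.2, hne, fun z hz => absurd hz (not_lt.2 (Fin.le_last z))⟩
        rw [this, LinearMap.range_zero, finrank_bot]
    · rw [Set.disjoint_left]
      rintro _ ⟨i, _, rfl⟩ ⟨h, _⟩
      exact Fin.castSucc_ne_last i h

theorem lp_aux {k Y : Type} [Field k] [LinearOrder Y] {N : ℕ} (e : Fin N ≃o Y) (W : Submodule k (Y → k)) :
    finrank k W = (pivots W).ncard := by
  have hE : ∃ f : (Y → k) ≃ₗ[k] (Fin N → k), ∀ w i, f w i = w (e i) :=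
    ⟨LinearEquiv.funCongrLeft k k e.toEquiv, fun _ _ => rfl⟩
  obtain ⟨f, hf⟩ := hE
  have h1 : finrank k W = finrank k (W.map f.toLinearMap) := (LinearEquiv.finrank_map_eq f W).symm
  rw [h1, lp_fin, ← Set.ncard_image_of_injective _ e.injective]
  congr 1
  ext y
  constructor
  · rintro ⟨i, ⟨u, ⟨w, hw, hu⟩, hwi, hz⟩, rfl⟩
    have hu' : ∀ i, u i = w (e i) := fun i => by rw [← hu]; exact hf w i
    refine ⟨w, hw, by rw [← hu']; exact hwi, fun z hz' => ?_⟩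
    obtain ⟨j, rfl⟩ := e.surjective z
    rw [← hu']
    exact hz j (e.lt_iff_lt.1 hz')
  · rintro ⟨w, hw, hwi, hz⟩
    obtain ⟨j, rfl⟩ := e.surjective y
    refine ⟨j, ⟨f w, ⟨w, hw, rfl⟩, by rw [hf]; exact hwi, fun z hz' => ?_⟩, rfl⟩
    rw [hf]; exact hz _ (e.lt_iff_lt.2 hz')

theorem lp {k Y : Type} [Field k] [LinearOrder Y] [Fintype Y] (W : Submodule k (Y → k)) :
    finrank k W = (pivots W).ncard :=
  lp_aux (Fintype.orderIsoFinOfCardEq Y rfl) W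

/-! ### Hilbert series of upper sets -/

/-- Hilbert series -/
noncomputable def hs {D : ℕ} (Λ : Set (Fin D → ℕ)) : PowerSeries ℤ :=
  PowerSeries.mk fun d => (({m | m ∈ Λ ∧ ∑ i, m i = d} : Set (Fin D → ℕ)).ncard : ℤ)

theorem finite_deg (D d : ℕ) : ({m | ∑ i, m i = d} : Set (Fin D → ℕ)).Finite := by
  classical
  refine (Finset.finite_toSet (Finset.piAntidiag Finset.univ d)).subset fun m hm => ?_
  simpa using hm

theorem hs_succ {D : ℕ} (Λ : Set (Fin (D+1) → ℕ)) :
    hs Λ = hs {m : Fin D → ℕ | (Fin.cons 0 m : Fin (D+1) → ℕ) ∈ Λ} +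
      PowerSeries.X * hs {m : Fin (D+1) → ℕ | m + Pi.single 0 1 ∈ Λ} := by
  ext d
  have key : ∀ d, ({m | m ∈ Λ ∧ ∑ i, m i = d} : Set (Fin (D+1) → ℕ)) =
      (fun m : Fin D → ℕ => (Fin.cons 0 m : Fin (D+1) → ℕ)) '' {m | (Fin.cons 0 m : Fin (D+1) → ℕ) ∈ Λ ∧ ∑ i, m i = d} ∪
      (fun m : Fin (D+1) → ℕ => m + Pi.single 0 1) '' {m | m + Pi.single 0 1 ∈ Λ ∧ ∑ i, m i + 1 = d} := by
    intro d
    ext m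
    simp only [Set.mem_setOf_eq, Set.mem_union, Set.mem_image]
    constructor
    · rintro ⟨hm, hd⟩
      rcases Nat.eq_zero_or_pos (m 0) with h0 | h0
      · left
        have e1 : (Fin.cons 0 (Fin.tail m) : Fin (D+1) → ℕ) = m := by
          rw [← h0]; exact Fin.cons_self_tail m
        refine ⟨Fin.tail m, ⟨by rwa [e1], ?_⟩, e1⟩
        rw [Fin.sum_univ_succ, h0, zero_add] at hd
        exact hd
      · right
        have e1 : (m - Pi.single 0 1) + Pi.single 0 1 = m := by
          funext i
          by_cases hi : i = 0
          · subst hi; simp; omega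
          · simp [hi]
        refine ⟨m - Pi.single 0 1, ⟨by rwa [e1], ?_⟩, e1⟩
        rw [← hd]
        conv_rhs => rw [← e1]
        simp [Finset.sum_add_distrib]
    · rintro (⟨m', ⟨h1, h2⟩, rfl⟩ | ⟨m', ⟨h1, h2⟩, rfl⟩)
      · exact ⟨h1, by simpa [Fin.sum_univ_succ] using h2⟩
      · exact ⟨h1, by simpa [Finset.sum_add_distrib] using h2⟩
  have inj1 : Function.Injective (fun m : Fin D → ℕ => (Fin.cons 0 m : Fin (D+1) → ℕ)) :=
    fun a b h => Fin.cons_right_injective (α := fun _ => ℕ) 0 h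
  have inj2 : Function.Injective (fun m : Fin (D+1) → ℕ => m + Pi.single 0 1) := add_left_injective _
  have hd : ∀ d, Disjoint ((fun m : Fin D → ℕ => (Fin.cons 0 m : Fin (D+1) → ℕ)) '' {m | (Fin.cons 0 m : Fin (D+1) → ℕ) ∈ Λ ∧ ∑ i, m i = d})
      ((fun m : Fin (D+1) → ℕ => m + Pi.single 0 1) '' {m | m + Pi.single 0 1 ∈ Λ ∧ ∑ i, m i + 1 = d}) := by
    intro d
    rw [Set.disjoint_left]
    rintro _ ⟨m, _, rfl⟩ ⟨m', _, h⟩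
    have := congrFun h 0
    simp at this
  have f1 : ∀ d, ({m | (Fin.cons 0 m : Fin (D+1) → ℕ) ∈ Λ ∧ ∑ i, m i = d} : Set (Fin D → ℕ)).Finite :=
    fun d => (finite_deg D d).subset fun m hm => hm.2
  have f2 : ∀ d, ({m | m + Pi.single 0 1 ∈ Λ ∧ ∑ i, m i + 1 = d} : Set (Fin (D+1) → ℕ)).Finite :=
    fun d => (finite_deg (D+1) (d-1)).subset fun m hm => by
      have := hm.2
      simp only [Set.mem_setOf_eq]; omega
  simp only [hs, map_add, PowerSeries.coeff_mk]
  rw [key d, Set.ncard_union_eq (hd d) ((f1 d).image _) ((f2 d).image _), Set.ncard_image_of_injective _ inj1,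
    Set.ncard_image_of_injective _ inj2]
  push_cast
  congr 1
  cases d with
  | zero => simp
  | succ d =>
    rw [PowerSeries.coeff_succ_X_mul, PowerSeries.coeff_mk]
    simp

/-- goodness -/
def GoodSet {D : ℕ} (Λ : Set (Fin D → ℕ)) : Prop :=
  ∃ P : Polynomial ℤ, hs Λ * (1 - PowerSeries.X) ^ D = (P : PowerSeries ℤ) ∧ (Λ.Nonempty → P.eval 1 = 1) ∧ (¬ Λ.Nonempty → P.eval 1 = 0)

theorem goodSet {D : ℕ} (Λ : Set (Fin D → ℕ)) (hΛ : IsUpperSet Λ) : GoodSet Λ := by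
  induction D with
  | zero =>
    by_cases h : Λ.Nonempty
    · refine ⟨1, ?_, fun _ => by simp, fun h' => absurd h h'⟩
      obtain ⟨m, hm⟩ := h
      ext d
      rw [pow_zero, mul_one, Polynomial.coe_one, PowerSeries.coeff_one]
      simp only [hs, PowerSeries.coeff_mk]
      by_cases hd : d = 0
      · subst hd
        have : ({m | m ∈ Λ ∧ ∑ i, m i = 0} : Set (Fin 0 → ℕ)) = {m} := by
          ext m'; rw [Subsingleton.elim m' m]; simp [hm]
        rw [this]; simp
      · have : ({m | m ∈ Λ ∧ ∑ i, m i = d} : Set (Fin 0 → ℕ)) = ∅ := by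
          ext m'; simp; intro _ h; exact hd h.symm
        rw [this]; simp [hd]
    · refine ⟨0, ?_, fun h' => absurd h' h, fun _ => by simp⟩
      rw [Set.not_nonempty_iff_eq_empty] at h
      subst h
      ext d; simp [hs]
  | succ D ih =>
    have hsl : ∀ Λ : Set (Fin (D+1) → ℕ), IsUpperSet Λ → IsUpperSet {m : Fin D → ℕ | (Fin.cons 0 m : Fin (D+1) → ℕ) ∈ Λ} := by
      intro Λ hΛ m m' hmm hm
      exact hΛ (by
        intro i
        refine Fin.cases ?_ (fun i => ?_) i
        · simp
        · simpa using hmm i) hm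
    have hstep : ∀ Λ : Set (Fin (D+1) → ℕ), IsUpperSet Λ → GoodSet {m : Fin (D+1) → ℕ | m + Pi.single 0 1 ∈ Λ} → GoodSet Λ := by
      rintro Λ hΛ ⟨P', h1, h2, h3⟩
      obtain ⟨P, h4, -, -⟩ := ih _ (hsl Λ hΛ)
      have hne : ({m : Fin (D+1) → ℕ | m + Pi.single 0 1 ∈ Λ}).Nonempty ↔ Λ.Nonempty := by
        constructor
        · rintro ⟨m, hm⟩; exact ⟨_, hm⟩
        · rintro ⟨m, hm⟩; exact ⟨m, hΛ (by intro i; simp) hm⟩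
      rw [hne] at h2 h3
      refine ⟨(1 - Polynomial.X) * P + Polynomial.X * P', ?_, fun h => ?_, fun h => ?_⟩
      · rw [hs_succ]
        push_cast
        rw [← h1, ← h4]; ring
      · simp [h2 h]
      · simp [h3 h]
    let sh : ℕ → Set (Fin (D+1) → ℕ) := fun j => {m | m + Pi.single 0 j ∈ Λ}
    have hsh : ∀ j, IsUpperSet (sh j) := fun j m m' h hm => hΛ (add_le_add_left h _) hm
    have hsh1 : ∀ j, {m : Fin (D+1) → ℕ | m + Pi.single 0 1 ∈ sh j} = sh (j+1) := by
      intro j; ext m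
      simp only [sh, Set.mem_setOf_eq]
      rw [add_assoc, ← Pi.single_add, add_comm 1 j]
    have hmono : Monotone sh := by
      apply monotone_nat_of_le_succ
      intro j m hm
      exact hΛ (by intro i; by_cases hi : i = 0 <;> simp [hi]) hm
    obtain ⟨N, hN⟩ : ∃ N, ∀ j ≥ N, sh j = sh N := by
      by_contra! hcon
      have hc2 : ∀ N, ∃ j m, N < j ∧ m ∈ sh j ∧ m ∉ sh N := by
        intro N
        obtain ⟨j, hj, hne⟩ := hcon N
        have hss : sh N ≤ sh j := hmono hj
        have : ¬ sh j ⊆ sh N := fun h => hne (Set.Subset.antisymm h hss)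
        obtain ⟨m, h1, h2⟩ := Set.not_subset.1 this
        refine ⟨j, m, lt_of_le_of_ne hj ?_, h1, h2⟩
        rintro rfl; exact h2 h1
      choose J m hJ hm1 hm2 using hc2
      let a : ℕ → ℕ := fun i => J^[i] 0
      have ha : ∀ i, a (i+1) = J (a i) := fun i => Function.iterate_succ_apply' J i 0
      have hamono : Monotone a := monotone_nat_of_le_succ fun i => by rw [ha]; exact (hJ _).le
      obtain ⟨i, j, hij, hle⟩ := wellQuasiOrdered_le (fun i => m (a i))
      have h1 : m (a i) ∈ sh (a (i+1)) := by rw [ha]; exact hm1 _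
      exact hm2 (a j) (hsh _ hle (hmono (hamono (show i + 1 ≤ j from hij)) h1))
    have hgN : GoodSet (sh N) := by
      obtain ⟨P, h4, h5, h6⟩ := ih _ (hsl _ (hsh N))
      have e1 := hs_succ (sh N)
      rw [hsh1, hN (N+1) (by omega)] at e1
      have hne : ({m : Fin D → ℕ | (Fin.cons 0 m : Fin (D+1) → ℕ) ∈ sh N}).Nonempty ↔ (sh N).Nonempty := by
        constructor
        · rintro ⟨m, hm⟩; exact ⟨_, hm⟩
        · rintro ⟨m, hm⟩
          refine ⟨Fin.tail m, ?_⟩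
          have : (Fin.cons 0 (Fin.tail m) : Fin (D+1) → ℕ) ∈ sh (N + m 0) := by
            simp only [sh, Set.mem_setOf_eq] at hm ⊢
            convert hm using 1
            funext i
            refine Fin.cases ?_ (fun i => ?_) i
            · simp [add_comm]
            · simp [Fin.tail]
          rwa [hN _ (by omega)] at this
      rw [hne] at h5 h6
      refine ⟨P, ?_, h5, h6⟩
      rw [← h4]
      linear_combination (1 - PowerSeries.X) ^ D * e1
    have : ∀ j ≤ N, GoodSet (sh (N - j)) := by
      intro j
      induction j with
      | zero => intro _; exact hgN
      | succ j ihj =>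
        intro hj
        apply hstep _ (hsh _)
        rw [hsh1]
        have : N - (j+1) + 1 = N - j := by omega
        rw [this]; exact ihj (by omega)
    have h0 := this N le_rfl
    have e : sh (N - N) = Λ := by ext m; simp [sh]
    rwa [e] at h0

end CE

namespace CE

set_option linter.unusedSectionVars false
set_option linter.unusedVariables false
set_option linter.style.longLine false

open Module

section hilb
variable {M V X L : Type} [Field M] [Fintype V] [Fintype X] [Field L] [Algebra (MvPolynomial V M) L]

/-- homogeneous integral points of a subspace -/
def Jd (𝓥 : Submodule L (X → L)) (d : ℕ) : Submodule M (X → MvPolynomial V M) where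
  carrier := {v | (∀ i, (v i).IsHomogeneous d) ∧ (fun i => algebraMap (MvPolynomial V M) L (v i)) ∈ 𝓥}
  zero_mem' := by
    refine ⟨fun i => MvPolynomial.isHomogeneous_zero _ _ _, ?_⟩
    convert 𝓥.zero_mem using 1
    funext i; simp
  add_mem' := by
    rintro a b ⟨h1, h2⟩ ⟨h3, h4⟩
    refine ⟨fun i => (h1 i).add (h3 i), ?_⟩
    convert 𝓥.add_mem h2 h4 using 1
    funext i; simp
  smul_mem' := by
    rintro c a ⟨h1, h2⟩
    refine ⟨fun i => ?_, ?_⟩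
    · exact (MvPolynomial.homogeneousSubmodule V M d).smul_mem c (h1 i)
    · convert 𝓥.smul_mem (algebraMap (MvPolynomial V M) L (MvPolynomial.C c)) h2 using 1
      funext i
      simp [MvPolynomial.smul_eq_C_mul]

theorem mem_Jd {𝓥 : Submodule L (X → L)} {d : ℕ} {v : X → MvPolynomial V M} :
    v ∈ Jd 𝓥 d ↔ (∀ i, (v i).IsHomogeneous d) ∧ (fun i => algebraMap (MvPolynomial V M) L (v i)) ∈ 𝓥 := Iff.rfl

/-- leading exponents -/
def lexp [LinearOrder X] (m : MonomialOrder.{0,0} V) (𝓥 : Submodule L (X → L)) (i : X) : Set (V →₀ ℕ) :=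
  {μ | ∃ d, ∃ v : X → MvPolynomial V M, v ∈ Jd 𝓥 d ∧ v i ≠ 0 ∧ (∀ j, i < j → v j = 0) ∧ m.degree (v i) = μ}

theorem homog_deg {p : MvPolynomial V M} {d : ℕ} (hp : p.IsHomogeneous d) {μ : V →₀ ℕ} (h : p.coeff μ ≠ 0) :
    μ.degree = d := by
  have := hp h
  rw [Finsupp.degree_eq_weight_one]; exact this

theorem lexp_upper [LinearOrder X] (m : MonomialOrder.{0,0} V) (𝓥 : Submodule L (X → L)) (i : X) :
    IsUpperSet (lexp (M := M) m 𝓥 i) := by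
  classical
  rintro μ ν hμν ⟨d, v, hv, hvi, hj, rfl⟩
  obtain ⟨κ, rfl⟩ := exists_add_of_le hμν
  have hmon : (MvPolynomial.monomial κ (1 : M)) ≠ 0 := by simp
  refine ⟨κ.degree + d, fun j => MvPolynomial.monomial κ 1 * v j, ⟨fun j => ?_, ?_⟩, mul_ne_zero hmon hvi, fun j hij => ?_, ?_⟩
  · exact (MvPolynomial.isHomogeneous_monomial _ rfl).mul (hv.1 j)
  · convert 𝓥.smul_mem (algebraMap (MvPolynomial V M) L (MvPolynomial.monomial κ 1)) hv.2 using 1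
    funext i; simp
  · simp only [hj j hij, mul_zero]
  · rw [MonomialOrder.degree_mul hmon hvi, MonomialOrder.degree_monomial, if_neg one_ne_zero, add_comm]

theorem finite_degree (d : ℕ) : {μ : V →₀ ℕ | μ.degree = d}.Finite := by
  classical
  refine ((Finset.finite_toSet (Finset.piAntidiag (Finset.univ : Finset V) d)).preimage
    (f := fun μ : V →₀ ℕ => (μ : V → ℕ)) (DFunLike.coe_injective.injOn)).subset fun m hm => ?_
  simpa [Finsupp.degree_eq_sum] using hm

theorem Jd_finrank [LinearOrder X] (m : MonomialOrder.{0,0} V) (𝓥 : Submodule L (X → L)) (d : ℕ) :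
    FiniteDimensional M (Jd (M := M) (V := V) 𝓥 d) ∧
    finrank M (Jd (M := M) (V := V) 𝓥 d) = ∑ i, ({μ | μ ∈ lexp (M := M) m 𝓥 i ∧ μ.degree = d} : Set (V →₀ ℕ)).ncard := by
  classical
  let Y := {y : X ×ₗ m.syn // (m.toSyn.symm (ofLex y).2).degree = d}
  have hfin : Finite Y := by
    have : Finite {μ : V →₀ ℕ // μ.degree = d} := (finite_degree d).to_subtype
    refine Finite.of_injective (β := X × {μ : V →₀ ℕ // μ.degree = d}) (fun y => ((ofLex y.1).1, ⟨_, y.2⟩)) ?_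
    intro y y' h
    simp only [Prod.mk.injEq, Subtype.mk.injEq, EmbeddingLike.apply_eq_iff_eq] at h
    exact Subtype.ext (ofLex.injective (Prod.ext h.1 h.2))
  have : Fintype Y := Fintype.ofFinite Y
  let cm : (X → MvPolynomial V M) →ₗ[M] (Y → M) :=
    { toFun := fun v y => (v (ofLex y.1).1).coeff (m.toSyn.symm (ofLex y.1).2)
      map_add' := fun a b => by funext y; simp
      map_smul' := fun a b => by funext y; simp }
  have hcm : ∀ v y, cm v y = (v (ofLex y.1).1).coeff (m.toSyn.symm (ofLex y.1).2) := fun _ _ => rfl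
  let mkY : X → {μ : V →₀ ℕ // μ.degree = d} → Y := fun i μ => ⟨toLex (i, m.toSyn μ.1), by simpa using μ.2⟩
  have hmk : ∀ v i μ, cm v (mkY i μ) = (v i).coeff μ.1 := fun v i μ => by simp [hcm, mkY]
  have hsurj : ∀ y : Y, ∃ i μ, y = mkY i μ := fun y => ⟨(ofLex y.1).1, ⟨_, y.2⟩, Subtype.ext (by simp [mkY])⟩
  have hlt : ∀ i μ j ν, mkY i μ < mkY j ν ↔ i < j ∨ (i = j ∧ m.toSyn μ.1 < m.toSyn ν.1) := by
    intro i μ j ν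
    change (toLex (i, m.toSyn μ.1) : X ×ₗ m.syn) < toLex (j, m.toSyn ν.1) ↔ _
    rw [Prod.Lex.toLex_lt_toLex]
  have hinj : Function.Injective (cm.comp (Jd (M := M) (V := V) 𝓥 d).subtype) := by
    intro v v' h
    refine Subtype.ext (funext fun i => ?_)
    ext μ
    by_cases hμ : μ.degree = d
    · have := congrFun h (mkY i ⟨μ, hμ⟩)
      simpa only [LinearMap.comp_apply, Submodule.subtype_apply, hmk] using this
    · rw [by_contra fun h => hμ (homog_deg (v.2.1 i) h), by_contra fun h => hμ (homog_deg (v'.2.1 i) h)]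
  refine ⟨FiniteDimensional.of_injective _ hinj, ?_⟩
  rw [← LinearMap.finrank_range_of_inj hinj, lp]
  have hp : ∀ i μ, mkY i μ ∈ pivots (LinearMap.range (cm.comp (Jd (M := M) (V := V) 𝓥 d).subtype)) ↔ μ.1 ∈ lexp (M := M) m 𝓥 i := by
    intro i μ
    constructor
    · rintro ⟨_, ⟨v, rfl⟩, h1, h2⟩
      simp only [LinearMap.comp_apply, Submodule.subtype_apply] at h1 h2
      rw [hmk] at h1
      have hvi : v.1 i ≠ 0 := fun h => h1 (by rw [h, MvPolynomial.coeff_zero])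
      refine ⟨d, v.1, v.2, hvi, fun j hij => ?_, ?_⟩
      · ext ν
        rw [MvPolynomial.coeff_zero]
        by_contra h
        have hν := homog_deg (v.2.1 j) h
        have := h2 (mkY j ⟨ν, hν⟩) ((hlt _ _ _ _).2 (Or.inl hij))
        rw [hmk] at this
        exact h this
      · have hd : (v.1 i).coeff (m.degree (v.1 i)) ≠ 0 := m.coeff_degree_ne_zero_iff.2 hvi
        have hdd := homog_deg (v.2.1 i) hd
        rcases lt_trichotomy (m.toSyn (m.degree (v.1 i))) (m.toSyn μ.1) with h | h | h
        · exact absurd (m.coeff_eq_zero_of_lt h) h1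
        · exact m.toSyn.injective h
        · have := h2 (mkY i ⟨_, hdd⟩) ((hlt _ _ _ _).2 (Or.inr ⟨rfl, h⟩))
          rw [hmk] at this
          exact absurd this hd
    · rintro ⟨d', v, hv, hvi, hj, hμ⟩
      have hd : (v i).coeff μ.1 ≠ 0 := by rw [← hμ]; exact m.coeff_degree_ne_zero_iff.2 hvi
      have : d' = d := by rw [← homog_deg (hv.1 i) hd]; exact μ.2
      subst this
      refine ⟨_, ⟨⟨v, hv⟩, rfl⟩, ?_, fun z hz => ?_⟩
      · simp only [LinearMap.comp_apply, Submodule.subtype_apply]; rw [hmk]; exact hd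
      · obtain ⟨j, ν, rfl⟩ := hsurj z
        simp only [LinearMap.comp_apply, Submodule.subtype_apply]; rw [hmk]
        rcases (hlt _ _ _ _).1 hz with h | ⟨rfl, h⟩
        · rw [hj j h, MvPolynomial.coeff_zero]
        · exact m.coeff_eq_zero_of_lt (by rw [hμ]; exact h)
  have : pivots (LinearMap.range (cm.comp (Jd (M := M) (V := V) 𝓥 d).subtype)) ≃
      Σ i : X, ({μ | μ ∈ lexp (M := M) m 𝓥 i ∧ μ.degree = d} : Set (V →₀ ℕ)) :=
    (Equiv.ofBijective (fun x => ⟨mkY x.1 ⟨x.2.1, x.2.2.2⟩, (hp _ _).2 x.2.2.1⟩) ⟨by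
      rintro ⟨i, μ, h1, h2⟩ ⟨j, ν, h3, h4⟩ h
      have h' := congrArg (fun x : pivots (LinearMap.range (cm.comp (Jd (M := M) (V := V) 𝓥 d).subtype)) => ofLex x.1.1) h
      simp only [mkY, ofLex_toLex, Prod.mk.injEq, EmbeddingLike.apply_eq_iff_eq] at h'
      obtain ⟨rfl, rfl⟩ := h'
      rfl, by
      rintro ⟨y, hy⟩
      obtain ⟨i, μ, rfl⟩ := hsurj y
      exact ⟨⟨i, μ.1, (hp _ _).1 hy, μ.2⟩, rfl⟩⟩).symm
  rw [← Nat.card_coe_set_eq, Nat.card_congr this]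
  have : ∀ i, Finite ({μ | μ ∈ lexp (M := M) m 𝓥 i ∧ μ.degree = d} : Set (V →₀ ℕ)) := fun i =>
    ((finite_degree d).subset fun μ hμ => hμ.2).to_subtype
  rw [Nat.card_sigma]
  exact Finset.sum_congr rfl fun i _ => Nat.card_coe_set_eq _

theorem V_finrank [IsFractionRing (MvPolynomial V M) L] [LinearOrder X] (m : MonomialOrder.{0,0} V) (𝓥 : Submodule L (X → L))
    (hhom : ∀ v : X → MvPolynomial V M, (fun i => algebraMap (MvPolynomial V M) L (v i)) ∈ 𝓥 → ∀ d,
      (fun i => algebraMap (MvPolynomial V M) L (MvPolynomial.homogeneousComponent d (v i))) ∈ 𝓥) :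
    finrank L 𝓥 = ({i | (lexp (M := M) m 𝓥 i).Nonempty} : Set X).ncard := by
  rw [lp]
  congr 1
  ext i
  constructor
  · rintro ⟨w, hw, hwi, hj⟩
    obtain ⟨b, hb⟩ := IsLocalization.exist_integer_multiples_of_finite (nonZeroDivisors (MvPolynomial V M)) w
    choose v hv using hb
    have hb0 : algebraMap (MvPolynomial V M) L b ≠ 0 := IsFractionRing.to_map_ne_zero_of_mem_nonZeroDivisors b.2
    have hv' : ∀ j, algebraMap (MvPolynomial V M) L (v j) = algebraMap (MvPolynomial V M) L b * w j := fun j => by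
      rw [hv]; simp [Algebra.smul_def]
    have hvV : (fun i => algebraMap (MvPolynomial V M) L (v i)) ∈ 𝓥 := by
      convert 𝓥.smul_mem (algebraMap (MvPolynomial V M) L b) hw using 1
      funext j; simp [hv']
    have hvi : v i ≠ 0 := by
      intro h
      have := hv' i
      rw [h, map_zero] at this
      exact mul_ne_zero hb0 hwi this.symm
    have hvj : ∀ j, i < j → v j = 0 := by
      intro j hij
      have := hv' j
      rw [hj j hij, mul_zero] at this
      exact (IsFractionRing.injective (MvPolynomial V M) L) (by rw [this, map_zero])
    obtain ⟨d, hd⟩ : ∃ d, MvPolynomial.homogeneousComponent d (v i) ≠ 0 := by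
      by_contra! h
      apply hvi
      rw [← MvPolynomial.sum_homogeneousComponent (v i)]
      exact Finset.sum_eq_zero fun d _ => h d
    exact ⟨_, d, fun j => MvPolynomial.homogeneousComponent d (v j),
      ⟨fun j => MvPolynomial.homogeneousComponent_isHomogeneous _ _, hhom v hvV d⟩, hd,
      fun j hij => by simp only [hvj j hij, map_zero], rfl⟩
  · rintro ⟨μ, d, v, hv, hvi, hj, rfl⟩
    refine ⟨_, hv.2, ?_, fun j hij => ?_⟩
    · intro h
      exact hvi ((IsFractionRing.injective (MvPolynomial V M) L) (by rw [h, map_zero]))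
    · simp only [hj j hij, map_zero]

theorem hilbert [IsFractionRing (MvPolynomial V M) L] (𝓥 : Submodule L (X → L))
    (hhom : ∀ v : X → MvPolynomial V M, (fun i => algebraMap (MvPolynomial V M) L (v i)) ∈ 𝓥 → ∀ d,
      (fun i => algebraMap (MvPolynomial V M) L (MvPolynomial.homogeneousComponent d (v i))) ∈ 𝓥)
    (q : ℕ) (hq : ∀ d, q ∣ finrank M (Jd (M := M) (V := V) 𝓥 d)) : q ∣ finrank L 𝓥 := by
  classical
  letI : LinearOrder X := LinearOrder.lift' (Fintype.equivFin X) (Fintype.equivFin X).injective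
  letI : LinearOrder V := LinearOrder.lift' (Fintype.equivFin V) (Fintype.equivFin V).injective
  let m : MonomialOrder.{0,0} V := MonomialOrder.lex
  rw [V_finrank m 𝓥 hhom]
  let D := Fintype.card V
  let e : Fin D ≃ V := (Fintype.equivFin V).symm
  let t : (Fin D → ℕ) ≃ (V →₀ ℕ) := (e.arrowCongr (Equiv.refl ℕ)).trans Finsupp.equivFunOnFinite.symm
  have ht : ∀ μ v, t μ v = μ (e.symm v) := fun μ v => rfl
  have htdeg : ∀ μ, (t μ).degree = ∑ i, μ i := by
    intro μ
    rw [Finsupp.degree_eq_sum, ← Equiv.sum_comp e]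
    simp [ht]
  let Λ : X → Set (Fin D → ℕ) := fun i => t ⁻¹' (lexp (M := M) m 𝓥 i)
  have hΛ : ∀ i, IsUpperSet (Λ i) := by
    intro i μ ν h hμ
    exact lexp_upper m 𝓥 i (fun v => by rw [ht, ht]; exact h _) hμ
  have hΛne : ∀ i, (Λ i).Nonempty ↔ (lexp (M := M) m 𝓥 i).Nonempty := by
    intro i
    constructor
    · rintro ⟨μ, h⟩; exact ⟨_, h⟩
    · rintro ⟨μ, h⟩; exact ⟨t.symm μ, by simpa [Λ] using h⟩
  have hcoef : ∀ d, PowerSeries.coeff d (∑ i, hs (Λ i)) = (finrank M (Jd (M := M) (V := V) 𝓥 d) : ℤ) := by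
    intro d
    rw [(Jd_finrank m 𝓥 d).2, map_sum]
    push_cast
    refine Finset.sum_congr rfl fun i _ => ?_
    simp only [hs, PowerSeries.coeff_mk]
    congr 1
    rw [← Set.ncard_image_of_injective _ t.injective]
    congr 1
    ext μ
    constructor
    · rintro ⟨ν, ⟨h1, h2⟩, rfl⟩
      exact ⟨h1, by rw [htdeg]; exact h2⟩
    · rintro ⟨h1, h2⟩
      refine ⟨t.symm μ, ⟨by simpa [Λ] using h1, ?_⟩, by simp⟩
      rw [← htdeg]; simpa using h2
  choose P hP1 hP2 hP3 using fun i => goodSet (Λ i) (hΛ i)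
  choose Q hQ using hq
  have hsum : ∑ i, hs (Λ i) = PowerSeries.C (q : ℤ) * PowerSeries.mk (fun d => (Q d : ℤ)) := by
    ext d
    rw [hcoef, PowerSeries.coeff_C_mul, PowerSeries.coeff_mk, hQ]
    push_cast; rfl
  have hPc : ((∑ i, P i : Polynomial ℤ) : PowerSeries ℤ) = PowerSeries.C (q : ℤ) * (PowerSeries.mk (fun d => (Q d : ℤ)) * (1 - PowerSeries.X) ^ D) := by
    rw [← mul_assoc, ← hsum, Finset.sum_mul]
    rw [← Polynomial.coeToPowerSeries.ringHom_apply, map_sum]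
    exact Finset.sum_congr rfl fun i _ => (hP1 i).symm
  have hdvd : (q : ℤ) ∣ (∑ i, P i : Polynomial ℤ).eval 1 := by
    rw [Polynomial.eval_eq_sum]
    refine Finset.dvd_sum fun j _ => ?_
    simp only [one_pow, mul_one]
    rw [← Polynomial.coeff_coe, hPc, PowerSeries.coeff_C_mul]
    exact dvd_mul_right _ _
  have hev : (∑ i, P i : Polynomial ℤ).eval 1 = (({i | (lexp (M := M) m 𝓥 i).Nonempty} : Set X).ncard : ℤ) := by
    rw [Polynomial.eval_finset_sum]
    have : ∀ i, (P i).eval 1 = if (lexp (M := M) m 𝓥 i).Nonempty then 1 else 0 := by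
      intro i
      split_ifs with h
      · exact hP2 i ((hΛne i).2 h)
      · exact hP3 i (fun h' => h ((hΛne i).1 h'))
    rw [Finset.sum_congr rfl fun i _ => this i, Finset.sum_boole, Set.ncard_eq_toFinset_card', Set.toFinset_setOf]
  rw [hev] at hdvd
  exact_mod_cast hdvd

/-- stability under scaling gives stability under taking homogeneous components -/
theorem hhom_of_scaling (T : Type) [Field T] [Algebra T M] [DecidableEq V] [Infinite M] (𝓥 : Submodule L (X → L))
    (hsc : ∀ l : M, l ≠ 0 → ∀ v : X → MvPolynomial V M, (fun i => algebraMap (MvPolynomial V M) L (v i)) ∈ 𝓥 →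
      (fun i => algebraMap (MvPolynomial V M) L (sop (1 : M ≃ₐ[T] M) (Matrix.diagonal fun _ => l) (v i))) ∈ 𝓥)
    (v : X → MvPolynomial V M) (hv : (fun i => algebraMap (MvPolynomial V M) L (v i)) ∈ 𝓥) (d : ℕ) :
      (fun i => algebraMap (MvPolynomial V M) L (MvPolynomial.homogeneousComponent d (v i))) ∈ 𝓥 := by
  classical
  let n := (Finset.univ.sup fun i => (v i).totalDegree) + 1
  obtain ⟨l, hl, hinj⟩ := exists_separating (M := M) (X := Unit) ((Finset.range n).image fun d _ => d)
  let J₀ : Submodule M (X → MvPolynomial V M) :=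
    { carrier := {v | (fun i => algebraMap (MvPolynomial V M) L (v i)) ∈ 𝓥}
      zero_mem' := by
        have := 𝓥.zero_mem
        simp only [Set.mem_setOf_eq, Pi.zero_apply, map_zero]
        exact this
      add_mem' := by
        intro a b ha hb
        have := 𝓥.add_mem ha hb
        simp only [Set.mem_setOf_eq, Pi.add_apply, map_add]
        exact this
      smul_mem' := by
        intro c a ha
        have := 𝓥.smul_mem (algebraMap (MvPolynomial V M) L (MvPolynomial.C c)) ha
        simp only [Set.mem_setOf_eq, Pi.smul_apply, MvPolynomial.smul_eq_C_mul, map_mul]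
        exact this }
  let wt : ℕ → Submodule M (X → MvPolynomial V M) := fun d =>
    { carrier := {v | ∀ i, (v i).IsHomogeneous d}
      zero_mem' := fun i => MvPolynomial.isHomogeneous_zero _ _ _
      add_mem' := fun ha hb i => (ha i).add (hb i)
      smul_mem' := fun c a ha i => (MvPolynomial.homogeneousSubmodule V M d).smul_mem c (ha i) }
  let f : (X → MvPolynomial V M) →ₗ[M] (X → MvPolynomial V M) :=
    { toFun := fun v i => sop (1 : M ≃ₐ[T] M) (Matrix.diagonal fun _ => l ()) (v i)
      map_add' := fun a b => by funext i; simp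
      map_smul' := fun c a => by funext i; simp [sop_smul] }
  have hf : ∀ a, ∀ r ∈ wt a, f r = (l () ^ a) • r := by
    intro a r hr
    funext i
    have := sop_diag (T := T) (N := ℕ) (fun _ : V => 1) (powersHom M (l ())) (p := r i) (a := a) (hr i)
    have h2 : f r i = sop (1 : M ≃ₐ[T] M) (Matrix.diagonal fun _ => l ()) (r i) := rfl
    rw [h2]
    simpa [powersHom_apply] using this
  let J := J₀ ⊓ ⨆ d ∈ Finset.range n, wt d
  have hJ : ∀ r ∈ J, f r ∈ J := by
    rintro r ⟨h1, h2⟩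
    refine ⟨hsc _ (hl ()) r h1, ?_⟩
    have : (⨆ d ∈ Finset.range n, wt d) ≤ (⨆ d ∈ Finset.range n, wt d).comap f := by
      refine iSup₂_le fun d hd r hr => ?_
      rw [Submodule.mem_comap, hf d r hr]
      exact Submodule.smul_mem _ _ (Submodule.mem_iSup_of_mem d (Submodule.mem_iSup_of_mem hd hr))
    exact this h2
  have key := eig_mem f J hJ (Finset.range n) wt (fun a => l () ^ a) (by
    intro a ha b hb hab
    have := hinj (Finset.mem_coe.2 (Finset.mem_image_of_mem (fun d (_ : Unit) => d) ha))
      (Finset.mem_coe.2 (Finset.mem_image_of_mem (fun d (_ : Unit) => d) hb)) (by simpa using hab)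
    exact congrFun this ()) hf inf_le_right
  have hvJ : v ∈ J := by
    refine ⟨hv, ?_⟩
    have hs : v = ∑ d ∈ Finset.range n, fun i => MvPolynomial.homogeneousComponent d (v i) := by
      funext i
      rw [Finset.sum_apply]
      conv_lhs => rw [← MvPolynomial.sum_homogeneousComponent (v i)]
      refine Finset.sum_subset ?_ fun d _ hd => ?_
      · have : (v i).totalDegree ≤ Finset.univ.sup fun i => (v i).totalDegree :=
          Finset.le_sup (f := fun i => (v i).totalDegree) (Finset.mem_univ i)
        exact Finset.range_subset_range.2 (by simp only [n]; omega)
      · exact MvPolynomial.homogeneousComponent_eq_zero _ _ (by simpa using hd)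
    rw [hs]
    refine Submodule.sum_mem _ fun d hd => Submodule.mem_iSup_of_mem d (Submodule.mem_iSup_of_mem hd ?_)
    exact fun i => MvPolynomial.homogeneousComponent_isHomogeneous _ _
  let hc : (X → MvPolynomial V M) →ₗ[M] (X → MvPolynomial V M) :=
    { toFun := fun v i => MvPolynomial.homogeneousComponent d (v i)
      map_add' := fun a b => by funext i; simp
      map_smul' := fun c a => by funext i; simp }
  have hle : (⨆ a ∈ Finset.range n, (J ⊓ wt a)) ≤ J₀.comap hc := by
    refine iSup₂_le fun a ha r hr => ?_
    rw [Submodule.mem_comap]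
    by_cases had : a = d
    · have : hc r = r := by
        funext i
        change MvPolynomial.homogeneousComponent d (r i) = r i
        rw [MvPolynomial.homogeneousComponent_of_mem (hr.2 i), if_pos had.symm]
      rw [this]; exact hr.1.1
    · have : hc r = 0 := by
        funext i
        change MvPolynomial.homogeneousComponent d (r i) = 0
        rw [MvPolynomial.homogeneousComponent_of_mem (hr.2 i), if_neg (Ne.symm had)]
      rw [this]; exact J₀.zero_mem
  exact hle (key hvJ)

end hilb

end CE

namespace CE

set_option linter.unusedSectionVars false
set_option linter.unusedVariables false
set_option linter.style.longLine false

open Module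
open scoped Kronecker

section bmsec
variable {M : Type} [Field M] {n : ℕ} {Ξ : Type} [Fintype Ξ] [DecidableEq Ξ]

/-- block monomial matrices -/
def bm (π : Equiv.Perm Ξ) (B : Ξ → Matrix (Fin n) (Fin n) M) : Matrix (Fin n × Ξ) (Fin n × Ξ) M :=
  fun x y => if x.2 = π y.2 then B y.2 x.1 y.1 else 0

theorem bm_apply (π : Equiv.Perm Ξ) (B : Ξ → Matrix (Fin n) (Fin n) M) (x y) :
    bm π B x y = if x.2 = π y.2 then B y.2 x.1 y.1 else 0 := rfl

theorem bm_ne {π : Equiv.Perm Ξ} {B : Ξ → Matrix (Fin n) (Fin n) M} {x y} (h : bm π B x y ≠ 0) : x.2 = π y.2 := by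
  by_contra h'
  exact h (by rw [bm_apply, if_neg h'])

theorem bm_mul (π ρ : Equiv.Perm Ξ) (B C : Ξ → Matrix (Fin n) (Fin n) M) :
    bm π B * bm ρ C = bm (π * ρ) (fun ξ => B (ρ ξ) * C ξ) := by
  ext x y
  rw [Matrix.mul_apply, Fintype.sum_prod_type, bm_apply]
  have : ∀ i ξ, bm π B x (i, ξ) * bm ρ C (i, ξ) y = if ξ = ρ y.2 then (if x.2 = π ξ then B ξ x.1 i else 0) * C y.2 i y.1 else 0 := by
    intro i ξ
    rw [bm_apply, bm_apply]
    simp only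
    split_ifs <;> simp
  simp only [this, Finset.sum_ite_eq', Finset.mem_univ, if_true]
  by_cases h : x.2 = π (ρ y.2)
  · simp [h, Matrix.mul_apply]
  · simp [h]

theorem bm_map {M' : Type} [Field M'] (f : M → M') (hf : f 0 = 0) (π : Equiv.Perm Ξ) (B : Ξ → Matrix (Fin n) (Fin n) M) :
    (bm π B).map f = bm π (fun ξ => (B ξ).map f) := by
  ext x y
  simp only [Matrix.map_apply, bm_apply]
  split_ifs <;> simp [hf]

theorem bm_diag (l : Ξ → M) : bm (n := n) 1 (fun ξ => l ξ • 1) = Matrix.diagonal fun x => l x.2 := by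
  ext ⟨i, ξ⟩ ⟨j, η⟩
  rw [bm_apply, Matrix.diagonal_apply]
  by_cases h : ξ = η
  · subst h
    by_cases h : i = j
    · subst h; simp
    · simp [h]
  · simp [h]

theorem bm_one : bm (M := M) (n := n) (1 : Equiv.Perm Ξ) (fun _ => 1) = 1 := by
  have := bm_diag (n := n) (fun _ : Ξ => (1 : M))
  simpa using this

end bmsec

section vopsec
variable {T M ι₁ ι₂ : Type} [Field T] [Field M] [Algebra T M] [Fintype ι₁] [DecidableEq ι₁] [Fintype ι₂] [DecidableEq ι₂]

/-- semilinear operators on polynomial vectors -/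
noncomputable def vop (σ : M ≃ₐ[T] M) (A : Matrix ι₁ ι₁ M) (C : Matrix ι₂ ι₂ M) :
    (ι₁ → MvPolynomial (ι₁ × ι₂) M) →+ (ι₁ → MvPolynomial (ι₁ × ι₂) M) where
  toFun v := fun x => ∑ y, MvPolynomial.C (A x y) * sop σ (A ⊗ₖ C) (v y)
  map_zero' := by funext x; simp
  map_add' a b := by funext x; simp [mul_add, Finset.sum_add_distrib]

theorem vop_apply (σ : M ≃ₐ[T] M) (A : Matrix ι₁ ι₁ M) (C : Matrix ι₂ ι₂ M) (v x) :
    vop σ A C v x = ∑ y, MvPolynomial.C (A x y) * sop σ (A ⊗ₖ C) (v y) := rfl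

theorem vop_smul (σ : M ≃ₐ[T] M) (A : Matrix ι₁ ι₁ M) (C : Matrix ι₂ ι₂ M) (m : M) (v) :
    vop σ A C (m • v) = σ m • vop σ A C v := by
  funext x
  simp only [vop_apply, Pi.smul_apply, sop_smul, Finset.smul_sum, mul_smul_comm]

theorem kron_mul_map (σ : M ≃ₐ[T] M) (A A' : Matrix ι₁ ι₁ M) (C C' : Matrix ι₂ ι₂ M) :
    (A ⊗ₖ C) * (A' ⊗ₖ C').map σ = (A * A'.map σ) ⊗ₖ (C * C'.map σ) := by
  have : (A' ⊗ₖ C').map σ = (A'.map σ) ⊗ₖ (C'.map σ) := by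
    ext ⟨a, b⟩ ⟨c, d⟩; simp [Matrix.kroneckerMap_apply]
  rw [this, Matrix.mul_kronecker_mul]

theorem vop_vop (σ τ : M ≃ₐ[T] M) (A A' : Matrix ι₁ ι₁ M) (C C' : Matrix ι₂ ι₂ M) (v) :
    vop σ A C (vop τ A' C' v) = vop (σ * τ) (A * A'.map σ) (C * C'.map σ) v := by
  funext x
  simp only [vop_apply, map_sum, map_mul, sop_C, sop_sop, kron_mul_map, Matrix.mul_apply, Matrix.map_apply,
    Finset.mul_sum, Finset.sum_mul]
  rw [Finset.sum_comm]
  refine Finset.sum_congr rfl fun y _ => Finset.sum_congr rfl fun z _ => ?_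
  ring

theorem vop_one (v) : vop (1 : M ≃ₐ[T] M) (1 : Matrix ι₁ ι₁ M) (1 : Matrix ι₂ ι₂ M) v = v := by
  funext x
  rw [vop_apply, Finset.sum_eq_single x]
  · rw [Matrix.one_kronecker_one, sop_one]; simp
  · intro y _ h; rw [Matrix.one_apply_ne h.symm]; simp
  · simp

/-- weight spaces -/
def wtS {N : Type} [AddCommGroup N] (w : ι₁ × ι₂ → N) (u : ι₁ → N) (a : N) : Submodule M (ι₁ → MvPolynomial (ι₁ × ι₂) M) where
  carrier := {v | ∀ y, MvPolynomial.IsWeightedHomogeneous w (v y) (a - u y)}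
  zero_mem' := fun y => MvPolynomial.isWeightedHomogeneous_zero _ _ _
  add_mem' := fun h h' y => (h y).add (h' y)
  smul_mem' := fun c v h y => (MvPolynomial.weightedHomogeneousSubmodule M w _).smul_mem c (h y)

theorem mem_wtS {N : Type} [AddCommGroup N] {w : ι₁ × ι₂ → N} {u : ι₁ → N} {a : N} {v : ι₁ → MvPolynomial (ι₁ × ι₂) M} :
    v ∈ wtS w u a ↔ ∀ y, MvPolynomial.IsWeightedHomogeneous w (v y) (a - u y) := Iff.rfl

theorem vop_wt {N : Type} [AddCommGroup N] (w : ι₁ × ι₂ → N) (u : ι₁ → N) (φ : N →+ N)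
    (σ : M ≃ₐ[T] M) (A : Matrix ι₁ ι₁ M) (C : Matrix ι₂ ι₂ M)
    (hw : ∀ x y z t, A x y ≠ 0 → C z t ≠ 0 → w (x, z) = φ (w (y, t)))
    (hu : ∀ x y, A x y ≠ 0 → u x = φ (u y)) (a : N) (v) (hv : v ∈ wtS (M := M) w u a) :
    vop σ A C v ∈ wtS (M := M) w u (φ a) := by
  intro x
  rw [vop_apply]
  refine MvPolynomial.IsWeightedHomogeneous.sum _ _ _ fun y _ => ?_
  by_cases h : A x y = 0
  · rw [h]; simp [MvPolynomial.isWeightedHomogeneous_zero]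
  · apply MvPolynomial.IsWeightedHomogeneous.C_mul
    rw [hu x y h, ← map_sub]
    refine sop_whomog w w φ σ _ ?_ (hv y)
    rintro ⟨x, z⟩ ⟨y, t⟩ h
    rw [Matrix.kroneckerMap_apply] at h
    exact hw _ _ _ _ (left_ne_zero_of_mul h) (right_ne_zero_of_mul h)

theorem vop_diag {N : Type} [AddCommGroup N] (w : ι₁ × ι₂ → N) (u : ι₁ → N) (χ : Multiplicative N →* M)
    (α : ι₁ → M) (γ : ι₂ → M) (hw : ∀ x z, χ (.ofAdd (w (x, z))) = α x * γ z) (hu : ∀ x, χ (.ofAdd (u x)) = α x)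
    (a : N) (v) (hv : v ∈ wtS (M := M) w u a) :
    vop (1 : M ≃ₐ[T] M) (Matrix.diagonal α) (Matrix.diagonal γ) v = χ (.ofAdd a) • v := by
  funext x
  rw [vop_apply, Finset.sum_eq_single x]
  · have : Matrix.diagonal α ⊗ₖ Matrix.diagonal γ = Matrix.diagonal fun v => χ (.ofAdd (w v)) := by
      rw [Matrix.diagonal_kronecker_diagonal]
      congr 1
      funext v; exact (hw v.1 v.2).symm
    rw [this, sop_diag w χ (hv x), Matrix.diagonal_apply_eq, Pi.smul_apply, ← MvPolynomial.smul_eq_C_mul, smul_smul, ← hu,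
      ← map_mul, ← ofAdd_add]
    congr 3
    abel
  · intro y _ h; rw [Matrix.diagonal_apply_ne _ h.symm]; simp
  · simp

/-- the torus character -/
noncomputable def torusChar {Ξ : Type} [Fintype Ξ] (l : Ξ → M) (hl : ∀ ξ, l ξ ≠ 0) : Multiplicative (Ξ → ℤ) →* M where
  toFun f := ∏ ξ, l ξ ^ (f.toAdd ξ)
  map_one' := by simp
  map_mul' f g := by
    rw [← Finset.prod_mul_distrib]
    refine Finset.prod_congr rfl fun ξ _ => ?_
    rw [← zpow_add₀ (hl ξ)]; rfl

theorem torusChar_single {Ξ : Type} [Fintype Ξ] [DecidableEq Ξ] (l : Ξ → M) (hl : ∀ ξ, l ξ ≠ 0) (ξ : Ξ) :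
    torusChar l hl (.ofAdd (Pi.single ξ 1)) = l ξ := by
  change ∏ η, l η ^ ((Pi.single ξ 1 : Ξ → ℤ) η) = l ξ
  rw [Finset.prod_eq_single ξ]
  · simp
  · intro η _ h; simp [h]
  · simp

theorem torusChar_nat {Ξ : Type} [Fintype Ξ] (l : Ξ → M) (hl : ∀ ξ, l ξ ≠ 0) (a : Ξ → ℕ) :
    torusChar l hl (.ofAdd (fun ξ => (a ξ : ℤ))) = ∏ ξ, l ξ ^ a ξ := by
  change ∏ η, l η ^ ((a η : ℤ)) = _
  simp

/-- every homogeneous vector is a sum of weight vectors -/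
theorem mem_iSup_wtS {Ξ : Type} [Fintype Ξ] [DecidableEq Ξ] (b : ι₁ × ι₂ → Ξ) (u : ι₁ → Ξ → ℕ) (c : ℕ) (hu : ∀ y, ∑ ξ, u y ξ = c) (d : ℕ)
    (v : ι₁ → MvPolynomial (ι₁ × ι₂) M) (hv : ∀ y, (v y).IsHomogeneous d) :
    v ∈ ⨆ a ∈ Finset.piAntidiag (Finset.univ : Finset Ξ) (d + c),
      wtS (M := M) (fun x => (Pi.single (b x) 1 : Ξ → ℤ)) (fun y ξ => (u y ξ : ℤ)) (fun ξ => (a ξ : ℤ)) := by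
  classical
  have hs : v = ∑ y, ∑ m ∈ (v y).support, Pi.single y (MvPolynomial.monomial m ((v y).coeff m)) := by
    funext x
    rw [Finset.sum_apply, Finset.sum_eq_single x]
    · rw [Finset.sum_apply]
      simp only [Pi.single_eq_same]
      exact (v x).as_sum
    · intro y _ h
      rw [Finset.sum_apply]
      exact Finset.sum_eq_zero fun m _ => by rw [Pi.single_eq_of_ne h.symm]
    · simp
  rw [hs]
  refine Submodule.sum_mem _ fun y _ => Submodule.sum_mem _ fun m hm => ?_
  let a : Ξ → ℕ := Finsupp.weight (fun x => (Pi.single (b x) 1 : Ξ → ℕ)) m + u y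
  have hwt : (fun ξ => (a ξ : ℤ)) - (fun ξ => (u y ξ : ℤ)) = Finsupp.weight (fun x => (Pi.single (b x) 1 : Ξ → ℤ)) m := by
    funext ξ
    simp only [a, Pi.sub_apply, Pi.add_apply, Nat.cast_add, add_sub_cancel_right]
    rw [Finsupp.weight_apply, Finsupp.weight_apply, Finsupp.sum, Finsupp.sum, Finset.sum_apply, Finset.sum_apply]
    push_cast
    refine Finset.sum_congr rfl fun x _ => ?_
    simp only [Pi.smul_apply, smul_eq_mul, nsmul_eq_mul]
    by_cases h : ξ = b x
    · subst h; simp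
    · simp [h]
  have ha : ∑ ξ, a ξ = d + c := by
    simp only [a, Pi.add_apply, Finset.sum_add_distrib, hu]
    congr 1
    rw [← homog_deg (hv y) (by simpa using hm), Finsupp.weight_apply, Finsupp.sum, Finsupp.degree_apply]
    simp only [Finset.sum_apply]
    rw [Finset.sum_comm]
    refine Finset.sum_congr rfl fun x _ => ?_
    simp only [Pi.smul_apply, smul_eq_mul, ← Finset.mul_sum]
    rw [Finset.sum_pi_single']; simp
  refine Submodule.mem_iSup_of_mem a (Submodule.mem_iSup_of_mem (by simpa using ha) ?_)
  intro x
  by_cases h : x = y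
  · subst h
    rw [Pi.single_eq_same, hwt]
    exact MvPolynomial.isWeightedHomogeneous_monomial _ _ _ rfl
  · rw [Pi.single_eq_of_ne h]
    exact MvPolynomial.isWeightedHomogeneous_zero _ _ _

end vopsec

end CE

namespace CE

set_option linter.unusedSectionVars false
set_option linter.unusedVariables false
set_option linter.style.longLine false

open Module
open scoped Kronecker

theorem mem_iSup_mono {R N α : Type} [Semiring R] [AddCommMonoid N] [Module R N] {f : α → Submodule R N} {P Q : α → Prop}
    (h : ∀ a, P a → Q a) {v : N} (hv : v ∈ ⨆ a, ⨆ _ : P a, f a) : v ∈ ⨆ a, ⨆ _ : Q a, f a := by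
  have : (⨆ a, ⨆ _ : P a, f a) ≤ ⨆ a, ⨆ _ : Q a, f a := iSup₂_le fun a ha => le_iSup₂_of_le a (h a ha) le_rfl
  exact this hv

section opd
variable {T M : Type} [Field T] [Field M] [Algebra T M] [Fintype (M ≃ₐ[T] M)] [DecidableEq (M ≃ₐ[T] M)]

/-- left translation permutation -/
def tp (S : Type) (σ : M ≃ₐ[T] M) : Equiv.Perm ((M ≃ₐ[T] M) × S) := Equiv.prodCongr (Equiv.mulLeft σ) (Equiv.refl S)

theorem tp_one (S : Type) : tp S (1 : M ≃ₐ[T] M) = 1 := by ext x <;> simp [tp]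

theorem tp_mul (S : Type) (σ τ : M ≃ₐ[T] M) : tp S (σ * τ) = tp S σ * tp S τ := by
  refine Equiv.ext fun x => ?_
  exact Prod.ext (mul_assoc _ _ _) rfl

variable (n : ℕ) (S : Type) [Fintype S] [DecidableEq S]

/-- translation matrices -/
noncomputable def Rm (σ : M ≃ₐ[T] M) : Matrix (Fin n × ((M ≃ₐ[T] M) × S)) (Fin n × ((M ≃ₐ[T] M) × S)) M :=
  bm (tp S σ) (fun _ => 1)

theorem Rm_one : Rm n S (1 : M ≃ₐ[T] M) = 1 := by
  rw [Rm, tp_one, bm_one]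

theorem Rm_mul (σ τ : M ≃ₐ[T] M) : Rm n S σ * (Rm n S τ).map σ = Rm n S (σ * τ) := by
  rw [Rm, Rm, Rm, bm_map _ (map_zero σ), bm_mul, tp_mul]
  congr 1
  funext ξ
  rw [one_mul]
  exact Matrix.map_one _ (map_zero σ) (map_one σ)

/-- precomposition with a permutation -/
def permHom {Ξ : Type} (π : Equiv.Perm Ξ) : (Ξ → ℤ) →+ (Ξ → ℤ) where
  toFun f := f ∘ π.symm
  map_zero' := rfl
  map_add' _ _ := rfl

theorem permHom_single {Ξ : Type} [DecidableEq Ξ] (π : Equiv.Perm Ξ) (ξ : Ξ) :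
    permHom π (Pi.single ξ 1) = Pi.single (π ξ) 1 := by
  funext η
  change (Pi.single ξ 1 : Ξ → ℤ) (π.symm η) = _
  by_cases h : η = π ξ
  · subst h; simp
  · rw [Pi.single_eq_of_ne h, Pi.single_eq_of_ne]
    intro h'; exact h (by rw [← h']; simp)

variable (n₂ : ℕ) (S₂ : Type) [Fintype S₂] [DecidableEq S₂]

/-- operators for the first side -/
noncomputable def opd₁ : OpData T M n S ((Fin n × ((M ≃ₐ[T] M) × S)) → MvPolynomial ((Fin n × ((M ≃ₐ[T] M) × S)) × (Fin n₂ × ((M ≃ₐ[T] M) × S₂))) M) where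
  op σ π B := vop σ (bm π B) (Rm n₂ S₂ σ)
  op_smul σ π B m r := vop_smul _ _ _ _ _
  op_op σ π B τ ρ C r := by
    rw [vop_vop, Rm_mul, bm_map _ (map_zero σ), bm_mul]
  op_one r := by rw [bm_one, Rm_one, vop_one]
  wt a := wtS (fun x => (Pi.single x.1.2 1 : (M ≃ₐ[T] M) × S → ℤ)) (fun x => Pi.single x.2 1) (fun ξ => (a ξ : ℤ))
  wt_map σ π B a r hr := by
    refine vop_wt _ _ (permHom π) σ _ _ ?_ ?_ _ _ hr
    · intro x y z t h _
      simp only [permHom_single, bm_ne h]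
    · intro x y h
      simp only [permHom_single, bm_ne h]
  wt_diag l hl a r hr := by
    rw [bm_diag, Rm_one, ← Matrix.diagonal_one, vop_diag _ _ (torusChar l hl) _ _ ?_ ?_ _ _ hr, torusChar_nat]
    · intro x z; rw [torusChar_single, mul_one]
    · intro x; rw [torusChar_single]

/-- operators for the second side -/
noncomputable def opd₂ : OpData T M n₂ S₂ ((Fin n × ((M ≃ₐ[T] M) × S)) → MvPolynomial ((Fin n × ((M ≃ₐ[T] M) × S)) × (Fin n₂ × ((M ≃ₐ[T] M) × S₂))) M) where
  op σ π B := vop σ (Rm n S σ) (bm π B)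
  op_smul σ π B m r := vop_smul _ _ _ _ _
  op_op σ π B τ ρ C r := by
    rw [vop_vop, Rm_mul, bm_map _ (map_zero σ), bm_mul]
  op_one r := by rw [bm_one, Rm_one, vop_one]
  wt a := wtS (fun x => (Pi.single x.2.2 1 : (M ≃ₐ[T] M) × S₂ → ℤ)) (fun x => 0) (fun ξ => (a ξ : ℤ))
  wt_map σ π B a r hr := by
    refine vop_wt _ _ (permHom π) σ _ _ ?_ ?_ _ _ hr
    · intro x y z t _ h
      simp only [permHom_single, bm_ne h]
    · intro x y h
      simp only [map_zero]
  wt_diag l hl a r hr := by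
    rw [bm_diag, Rm_one, ← Matrix.diagonal_one, vop_diag _ _ (torusChar l hl) _ _ ?_ ?_ _ _ hr, torusChar_nat]
    · intro x z; rw [torusChar_single, one_mul]
    · intro x; rw [ofAdd_zero, map_one]

theorem mem_wt₁ (d : ℕ) (v : (Fin n × ((M ≃ₐ[T] M) × S)) → MvPolynomial ((Fin n × ((M ≃ₐ[T] M) × S)) × (Fin n₂ × ((M ≃ₐ[T] M) × S₂))) M)
    (hv : ∀ y, (v y).IsHomogeneous d) : v ∈ ⨆ a : (M ≃ₐ[T] M) × S → ℕ, ⨆ (_ : ∑ ξ, a ξ = d + 1), (opd₁ n S n₂ S₂).wt a := by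
  have := mem_iSup_wtS (M := M) (fun x : (Fin n × ((M ≃ₐ[T] M) × S)) × (Fin n₂ × ((M ≃ₐ[T] M) × S₂)) => x.1.2)
    (fun y => Pi.single y.2 1) 1 (fun y => by simp) d v hv
  have e : (fun (y : Fin n × ((M ≃ₐ[T] M) × S)) ξ => (((Pi.single y.2 1 : (M ≃ₐ[T] M) × S → ℕ) ξ : ℕ) : ℤ)) = fun y => Pi.single y.2 1 := by
    funext y ξ
    by_cases h : ξ = y.2
    · subst h; simp
    · simp [h]
  rw [e] at this
  exact mem_iSup_mono (fun a ha => by simpa using ha) this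

theorem mem_wt₂ (d : ℕ) (v : (Fin n × ((M ≃ₐ[T] M) × S)) → MvPolynomial ((Fin n × ((M ≃ₐ[T] M) × S)) × (Fin n₂ × ((M ≃ₐ[T] M) × S₂))) M)
    (hv : ∀ y, (v y).IsHomogeneous d) : v ∈ ⨆ a : (M ≃ₐ[T] M) × S₂ → ℕ, ⨆ (_ : ∑ ξ, a ξ = d), (opd₂ n S n₂ S₂).wt a := by
  have := mem_iSup_wtS (M := M) (fun x : (Fin n × ((M ≃ₐ[T] M) × S)) × (Fin n₂ × ((M ≃ₐ[T] M) × S₂)) => x.2.2)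
    (fun y _ => 0) 0 (fun y => by simp) d v hv
  have e : (fun (y : Fin n × ((M ≃ₐ[T] M) × S)) (ξ : (M ≃ₐ[T] M) × S₂) => ((0 : ℕ) : ℤ)) = fun y => 0 := by
    funext y ξ; simp
  rw [e] at this
  exact mem_iSup_mono (fun a ha => by simpa using ha) this

end opd

/-- splitting data for a division algebra -/
structure SplitData (T M : Type) [Field T] [Field M] [Algebra T M] (D : Type) [DivisionRing D] [Algebra T D] where
  n : ℕ
  hn : n ≠ 0
  θ : D →ₐ[T] Matrix (Fin n) (Fin n) M
  GK : Subgroup (M ≃ₐ[T] M)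
  hSN : ∀ h ∈ GK, ∃ N : Matrix (Fin n) (Fin n) M, N.det ≠ 0 ∧ ∀ d, N * θ d = (θ d).map h * N
  hSc : ∀ A : Matrix (Fin n) (Fin n) M, (∀ d, A * θ d = θ d * A) → ∃ c : M, A = c • 1
  hcard : Nat.card (M ≃ₐ[T] M) * n ^ 2 ∣ finrank T D * Nat.card GK

section irred
variable {T M : Type} [Field T] [Field M] [Algebra T M] [Fintype (M ≃ₐ[T] M)] [DecidableEq (M ≃ₐ[T] M)]
  [FiniteDimensional T M] [IsGalois T M] [Infinite M]
  {D₁ D₂ : Type} [DivisionRing D₁] [Algebra T D₁] [FiniteDimensional T D₁]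
  [DivisionRing D₂] [Algebra T D₂] [FiniteDimensional T D₂]
  (s₁ : SplitData T M D₁) (s₂ : SplitData T M D₂)
  (S₁ S₂ : Type) [Group S₁] [Fintype S₁] [DecidableEq S₁] [Group S₂] [Fintype S₂] [DecidableEq S₂]

theorem admB_tp {D : Type} [DivisionRing D] [Algebra T D] {n : ℕ} (θ : D →ₐ[T] Matrix (Fin n) (Fin n) M) (S : Type) (σ : M ≃ₐ[T] M) :
    AdmB θ σ (tp S σ) (fun _ => 1) := by
  refine ⟨fun ξ => by simp, fun d ξ => ?_⟩
  rw [one_mul, mul_one]; rfl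

/-- dvd from prime powers -/
theorem dvd_of_prime_pows {N r : ℕ} (hN : N ≠ 0) (h : ∀ p k, p.Prime → p ^ k ∣ N → p ^ k ∣ r) : N ∣ r := by
  rcases eq_or_ne r 0 with rfl | hr
  · exact dvd_zero _
  · rw [Nat.dvd_iff_prime_pow_dvd_dvd]
    exact fun p k hp hk => h p k hp hk

theorem irred {L : Type} [Field L]
    [Algebra (MvPolynomial ((Fin s₁.n × ((M ≃ₐ[T] M) × S₁)) × (Fin s₂.n × ((M ≃ₐ[T] M) × S₂))) M) L]
    [IsFractionRing (MvPolynomial ((Fin s₁.n × ((M ≃ₐ[T] M) × S₁)) × (Fin s₂.n × ((M ≃ₐ[T] M) × S₂))) M) L]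
    (hS : s₁.n * Nat.card S₁ = s₂.n * Nat.card S₂)
    (𝓥 : Submodule L ((Fin s₁.n × ((M ≃ₐ[T] M) × S₁)) → L))
    (hst : ∀ σ π B π' B', AdmB s₁.θ (S := S₁) σ π B → AdmB s₂.θ (S := S₂) σ π' B' →
      ∀ v : (Fin s₁.n × ((M ≃ₐ[T] M) × S₁)) → MvPolynomial ((Fin s₁.n × ((M ≃ₐ[T] M) × S₁)) × (Fin s₂.n × ((M ≃ₐ[T] M) × S₂))) M,
        (fun i => algebraMap _ L (v i)) ∈ 𝓥 → (fun i => algebraMap _ L (vop σ (bm π B) (bm π' B') v i)) ∈ 𝓥) :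
    𝓥 = ⊥ ∨ 𝓥 = ⊤ := by
  classical
  have hhom := hhom_of_scaling T 𝓥 (by
    intro l hl v hv
    have h1 := hst 1 1 (fun _ => l • 1) 1 (fun _ => 1)
      ⟨fun ξ => by simp [Matrix.det_smul, hl], fun d ξ => by simp⟩
      ⟨fun ξ => by simp, fun d ξ => by simp⟩ v hv
    have h2 := 𝓥.smul_mem (algebraMap (MvPolynomial ((Fin s₁.n × ((M ≃ₐ[T] M) × S₁)) × (Fin s₂.n × ((M ≃ₐ[T] M) × S₂))) M) L (MvPolynomial.C l⁻¹)) h1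
    convert h2 using 1
    funext x
    rw [Pi.smul_apply, smul_eq_mul, ← map_mul]
    congr 1
    rw [bm_diag (fun _ => l), bm_one, vop_apply, Finset.sum_eq_single x]
    · have : (Matrix.diagonal fun _ => l : Matrix (Fin s₁.n × ((M ≃ₐ[T] M) × S₁)) (Fin s₁.n × ((M ≃ₐ[T] M) × S₁)) M) ⊗ₖ (1 : Matrix (Fin s₂.n × ((M ≃ₐ[T] M) × S₂)) (Fin s₂.n × ((M ≃ₐ[T] M) × S₂)) M) = Matrix.diagonal fun _ => l := by
        rw [← Matrix.diagonal_one, Matrix.diagonal_kronecker_diagonal]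
        simp
      rw [this, Matrix.diagonal_apply_eq, ← mul_assoc, ← map_mul, inv_mul_cancel₀ hl, map_one, one_mul]
    · intro y _ h
      rw [Matrix.diagonal_apply_ne _ h.symm]; simp
    · simp)
  have hJfin : ∀ d, FiniteDimensional M (Jd (M := M) (V := (Fin s₁.n × ((M ≃ₐ[T] M) × S₁)) × (Fin s₂.n × ((M ≃ₐ[T] M) × S₂))) 𝓥 d) := by
    intro d
    letI : LinearOrder (Fin s₁.n × ((M ≃ₐ[T] M) × S₁)) := LinearOrder.lift' (Fintype.equivFin _) (Fintype.equivFin _).injective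
    letI : LinearOrder (((Fin s₁.n × ((M ≃ₐ[T] M) × S₁)) × (Fin s₂.n × ((M ≃ₐ[T] M) × S₂)))) := LinearOrder.lift' (Fintype.equivFin _) (Fintype.equivFin _).injective
    exact (Jd_finrank MonomialOrder.lex 𝓥 d).1
  have hvh : ∀ (d : ℕ) (σ : M ≃ₐ[T] M) A C (v : (Fin s₁.n × ((M ≃ₐ[T] M) × S₁)) → MvPolynomial ((Fin s₁.n × ((M ≃ₐ[T] M) × S₁)) × (Fin s₂.n × ((M ≃ₐ[T] M) × S₂))) M),
      (∀ i, (v i).IsHomogeneous d) → ∀ i, (vop σ A C v i).IsHomogeneous d := by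
    intro d σ A C v hv i
    rw [vop_apply]
    refine MvPolynomial.IsWeightedHomogeneous.sum _ _ _ fun y _ => ?_
    apply MvPolynomial.IsWeightedHomogeneous.C_mul
    exact sop_whomog (fun _ => 1) (fun _ => 1) (AddMonoidHom.id ℕ) σ _ (fun _ _ _ => rfl) (hv y)
  have hN : Nat.card (M ≃ₐ[T] M) * s₁.n * Nat.card S₁ ≠ 0 :=
    mul_ne_zero (mul_ne_zero Nat.card_pos.ne' s₁.hn) Nat.card_pos.ne'
  have hdvd : Nat.card (M ≃ₐ[T] M) * s₁.n * Nat.card S₁ ∣ finrank L 𝓥 := by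
    refine dvd_of_prime_pows hN fun p k hp hk => ?_
    refine hilbert 𝓥 hhom _ fun d => ?_
    have := hJfin d
    by_cases hpd : p ∣ d + 1
    · have hpd' : ¬ p ∣ d := fun h => hp.one_lt.ne' (Nat.dvd_one.1 ((Nat.dvd_add_right h).1 hpd))
      refine claim s₂.θ s₂.GK (opd₂ s₁.n S₁ s₂.n S₂) (Jd 𝓥 d) s₂.hSN s₂.hSc ?_ s₂.hn s₂.hcard p hp k ?_ d hpd' ?_
      · intro σ π B h r hr
        exact ⟨hvh d _ _ _ _ hr.1, hst σ _ _ _ _ (admB_tp s₁.θ S₁ σ) h r hr.2⟩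
      · rw [mul_assoc, ← hS, ← mul_assoc]; exact hk
      · intro v hv
        refine mem_iSup_mono (fun a ha => by simpa using ha) (mem_wt₂ s₁.n S₁ s₂.n S₂ d v hv.1)
    · refine claim s₁.θ s₁.GK (opd₁ s₁.n S₁ s₂.n S₂) (Jd 𝓥 d) s₁.hSN s₁.hSc ?_ s₁.hn s₁.hcard p hp k hk (d + 1) hpd ?_
      · intro σ π B h r hr
        exact ⟨hvh d _ _ _ _ hr.1, hst σ _ _ _ _ h (admB_tp s₂.θ S₂ σ) r hr.2⟩
      · intro v hv
        refine mem_iSup_mono (fun a ha => by simpa using ha) (mem_wt₁ s₁.n S₁ s₂.n S₂ d v hv.1)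
  have htop : finrank L ((Fin s₁.n × ((M ≃ₐ[T] M) × S₁)) → L) = Nat.card (M ≃ₐ[T] M) * s₁.n * Nat.card S₁ := by
    rw [finrank_fintype_fun_eq_card]
    simp only [Fintype.card_prod, Fintype.card_fin, Nat.card_eq_fintype_card]; ring
  rcases Nat.eq_zero_or_pos (finrank L 𝓥) with h0 | h0
  · left; exact Submodule.finrank_eq_zero.1 h0
  · right
    apply Submodule.eq_top_of_finrank_eq
    apply le_antisymm (Submodule.finrank_le _)
    rw [htop]
    exact Nat.le_of_dvd h0 hdvd

end irred

end CE

namespace CE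

set_option linter.unusedSectionVars false
set_option linter.unusedVariables false
set_option linter.style.longLine false

open Module
open scoped Kronecker Matrix

section tw
variable {T L ι H : Type} [Field T] [Field L] [Algebra T L] [Fintype ι] [DecidableEq ι]

/-- commutant of a family of semilinear operators -/
def twE (τ : H → L →ₐ[T] L) (A : H → Matrix ι ι L) : Subalgebra T (Matrix ι ι L) where
  carrier := {φ | ∀ h, A h * φ.map (τ h) = φ * A h}
  mul_mem' := by
    intro a b ha hb h
    have : (a * b).map (τ h) = a.map (τ h) * b.map (τ h) := Matrix.map_mul
    rw [this, ← mul_assoc, ha h, mul_assoc, hb h, mul_assoc]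
  add_mem' := by
    intro a b ha hb h
    have : (a + b).map (τ h) = a.map (τ h) + b.map (τ h) := Matrix.map_add _ (map_add _) _ _
    rw [this, mul_add, ha h, hb h, add_mul]
  algebraMap_mem' := by
    intro t h
    have : (algebraMap T (Matrix ι ι L) t).map (τ h) = algebraMap T (Matrix ι ι L) t := by
      ext i j
      simp only [Matrix.map_apply, Matrix.algebraMap_matrix_apply]
      split_ifs <;> simp
    rw [this, Algebra.commutes]

theorem mem_twE {τ : H → L →ₐ[T] L} {A : H → Matrix ι ι L} {φ : Matrix ι ι L} :
    φ ∈ twE τ A ↔ ∀ h, A h * φ.map (τ h) = φ * A h := Iff.rfl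

variable (τ : H → L →ₐ[T] L) (A : H → Matrix ι ι L)

theorem twE_unit (hirr : ∀ 𝓥 : Submodule L (ι → L), (∀ h v, v ∈ 𝓥 → A h *ᵥ (fun i => τ h (v i)) ∈ 𝓥) → 𝓥 = ⊥ ∨ 𝓥 = ⊤)
    (φ : twE τ A) : IsUnit φ ∨ φ = 0 := by
  obtain ⟨φ, hφ⟩ := φ
  rw [mem_twE] at hφ
  rcases hirr (LinearMap.ker (Matrix.mulVecLin φ)) (by
    intro h v hv
    rw [LinearMap.mem_ker, Matrix.mulVecLin_apply] at hv ⊢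
    rw [Matrix.mulVec_mulVec, ← hφ h, ← Matrix.mulVec_mulVec]
    have : φ.map (τ h) *ᵥ (fun i => τ h (v i)) = fun i => τ h ((φ *ᵥ v) i) := by
      funext i
      simp [Matrix.mulVec, dotProduct]
    rw [this, hv]
    simp only [Pi.zero_apply, map_zero]
    exact Matrix.mulVec_zero _) with h0 | h0
  · left
    have hu : IsUnit φ := by
      rw [← Matrix.mulVec_injective_iff_isUnit]
      exact LinearMap.ker_eq_bot.1 h0
    have h1 : φ * φ⁻¹ = 1 := Matrix.mul_nonsing_inv _ ((Matrix.isUnit_iff_isUnit_det _).1 hu)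
    have h2 : φ⁻¹ * φ = 1 := Matrix.nonsing_inv_mul _ ((Matrix.isUnit_iff_isUnit_det _).1 hu)
    have hm : φ⁻¹ ∈ twE τ A := by
      intro h
      have e1 : φ.map (τ h) * φ⁻¹.map (τ h) = 1 := by
        have : (φ * φ⁻¹).map (τ h) = φ.map (τ h) * φ⁻¹.map (τ h) := Matrix.map_mul
        rw [← this, h1, Matrix.map_one _ (map_zero _) (map_one _)]
      calc A h * φ⁻¹.map (τ h) = φ⁻¹ * (φ * A h) * φ⁻¹.map (τ h) := by rw [← mul_assoc φ⁻¹, h2, one_mul]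
        _ = φ⁻¹ * A h * (φ.map (τ h) * φ⁻¹.map (τ h)) := by rw [← hφ h]; simp only [mul_assoc]
        _ = _ := by rw [e1, mul_one]
    exact ⟨⟨⟨φ, hφ⟩, ⟨φ⁻¹, hm⟩, Subtype.ext h1, Subtype.ext h2⟩, rfl⟩
  · right
    apply Subtype.ext
    change φ = 0
    ext i j
    have : Pi.single j (1 : L) ∈ LinearMap.ker (Matrix.mulVecLin φ) := by rw [h0]; trivial
    rw [LinearMap.mem_ker, Matrix.mulVecLin_apply] at this
    simpa using congrFun this i

theorem twE_fin (hA : ∀ h, IsUnit (A h)) : Module.Finite (Subring.center (twE τ A)) (twE τ A) := by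
  classical
  obtain ⟨s, hs, hs2, hs3⟩ := exists_linearIndependent L (twE τ A : Set (Matrix ι ι L))
  have hfin : s.Finite := hs3.set_finite_of_isNoetherian
  -- coefficients are fixed
  have key : ∀ φ ∈ twE τ A, ∃ c : s → L, (∀ h i, τ h (c i) = c i) ∧ (haveI := hfin.fintype; φ = ∑ i, c i • (i : Matrix ι ι L)) := by
    letI := hfin.fintype
    intro φ hφ
    have h1 : φ ∈ Submodule.span L (Set.range ((↑) : s → Matrix ι ι L)) := by
      rw [Subtype.range_coe, hs2]
      exact Submodule.subset_span hφ
    rw [Submodule.mem_span_range_iff_exists_fun] at h1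
    obtain ⟨c, hc⟩ := h1
    refine ⟨c, fun h => ?_, hc.symm⟩
    have h2 : ∑ i, τ h (c i) • (i : Matrix ι ι L) = φ := by
      have h3 : φ.map (τ h) = ∑ i, τ h (c i) • (i : Matrix ι ι L).map (τ h) := by
        rw [← hc]
        ext a b
        simp [Matrix.sum_apply]
      have h4 := hφ h
      rw [h3, Finset.mul_sum] at h4
      have h5 : ∀ i : s, A h * (τ h (c i) • (i : Matrix ι ι L).map (τ h)) = (τ h (c i) • (i : Matrix ι ι L)) * A h := by
        intro i
        rw [Matrix.mul_smul, (hs i.2 : (i : Matrix ι ι L) ∈ twE τ A) h, Matrix.smul_mul]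
      rw [Finset.sum_congr rfl fun i _ => h5 i, ← Finset.sum_mul] at h4
      exact (hA h).mul_right_cancel h4
    have h6 : ∑ i, (τ h (c i) - c i) • (i : Matrix ι ι L) = 0 := by
      simp only [sub_smul, Finset.sum_sub_distrib]
      rw [h2, hc, sub_self]
    intro i
    exact sub_eq_zero.1 (Fintype.linearIndependent_iff.1 hs3 _ h6 i)
  letI := hfin.fintype
  have hsc : ∀ c : L, (∀ h, τ h c = c) → (c • (1 : Matrix ι ι L)) ∈ twE τ A := by
    intro c hc h
    have : (c • (1 : Matrix ι ι L)).map (τ h) = c • 1 := by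
      ext a b
      by_cases hab : a = b
      · subst hab; simp [hc]
      · simp [hab]
    rw [this]; simp
  have hcen : ∀ c (hc : ∀ h, τ h c = c), (⟨_, hsc c hc⟩ : twE τ A) ∈ Subring.center (twE τ A) := by
    intro c hc
    rw [Subring.mem_center_iff]
    intro g
    apply Subtype.ext
    simp
  refine ⟨⟨Finset.univ.image fun i : s => (⟨i, hs i.2⟩ : twE τ A), ?_⟩⟩
  rw [eq_top_iff]
  rintro ⟨φ, hφ⟩ -
  obtain ⟨c, hc, e⟩ := key φ hφ
  have : (⟨φ, hφ⟩ : twE τ A) = ∑ i : s, (⟨_, hcen (c i) fun h => hc h i⟩ : Subring.center (twE τ A)) • (⟨i, hs i.2⟩ : twE τ A) := by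
    apply Subtype.ext
    change φ = (twE τ A).val _
    rw [e, map_sum]
    refine Finset.sum_congr (by congr) fun i _ => ?_
    change _ = (c i • (1 : Matrix ι ι L)) * (i : Matrix ι ι L)
    simp
  rw [this]
  refine Submodule.sum_mem _ fun i _ => Submodule.smul_mem _ _ (Submodule.subset_span ?_)
  simp
end tw

end CE

namespace CE

set_option linter.unusedSectionVars false
set_option linter.unusedVariables false
set_option linter.style.longLine false

open Module
open scoped Kronecker Matrix

theorem sop_injective {T M V : Type} [Field T] [Field M] [Algebra T M] [Fintype V] [DecidableEq V]
    (σ : M ≃ₐ[T] M) (A : Matrix V V M) (hA : IsUnit A) : Function.Injective (sop σ A) := by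
  obtain ⟨B, hB⟩ := hA.exists_left_inv
  refine Function.LeftInverse.injective (g := sop σ⁻¹ (B.map ⇑(σ⁻¹))) fun p => ?_
  have : B.map ⇑(σ⁻¹) * A.map ⇑(σ⁻¹) = (B * A).map ⇑(σ⁻¹) := Matrix.map_mul.symm
  rw [sop_sop, this, hB, Matrix.map_one _ (map_zero _) (map_one _), inv_mul_cancel, sop_one]

section gen
variable {T M ι₁ ι₂ : Type} [Field T] [Field M] [Algebra T M] [Fintype ι₁] [DecidableEq ι₁] [Fintype ι₂] [DecidableEq ι₂]

/-- action of a semilinear substitution on the fraction field -/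
noncomputable def fr {V : Type} [Fintype V] [DecidableEq V] (σ : M ≃ₐ[T] M) (A : Matrix V V M) (hA : IsUnit A) :
    FractionRing (MvPolynomial V M) →ₐ[T] FractionRing (MvPolynomial V M) :=
  { IsFractionRing.map (K := FractionRing (MvPolynomial V M)) (L := FractionRing (MvPolynomial V M)) (sop_injective σ A hA) with
    commutes' := by
      intro t
      change IsFractionRing.map (sop_injective σ A hA) (algebraMap T _ t) = _
      rw [IsScalarTower.algebraMap_apply T (MvPolynomial V M) (FractionRing (MvPolynomial V M))]
      rw [IsFractionRing.map, IsLocalization.map_eq]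
      rw [IsScalarTower.algebraMap_apply T M (MvPolynomial V M), MvPolynomial.algebraMap_eq, sop_C, AlgEquiv.commutes] }

theorem fr_alg {V : Type} [Fintype V] [DecidableEq V] (σ : M ≃ₐ[T] M) (A : Matrix V V M) (hA : IsUnit A) (p : MvPolynomial V M) :
    fr σ A hA (algebraMap _ _ p) = algebraMap _ _ (sop σ A p) := by
  change IsFractionRing.map (sop_injective σ A hA) (algebraMap _ _ p) = _
  rw [IsFractionRing.map, IsLocalization.map_eq]

/-- constants -/
noncomputable def cst (V : Type) (M : Type) [Field M] : M →+* FractionRing (MvPolynomial V M) := (algebraMap (MvPolynomial V M) _).comp MvPolynomial.C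

theorem fr_cst {V : Type} [Fintype V] [DecidableEq V] (σ : M ≃ₐ[T] M) (A : Matrix V V M) (hA : IsUnit A) (m : M) :
    fr σ A hA (cst V M m) = cst V M (σ m) := by
  rw [cst, RingHom.comp_apply, fr_alg, sop_C]; rfl

/-- constants as algebra hom -/
noncomputable def cstA (T : Type) [Field T] [Algebra T M] (V : Type) : M →ₐ[T] FractionRing (MvPolynomial V M) :=
  { cst V M with
    commutes' := by
      intro t
      rw [IsScalarTower.algebraMap_apply T (MvPolynomial V M) (FractionRing (MvPolynomial V M)), IsScalarTower.algebraMap_apply T M (MvPolynomial V M), MvPolynomial.algebraMap_eq]; rfl }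

theorem fr_map {V n m : Type} [Fintype V] [DecidableEq V] (σ : M ≃ₐ[T] M) (A : Matrix V V M) (hA : IsUnit A) (B : Matrix n m M) :
    (B.map (cst V M)).map (fr σ A hA) = (B.map σ).map (cst V M) := by
  ext i j
  simp only [Matrix.map_apply, fr_cst]

theorem gen_inv (e : ι₁ ≃ ι₂) : ∃ Z : Matrix ι₁ ι₂ (FractionRing (MvPolynomial (ι₁ × ι₂) M)),
    (Matrix.of fun (j : ι₂) (i : ι₁) => algebraMap (MvPolynomial (ι₁ × ι₂) M) (FractionRing (MvPolynomial (ι₁ × ι₂) M)) (MvPolynomial.X (i, j))) * Z = 1 ∧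
    Z * (Matrix.of fun (j : ι₂) (i : ι₁) => algebraMap (MvPolynomial (ι₁ × ι₂) M) (FractionRing (MvPolynomial (ι₁ × ι₂) M)) (MvPolynomial.X (i, j))) = 1 := by
  set F := FractionRing (MvPolynomial (ι₁ × ι₂) M)
  set Y : Matrix ι₂ ι₁ F := Matrix.of fun (j : ι₂) (i : ι₁) => algebraMap (MvPolynomial (ι₁ × ι₂) M) F (MvPolynomial.X (i, j)) with hY
  have hdet : (Y.submatrix id e.symm).det ≠ 0 := by
    have h1 : Y.submatrix id e.symm = ((Matrix.mvPolynomialX ι₂ ι₂ M).map (MvPolynomial.rename (fun p : ι₂ × ι₂ => (e.symm p.2, p.1)))).map (algebraMap (MvPolynomial (ι₁ × ι₂) M) F) := by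
      ext a b
      simp [hY, Matrix.mvPolynomialX]
    have h2 : Function.Injective (fun p : ι₂ × ι₂ => (e.symm p.2, p.1)) := by
      rintro ⟨a, b⟩ ⟨c, d⟩ h
      simp at h
      exact Prod.ext h.2 h.1
    rw [h1, ← RingHom.mapMatrix_apply, ← RingHom.map_det, ← AlgHom.mapMatrix_apply, ← AlgHom.map_det]
    intro h
    rw [map_eq_zero_iff _ (IsFractionRing.injective _ _), map_eq_zero_iff _ (MvPolynomial.rename_injective _ h2)] at h
    exact Matrix.det_mvPolynomialX_ne_zero ι₂ M h
  have hu : IsUnit (Y.submatrix id e.symm).det := hdet.isUnit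
  have a1 := Matrix.mul_nonsing_inv _ hu
  have a2 := Matrix.nonsing_inv_mul _ hu
  set W := (Y.submatrix id e.symm)⁻¹
  refine ⟨W.submatrix e id, ?_, ?_⟩
  · have : Y * W.submatrix e id = (Y.submatrix id e.symm) * W := by
      ext a b
      simp only [Matrix.mul_apply, Matrix.submatrix_apply, id]
      exact Fintype.sum_equiv e _ _ (by simp)
    rw [this, a1]
  · have : W.submatrix e id * Y = (W * Y.submatrix id e.symm).submatrix e e := by
      ext a b
      simp [Matrix.mul_apply]
    rw [this, a2]
    simp

theorem gen {D₁ D₂ : Type} [DivisionRing D₁] [DivisionRing D₂] [Algebra T D₁] [Algebra T D₂] [Nonempty ι₁] (e : ι₁ ≃ ι₂) {H : Type} (σ : H → M ≃ₐ[T] M)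
    (A : H → Matrix ι₁ ι₁ M) (C : H → Matrix ι₂ ι₂ M) (hA : ∀ h, IsUnit (A h)) (hC : ∀ h, IsUnit (C h))
    (hirr : ∀ 𝓥 : Submodule (FractionRing (MvPolynomial (ι₁ × ι₂) M)) (ι₁ → FractionRing (MvPolynomial (ι₁ × ι₂) M)),
      (∀ h (v : ι₁ → MvPolynomial (ι₁ × ι₂) M), (fun i => algebraMap _ (FractionRing (MvPolynomial (ι₁ × ι₂) M)) (v i)) ∈ 𝓥 →
        (fun i => algebraMap _ (FractionRing (MvPolynomial (ι₁ × ι₂) M)) (vop (σ h) (A h) (C h) v i)) ∈ 𝓥) → 𝓥 = ⊥ ∨ 𝓥 = ⊤)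
    (r₁ : D₁ →ₐ[T] Matrix ι₁ ι₁ M) (hr₁ : ∀ d h, A h * (r₁ d).map (σ h) = r₁ d * A h)
    (r₂ : D₂ᵐᵒᵖ →ₐ[T] Matrix ι₂ ι₂ M) (hr₂ : ∀ d h, C h * (r₂ d).map (σ h) = r₂ d * C h) :
    ∃ (E : Type) (_ : DivisionRing E) (_ : Algebra T E), FiniteDimensional (Subring.center E) E ∧ Nonempty (D₁ →ₐ[T] E) ∧ Nonempty (D₂ →ₐ[T] E) := by
  classical
  have hK : ∀ h, IsUnit (A h ⊗ₖ C h) := by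
    intro h
    rw [Matrix.isUnit_iff_isUnit_det, Matrix.det_kronecker]
    exact (((Matrix.isUnit_iff_isUnit_det _).1 (hA h)).pow _).mul (((Matrix.isUnit_iff_isUnit_det _).1 (hC h)).pow _)
  let F := FractionRing (MvPolynomial (ι₁ × ι₂) M)
  let c : M →ₐ[T] F := cstA T (ι₁ × ι₂)
  let τ : H → F →ₐ[T] F := fun h => fr (σ h) _ (hK h)
  have hτm : ∀ {n m : Type} h (B : Matrix n m M), (B.map c).map (τ h) = (B.map (σ h)).map c := fun h B => fr_map _ _ _ _
  have cmul : ∀ {n m k : Type} [Fintype m] (B : Matrix n m M) (B' : Matrix m k M), B.map c * B'.map c = (B * B').map c := fun B B' => Matrix.map_mul.symm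
  let A' : H → Matrix ι₁ ι₁ F := fun h => (A h).map c
  have hA' : ∀ h, IsUnit (A' h) := fun h => (hA h).map (c.toRingHom.mapMatrix)
  have hu := twE_unit τ A' (by
    intro 𝓥 h𝓥
    apply hirr
    intro h v hv
    convert h𝓥 h _ hv using 1
    funext i
    rw [vop_apply, map_sum]
    simp only [Matrix.mulVec, dotProduct, map_mul]
    refine Finset.sum_congr rfl fun j _ => ?_
    congr 1
    exact (fr_alg _ _ (hK h) _).symm)
  letI : DivisionRing (twE τ A') := DivisionRing.ofIsUnitOrEqZero hu
  refine ⟨twE τ A', inferInstance, inferInstance, ?_, ?_, ?_⟩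
  · exact twE_fin τ A' hA'
  · refine ⟨(c.mapMatrix.comp r₁).codRestrict _ ?_⟩
    intro d h
    change (A h).map c * ((r₁ d).map c).map (τ h) = (r₁ d).map c * (A h).map c
    rw [hτm, cmul, hr₁, cmul]
  · obtain ⟨Z, hYZ, hZY⟩ := gen_inv (M := M) e
    set Y : Matrix ι₂ ι₁ F := Matrix.of fun (j : ι₂) (i : ι₁) => algebraMap (MvPolynomial (ι₁ × ι₂) M) F (MvPolynomial.X (i, j)) with hY
    have hhY : ∀ h, Y.map (τ h) = ((C h).map c)ᵀ * Y * A' h := by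
      intro h
      ext j i
      have : (Y.map (τ h)) j i = algebraMap _ F (sop (σ h) (A h ⊗ₖ C h) (MvPolynomial.X (i, j))) := fr_alg _ _ (hK h) _
      rw [this, sop_X, map_sum, Fintype.sum_prod_type, Matrix.mul_apply]
      refine Finset.sum_congr rfl fun i' _ => ?_
      rw [Matrix.mul_apply, Finset.sum_mul]
      refine Finset.sum_congr rfl fun j' _ => ?_
      rw [map_mul, Matrix.kroneckerMap_apply, map_mul, map_mul]
      change c (A h i' i) * c (C h j' j) * Y j' i' = c (C h j' j) * Y j' i' * c (A h i' i)
      ring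
    have tmul : ∀ {n m k : Type} [Fintype m] h (B : Matrix n m F) (B' : Matrix m k F), (B * B').map (τ h) = B.map (τ h) * B'.map (τ h) := fun h B B' => Matrix.map_mul
    have hhZ : ∀ h, A' h * Z.map (τ h) * ((C h).map c)ᵀ = Z := by
      intro h
      have h1 : Z.map (τ h) * Y.map (τ h) = 1 := by
        rw [← tmul, hZY, Matrix.map_one _ (map_zero _) (map_one _)]
      rw [hhY] at h1
      have h2 : (A' h * Z.map (τ h) * ((C h).map c)ᵀ * Y) * A' h = 1 * A' h := by
        have : (A' h * Z.map (τ h) * ((C h).map c)ᵀ * Y) * A' h = A' h * (Z.map (τ h) * (((C h).map c)ᵀ * Y * A' h)) := by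
          simp only [Matrix.mul_assoc]
        rw [this, h1, mul_one, one_mul]
      have h3 := (hA' h).mul_right_cancel h2
      calc A' h * Z.map (τ h) * ((C h).map c)ᵀ = A' h * Z.map (τ h) * ((C h).map c)ᵀ * (Y * Z) := by rw [hYZ, Matrix.mul_one]
        _ = (A' h * Z.map (τ h) * ((C h).map c)ᵀ * Y) * Z := by simp only [Matrix.mul_assoc]
        _ = Z := by rw [h3, Matrix.one_mul]
    let R : D₂ → Matrix ι₂ ι₂ F := fun d => ((r₂ (MulOpposite.op d)).map c)ᵀ
    have hRh : ∀ h d, (R d).map (τ h) * ((C h).map c)ᵀ = ((C h).map c)ᵀ * R d := by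
      intro h d
      have : (R d).map (τ h) = (((r₂ (MulOpposite.op d)).map (σ h)).map c)ᵀ := by
        rw [← hτm]; rfl
      rw [this, ← Matrix.transpose_mul, ← Matrix.transpose_mul, cmul, cmul, hr₂]
    have hRm : ∀ d d', R (d * d') = R d * R d' := by
      intro d d'
      simp only [R]
      rw [← Matrix.transpose_mul, cmul, MulOpposite.op_mul, map_mul]
    have hR1 : R 1 = 1 := by
      simp only [R]
      rw [MulOpposite.op_one, map_one, Matrix.map_one _ (map_zero _) (map_one _), Matrix.transpose_one]
    let ψ : D₂ →ₐ[T] Matrix ι₁ ι₁ F := AlgHom.ofLinearMap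
      { toFun := fun d => Z * R d * Y
        map_add' := by
          intro d d'
          have : R (d + d') = R d + R d' := by
            simp only [R]
            rw [MulOpposite.op_add, map_add, Matrix.map_add _ (map_add c), Matrix.transpose_add]
          rw [this, Matrix.mul_add, Matrix.add_mul]
        map_smul' := by
          intro t d
          have : R (t • d) = t • R d := by
            simp only [R]
            rw [MulOpposite.op_smul, map_smul]
            ext a b
            simp
          rw [this, Matrix.mul_smul, Matrix.smul_mul]; rfl }
      (by
        change Z * R 1 * Y = 1
        rw [hR1, Matrix.mul_one, hZY])
      (by
        intro d d'
        change Z * R (d * d') * Y = Z * R d * Y * (Z * R d' * Y)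
        calc Z * R (d * d') * Y = Z * R d * ((1 : Matrix ι₂ ι₂ F) * (R d' * Y)) := by rw [hRm]; simp only [Matrix.mul_assoc, Matrix.one_mul]
          _ = _ := by rw [← hYZ]; simp only [Matrix.mul_assoc])
    refine ⟨ψ.codRestrict _ ?_⟩
    intro d h
    change A' h * (Z * R d * Y).map (τ h) = Z * R d * Y * A' h
    rw [tmul, tmul, hhY]
    calc A' h * (Z.map (τ h) * (R d).map (τ h) * (((C h).map c)ᵀ * Y * A' h))
        = A' h * Z.map (τ h) * ((R d).map (τ h) * ((C h).map c)ᵀ) * Y * A' h := by simp only [Matrix.mul_assoc]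
      _ = (A' h * Z.map (τ h) * ((C h).map c)ᵀ) * R d * Y * A' h := by rw [hRh]; simp only [Matrix.mul_assoc]
      _ = _ := by rw [hhZ]
end gen
end CE

namespace CE

set_option linter.unusedSectionVars false
set_option linter.unusedVariables false
set_option linter.style.longLine false

open Module
open scoped Kronecker Matrix

theorem bm_isUnit {M : Type} [Field M] {n : ℕ} {Ξ : Type} [Fintype Ξ] [DecidableEq Ξ] (π : Equiv.Perm Ξ)
    (B : Ξ → Matrix (Fin n) (Fin n) M) (hB : ∀ ξ, (B ξ).det ≠ 0) : IsUnit (bm π B) := by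
  have h : bm π B * bm π⁻¹ (fun ξ => (B (π⁻¹ ξ))⁻¹) = 1 := by
    rw [bm_mul, mul_inv_cancel, ← bm_one]
    congr 1
    funext ξ
    exact Matrix.mul_nonsing_inv _ (hB _).isUnit
  exact IsUnit.of_mul_eq_one _ h

section comb
variable {T M : Type} [Field T] [Field M] [Algebra T M] [Fintype (M ≃ₐ[T] M)] [DecidableEq (M ≃ₐ[T] M)]

/-- sum of the conjugates of a representation -/
noncomputable def rho {D : Type} [DivisionRing D] [Algebra T D] {n : ℕ} (θ : D →ₐ[T] Matrix (Fin n) (Fin n) M) (S : Type) [Fintype S] [DecidableEq S] :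
    D →ₐ[T] Matrix (Fin n × ((M ≃ₐ[T] M) × S)) (Fin n × ((M ≃ₐ[T] M) × S)) M := AlgHom.ofLinearMap
  { toFun := fun d => bm 1 (fun ξ => (θ d).map ξ.1)
    map_add' := by
      intro d d'
      ext x y
      simp only [bm_apply, Matrix.add_apply, map_add, Matrix.map_apply]
      split_ifs <;> simp
    map_smul' := by
      intro t d
      ext x y
      simp only [bm_apply, Matrix.smul_apply, map_smul, Matrix.map_apply, RingHom.id_apply]
      split_ifs <;> simp }
  (by
    rw [LinearMap.coe_mk, AddHom.coe_mk, ← bm_one]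
    congr 1
    funext ξ
    rw [map_one, Matrix.map_one _ (map_zero _) (map_one _)])
  (by
    intro d d'
    simp only [LinearMap.coe_mk, AddHom.coe_mk]
    rw [bm_mul, mul_one]
    congr 1
    funext ξ
    rw [map_mul]
    exact Matrix.map_mul)

theorem rho_apply {D : Type} [DivisionRing D] [Algebra T D] {n : ℕ} (θ : D →ₐ[T] Matrix (Fin n) (Fin n) M) (S : Type) [Fintype S] [DecidableEq S] (d : D) :
    rho θ S d = bm 1 (fun ξ => (θ d).map ξ.1) := rfl

theorem rho_comm {D : Type} [DivisionRing D] [Algebra T D] {n : ℕ} (θ : D →ₐ[T] Matrix (Fin n) (Fin n) M) (S : Type) [Fintype S] [DecidableEq S]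
    {σ : M ≃ₐ[T] M} {π B} (h : AdmB θ (S := S) σ π B) (d : D) : bm π B * (rho θ S d).map σ = rho θ S d * bm π B := by
  rw [rho_apply, bm_map _ (map_zero σ), bm_mul, bm_mul, mul_one, one_mul]
  congr 1
  funext ξ
  exact h.comm d ξ

theorem of_split [FiniteDimensional T M] [IsGalois T M] [Infinite M] {D₁ D₂ : Type} [DivisionRing D₁] [DivisionRing D₂] [Algebra T D₁] [Algebra T D₂]
    [FiniteDimensional T D₁] [FiniteDimensional T D₂] (s₁ : SplitData T M D₁) (s₂ : SplitData T M D₂ᵐᵒᵖ) :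
    ∃ (E : Type) (_ : DivisionRing E) (_ : Algebra T E), FiniteDimensional (Subring.center E) E ∧ Nonempty (D₁ →ₐ[T] E) ∧ Nonempty (D₂ →ₐ[T] E) := by
  classical
  haveI : NeZero s₁.n := ⟨s₁.hn⟩
  haveI : NeZero s₂.n := ⟨s₂.hn⟩
  haveI : FiniteDimensional T D₂ᵐᵒᵖ := Module.Finite.equiv (MulOpposite.opLinearEquiv T)
  let S₁ := Multiplicative (ZMod s₂.n)
  let S₂ := Multiplicative (ZMod s₁.n)
  haveI : Fintype S₁ := Fintype.ofFinite _
  haveI : Fintype S₂ := Fintype.ofFinite _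
  have c1 : Nat.card S₁ = s₂.n := Nat.card_zmod _
  have c2 : Nat.card S₂ = s₁.n := Nat.card_zmod _
  have hS : s₁.n * Nat.card S₁ = s₂.n * Nat.card S₂ := by rw [c1, c2, mul_comm]
  let ι₁ := Fin s₁.n × ((M ≃ₐ[T] M) × S₁)
  let ι₂ := Fin s₂.n × ((M ≃ₐ[T] M) × S₂)
  have hcard : Fintype.card ι₁ = Fintype.card ι₂ := by
    rw [← Nat.card_eq_fintype_card, ← Nat.card_eq_fintype_card]
    simp only [ι₁, ι₂, Nat.card_prod, Nat.card_fin]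
    rw [mul_left_comm, hS, mul_left_comm]
  let e : ι₁ ≃ ι₂ := Fintype.equivOfCardEq hcard
  let H := {x : (M ≃ₐ[T] M) × (Equiv.Perm ((M ≃ₐ[T] M) × S₁) × ((M ≃ₐ[T] M) × S₁ → Matrix (Fin s₁.n) (Fin s₁.n) M)) ×
    (Equiv.Perm ((M ≃ₐ[T] M) × S₂) × ((M ≃ₐ[T] M) × S₂ → Matrix (Fin s₂.n) (Fin s₂.n) M)) //
    AdmB s₁.θ (S := S₁) x.1 x.2.1.1 x.2.1.2 ∧ AdmB s₂.θ (S := S₂) x.1 x.2.2.1 x.2.2.2}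
  refine gen (ι₁ := ι₁) (ι₂ := ι₂) (H := H) e (fun h => h.1.1) (fun h => bm h.1.2.1.1 h.1.2.1.2) (fun h => bm h.1.2.2.1 h.1.2.2.2)
    (fun h => bm_isUnit _ _ h.2.1.det) (fun h => bm_isUnit _ _ h.2.2.det) ?_
    (rho s₁.θ S₁) (fun d h => rho_comm _ _ h.2.1 d) (rho s₂.θ S₂) (fun d h => rho_comm _ _ h.2.2 d)
  intro 𝓥 h𝓥
  refine irred s₁ s₂ S₁ S₂ hS 𝓥 ?_
  intro σ π B π' B' hB hB' v hv
  exact h𝓥 ⟨⟨σ, ⟨π, B⟩, ⟨π', B'⟩⟩, hB, hB'⟩ v hv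
end comb
end CE

namespace CE

set_option linter.unusedSectionVars false
set_option linter.unusedVariables false
set_option linter.style.longLine false

open Module
open scoped TensorProduct

section tens
variable {K M D : Type} [Field K] [Field M] [Algebra K M] [DivisionRing D] [Algebra K D]

theorem eqv_mul_right {ι : Type} [DecidableEq ι] (b : Basis ι K M) (x : M ⊗[K] D) (d : D) (i : ι) :
    TensorProduct.equivFinsuppOfBasisLeft b (x * (1 ⊗ₜ d)) i = TensorProduct.equivFinsuppOfBasisLeft b x i * d := by
  induction x with
  | zero => simp
  | add x y hx hy => simp [add_mul, hx, hy]
  | tmul m e => simp [TensorProduct.equivFinsuppOfBasisLeft_apply_tmul_apply]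

theorem eqv_mul_left {ι : Type} [DecidableEq ι] (b : Basis ι K M) (x : M ⊗[K] D) (d : D) (i : ι) :
    TensorProduct.equivFinsuppOfBasisLeft b ((1 ⊗ₜ d) * x) i = d * TensorProduct.equivFinsuppOfBasisLeft b x i := by
  induction x with
  | zero => simp
  | add x y hx hy => simp [mul_add, hx, hy]
  | tmul m e => simp [TensorProduct.equivFinsuppOfBasisLeft_apply_tmul_apply]

theorem eq_left_of_comm (hc : Subalgebra.center K D = ⊥) (x : M ⊗[K] D) (hx : ∀ d : D, (1 ⊗ₜ d) * x = x * (1 ⊗ₜ d)) :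
    ∃ m : M, x = m ⊗ₜ 1 := by
  classical
  let b := Basis.ofVectorSpace K M
  have h1 : ∀ i, ∃ c : K, TensorProduct.equivFinsuppOfBasisLeft b x i = algebraMap K D c := by
    intro i
    have : TensorProduct.equivFinsuppOfBasisLeft b x i ∈ Subalgebra.center K D := by
      rw [Subalgebra.mem_center_iff]
      intro d
      rw [← eqv_mul_right, ← eqv_mul_left, hx]
    rw [hc, Algebra.mem_bot] at this
    obtain ⟨c, hc⟩ := this
    exact ⟨c, hc.symm⟩
  choose c hc using h1
  have h2 := (TensorProduct.equivFinsuppOfBasisLeft b).symm_apply_apply x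
  rw [TensorProduct.equivFinsuppOfBasisLeft_symm_apply] at h2
  rw [← h2]
  refine ⟨∑ i ∈ (TensorProduct.equivFinsuppOfBasisLeft b x).support, c i • b i, ?_⟩
  rw [Finsupp.sum, TensorProduct.sum_tmul]
  refine Finset.sum_congr rfl fun i _ => ?_
  rw [hc, Algebra.algebraMap_eq_smul_one, TensorProduct.smul_tmul]

theorem tens_simple (hc : Subalgebra.center K D = ⊥) : IsSimpleRing (M ⊗[K] D) := by
  classical
  let b := Basis.ofVectorSpace K M
  let f := TensorProduct.equivFinsuppOfBasisLeft (N := D) b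
  rw [isSimpleRing_iff_isTwoSided_imp]
  refine ⟨inferInstance, fun I hI => ?_⟩
  by_cases h0 : I = ⊥
  · exact Or.inl h0
  right
  obtain ⟨x0, hx0, hx0'⟩ := Submodule.exists_mem_ne_zero_of_ne_bot h0
  have hex : ∃ N : ℕ, ∃ x ∈ I, x ≠ 0 ∧ (f x).support.card = N := ⟨_, x0, hx0, hx0', rfl⟩
  obtain ⟨y, hyI, hy0, hyN⟩ := Nat.find_spec hex
  have hmin : ∀ z ∈ I, (f z).support.card < (f y).support.card → z = 0 := by
    intro z hz hlt
    by_contra hz0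
    rw [hyN] at hlt
    exact Nat.find_min hex hlt ⟨z, hz, hz0, rfl⟩
  have hfy : f y ≠ 0 := by simpa using hy0
  obtain ⟨i0, hi0⟩ := Finsupp.ne_iff.1 hfy
  rw [Finsupp.zero_apply] at hi0
  set w := y * (1 ⊗ₜ (f y i0)⁻¹) with hw
  have hwI : w ∈ I := I.mul_mem_right _ hyI
  have hfw : ∀ i, f w i = f y i * (f y i0)⁻¹ := fun i => eqv_mul_right b _ _ _
  have hw1 : f w i0 = 1 := by rw [hfw, mul_inv_cancel₀ hi0]
  have hcomm : ∀ d : D, (1 ⊗ₜ d) * w = w * (1 ⊗ₜ d) := by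
    intro d
    rw [← sub_eq_zero]
    apply hmin _ (I.sub_mem (I.mul_mem_left _ hwI) (I.mul_mem_right _ hwI))
    have hv : ∀ i, f ((1 ⊗ₜ d) * w - w * (1 ⊗ₜ d)) i = d * f w i - f w i * d := by
      intro i
      rw [map_sub, Finsupp.sub_apply]
      congr 1
      · exact eqv_mul_left b _ _ _
      · exact eqv_mul_right b _ _ _
    apply Finset.card_lt_card
    rw [Finset.ssubset_iff_of_subset]
    · refine ⟨i0, by simpa using hi0, ?_⟩
      rw [Finsupp.mem_support_iff, not_not, hv, hw1]; simp
    · intro i hi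
      rw [Finsupp.mem_support_iff] at hi ⊢
      intro h
      apply hi
      rw [hv, hfw, h]; simp
  obtain ⟨m, hm⟩ := eq_left_of_comm hc w hcomm
  have hm0 : m ≠ 0 := by
    rintro rfl
    rw [TensorProduct.zero_tmul] at hm
    rw [hm] at hw1
    simp at hw1
  rw [Ideal.eq_top_iff_one]
  have := I.mul_mem_left (m⁻¹ ⊗ₜ 1) hwI
  rwa [hm, Algebra.TensorProduct.tmul_mul_tmul, inv_mul_cancel₀ hm0, mul_one] at this

theorem tens_central (hc : Subalgebra.center K D = ⊥) : Algebra.IsCentral M (M ⊗[K] D) := by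
  refine ⟨fun x hx => ?_⟩
  rw [Subalgebra.mem_center_iff] at hx
  obtain ⟨m, rfl⟩ := eq_left_of_comm hc x fun d => hx _
  exact ⟨m, rfl⟩

variable [FiniteDimensional K D]

/-- splitting over separably closed fields -/
theorem exists_split (hc : Subalgebra.center K D = ⊥) [IsSepClosed M] :
    ∃ n : ℕ, n ≠ 0 ∧ n ^ 2 = finrank K D ∧ Nonempty (D →ₐ[K] Matrix (Fin n) (Fin n) M) := by
  haveI := tens_simple (M := M) hc
  haveI := tens_central (M := M) hc
  haveI : IsArtinianRing (M ⊗[K] D) := IsArtinianRing.of_finite M _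
  obtain ⟨n, hn, Δ, _, _, _, ⟨e⟩⟩ := IsSimpleRing.exists_algEquiv_matrix_divisionRing_finite M (M ⊗[K] D)
  have hcΔ : Algebra.IsCentral M Δ := by
    haveI : Algebra.IsCentral M (Matrix (Fin n) (Fin n) Δ) := Algebra.IsCentral.of_algEquiv M _ _ e
    refine ⟨fun x hx => ?_⟩
    have h1 : Matrix.scalar (Fin n) x ∈ Subalgebra.center M (Matrix (Fin n) (Fin n) Δ) := by
      rw [Matrix.subalgebraCenter_eq_scalarAlgHom_map]
      exact ⟨x, hx, rfl⟩
    obtain ⟨m, hm⟩ := Algebra.IsCentral.out (K := M) h1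
    refine ⟨m, ?_⟩
    have := congrFun (congrFun hm 0) 0
    simpa [Matrix.algebraMap_matrix_apply] using this
  have hbot : (⊥ : Subalgebra M Δ) = ⊤ := by
    by_contra hne
    obtain ⟨x, hx, hsep⟩ := JacobsonNoether.exists_separable_and_not_isCentral' hne
    apply hx
    have h1 := IsSepClosed.degree_eq_one_of_irreducible M (minpoly.irreducible (Algebra.IsIntegral.isIntegral (R := M) x)) hsep
    rw [Algebra.mem_bot]
    exact minpoly.mem_range_of_degree_eq_one M x h1
  have hbij : Function.Bijective (algebraMap M Δ) := by
    refine ⟨(algebraMap M Δ).injective, fun x => ?_⟩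
    have : x ∈ (⊥ : Subalgebra M Δ) := by rw [hbot]; trivial
    exact Algebra.mem_bot.1 this
  let e2 : M ≃ₐ[M] Δ := AlgEquiv.ofBijective (Algebra.ofId M Δ) hbij
  let e3 : M ⊗[K] D ≃ₐ[M] Matrix (Fin n) (Fin n) M := e.trans (e2.symm.mapMatrix)
  refine ⟨n, hn.out, ?_, ⟨(e3.toAlgHom.restrictScalars K).comp Algebra.TensorProduct.includeRight⟩⟩
  have := e3.toLinearEquiv.finrank_eq
  rw [Module.finrank_baseChange, Module.finrank_matrix] at this
  simp at this
  rw [this, sq]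
end tens
end CE

namespace CE

set_option linter.unusedSectionVars false
set_option linter.unusedVariables false
set_option linter.style.longLine false

open Module
open scoped TensorProduct

/-- Skolem-Noether for matrix algebras -/
theorem skolem {M : Type} [Field M] {n : ℕ} (f : Matrix (Fin n) (Fin n) M ≃ₐ[M] Matrix (Fin n) (Fin n) M) :
    ∃ N : Matrix (Fin n) (Fin n) M, N.det ≠ 0 ∧ ∀ A, N * A = f A * N := by
  let g := (Matrix.toLinAlgEquiv' (R := M) (n := Fin n))
  obtain ⟨t, ht⟩ := ((g.symm.trans f).trans g).eq_linearEquivConjAlgEquiv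
  refine ⟨g.symm t.toLinearMap, ?_, ?_⟩
  · have h1 : g.symm t.toLinearMap * g.symm t.symm.toLinearMap = 1 := by
      rw [← map_mul]
      have : (t.toLinearMap : Module.End M (Fin n → M)) * t.symm.toLinearMap = 1 := by
        ext x; simp
      rw [this, map_one]
    intro h
    have := congrArg Matrix.det h1
    rw [Matrix.det_mul, h] at this
    simp at this
  · intro A
    apply g.injective
    rw [map_mul, map_mul, AlgEquiv.apply_symm_apply]
    have h2 := DFunLike.congr_fun ht (g A)
    simp only [AlgEquiv.trans_apply, AlgEquiv.symm_apply_apply] at h2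
    rw [h2]
    apply LinearMap.ext
    intro x
    simp [LinearEquiv.conjAlgEquiv_apply]

section rep
variable {T K M D : Type} [Field T] [Field K] [Field M] [Algebra T K] [Algebra K M] [Algebra T M] [IsScalarTower T K M] [DivisionRing D] [Algebra K D]
  [Algebra T D] [IsScalarTower T K D] [FiniteDimensional K D]

/-- the isomorphism onto matrices induced by a representation -/
theorem lift_bij (hc : Subalgebra.center K D = ⊥) {n : ℕ} (hn : n ≠ 0) (hn2 : n ^ 2 = finrank K D) (θ : D →ₐ[K] Matrix (Fin n) (Fin n) M) :
    ∃ f : M ⊗[K] D ≃ₐ[M] Matrix (Fin n) (Fin n) M, ∀ d, f (1 ⊗ₜ d) = θ d := by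
  haveI := tens_simple (M := M) hc
  haveI : NeZero n := ⟨hn⟩
  let g : M ⊗[K] D →ₐ[M] Matrix (Fin n) (Fin n) M := Algebra.TensorProduct.lift (Algebra.ofId M _) θ (fun m d => Algebra.commutes m _)
  have hinj : Function.Injective g := g.toRingHom.injective
  have hfr : finrank M (M ⊗[K] D) = finrank M (Matrix (Fin n) (Fin n) M) := by
    rw [Module.finrank_baseChange, Module.finrank_matrix]
    simp [← hn2, sq]
  have hbij : Function.Bijective g := ⟨hinj, (LinearMap.injective_iff_surjective_of_finrank_eq_finrank (f := g.toLinearMap) hfr).1 hinj⟩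
  exact ⟨AlgEquiv.ofBijective g hbij, fun d => by
    change g (1 ⊗ₜ d) = θ d
    have := Algebra.TensorProduct.lift_tmul (Algebra.ofId M (Matrix (Fin n) (Fin n) M)) θ (fun m d => Algebra.commutes m _) 1 d
    rw [map_one, one_mul] at this
    exact this⟩

theorem split_of_rep [FiniteDimensional T M] [IsGalois T M] (hc : Subalgebra.center K D = ⊥) {n : ℕ} (hn : n ≠ 0) (hn2 : n ^ 2 = finrank K D)
    (θ : D →ₐ[K] Matrix (Fin n) (Fin n) M) : Nonempty (SplitData T M D) := by
  obtain ⟨f, hf⟩ := lift_bij hc hn hn2 θ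
  haveI : IsGalois K M := IsGalois.tower_top_of_isGalois T K M
  haveI : FiniteDimensional K M := FiniteDimensional.right T K M
  refine ⟨⟨n, hn, θ.restrictScalars T, (AlgEquiv.restrictScalarsHom T : (M ≃ₐ[K] M) →* (M ≃ₐ[T] M)).range, ?_, ?_, ?_⟩⟩
  · rintro _ ⟨h, rfl⟩
    obtain ⟨f', hf'⟩ := lift_bij hc hn hn2 ((h.toAlgHom.mapMatrix).comp θ)
    obtain ⟨N, hN, hN2⟩ := skolem (f.symm.trans f')
    refine ⟨N, hN, fun d => ?_⟩
    have := hN2 (θ d)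
    rw [AlgEquiv.trans_apply, ← hf, AlgEquiv.symm_apply_apply, hf', hf] at this
    exact this
  · intro A hA
    have h1 : ∀ x, A * f x = f x * A := by
      intro x
      induction x with
      | zero => simp
      | add x y hx hy => rw [map_add, mul_add, add_mul, hx, hy]
      | tmul m d =>
        have : m ⊗ₜ[K] d = m • (1 ⊗ₜ[K] d) := by rw [TensorProduct.smul_tmul']; simp
        rw [this, map_smul, hf, Matrix.mul_smul, Matrix.smul_mul]
        congr 1
        exact hA d
    have h2 : A ∈ Subalgebra.center M (Matrix (Fin n) (Fin n) M) := by
      rw [Subalgebra.mem_center_iff]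
      intro B
      have := h1 (f.symm B)
      rw [AlgEquiv.apply_symm_apply] at this
      exact this.symm
    obtain ⟨c, hc⟩ := Algebra.IsCentral.out (K := M) h2
    exact ⟨c, by rw [← hc]; exact Algebra.algebraMap_eq_smul_one c⟩
  · have e1 : Nat.card (AlgEquiv.restrictScalarsHom T : (M ≃ₐ[K] M) →* (M ≃ₐ[T] M)).range = finrank K M := by
      rw [← IsGalois.card_aut_eq_finrank K M]
      exact (Nat.card_congr (MonoidHom.ofInjective (AlgEquiv.restrictScalarsHom_injective T)).toEquiv).symm
    rw [e1, IsGalois.card_aut_eq_finrank T M, hn2, ← Module.finrank_mul_finrank T K M, ← Module.finrank_mul_finrank T K D]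
    apply dvd_of_eq
    ring
end rep

theorem exists_splitting {T K D : Type} [Field T] [Field K] [Algebra T K] [DivisionRing D] [Algebra K D]
    [Algebra T D] [IsScalarTower T K D] [FiniteDimensional T D] [Algebra.IsSeparable T K] (hc : Subalgebra.center K D = ⊥) :
    ∃ M₀ : IntermediateField T (SeparableClosure T), FiniteDimensional T M₀ ∧ ∀ M : IntermediateField T (SeparableClosure T), M₀ ≤ M →
      FiniteDimensional T M → IsGalois T M → Nonempty (SplitData T M D) := by
  classical
  haveI : FiniteDimensional K D := FiniteDimensional.right T K D
  let κ : K →ₐ[T] SeparableClosure T := IsSepClosed.lift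
  letI : Algebra K (SeparableClosure T) := κ.toRingHom.toAlgebra
  haveI : IsScalarTower T K (SeparableClosure T) := IsScalarTower.of_algebraMap_eq fun x => (κ.commutes x).symm
  obtain ⟨n, hn, hn2, ⟨θ⟩⟩ := exists_split (M := SeparableClosure T) hc
  haveI : NeZero n := ⟨hn⟩
  let b := Module.finBasis T D
  let s : Set (SeparableClosure T) := Set.range fun p : Fin (finrank T D) × Fin n × Fin n => θ (b p.1) p.2.1 p.2.2
  have hs : s.Finite := Set.finite_range _
  refine ⟨IntermediateField.adjoin T s, ?_, ?_⟩
  · haveI : Finite s := hs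
    exact IntermediateField.finiteDimensional_adjoin fun x _ => Algebra.IsIntegral.isIntegral x
  · intro M hM _ _
    have hent : ∀ d i j, θ d i j ∈ M := by
      intro d i j
      rw [← b.sum_repr d, map_sum, Matrix.sum_apply]
      refine sum_mem fun k _ => ?_
      have : θ (b.repr d k • b k) = b.repr d k • θ (b k) := map_smul (θ.restrictScalars T) _ _
      rw [this, Matrix.smul_apply]
      exact M.smul_mem (hM (IntermediateField.subset_adjoin T s ⟨(k, i, j), rfl⟩))
    have hκ : ∀ x, κ x ∈ M := by
      intro x
      have := hent (algebraMap K D x) 0 0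
      rw [AlgHom.commutes, Matrix.algebraMap_matrix_apply, if_pos rfl] at this
      exact this
    letI : Algebra K M := (κ.toRingHom.codRestrict M.toSubfield hκ).toAlgebra
    have halg : ∀ x, ((algebraMap K M x : M) : SeparableClosure T) = algebraMap K (SeparableClosure T) x := fun x => rfl
    haveI : IsScalarTower T K M := IsScalarTower.of_algebraMap_eq fun x => Subtype.ext (κ.commutes x).symm
    let θ' : D →ₐ[K] Matrix (Fin n) (Fin n) M :=
      { toFun := fun d => Matrix.of fun i j => ⟨θ d i j, hent d i j⟩
        map_one' := by
          ext i j
          by_cases h : i = j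
          · subst h; simp
          · simp [h]
        map_mul' := by
          intro x y
          ext i j
          simp [Matrix.mul_apply]
        map_zero' := by
          ext i j; simp
        map_add' := by
          intro x y; ext i j; simp
        commutes' := by
          intro x
          ext1 i j
          rw [Matrix.algebraMap_matrix_apply]
          apply Subtype.ext
          change θ (algebraMap K D x) i j = _
          rw [AlgHom.commutes, Matrix.algebraMap_matrix_apply]
          split_ifs
          · rw [halg]
          · rfl }
    exact split_of_rep hc hn hn2 θ'

theorem main_over_T {T K₁ D₁ K₂ D₂ : Type} [Field T] [Infinite T] [Field K₁] [Algebra T K₁] [DivisionRing D₁] [Algebra K₁ D₁]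
    [Algebra T D₁] [IsScalarTower T K₁ D₁] [FiniteDimensional T D₁] [Algebra.IsSeparable T K₁] (hc₁ : Subalgebra.center K₁ D₁ = ⊥)
    [Field K₂] [Algebra T K₂] [DivisionRing D₂] [Algebra K₂ D₂]
    [Algebra T D₂] [IsScalarTower T K₂ D₂] [FiniteDimensional T D₂] [Algebra.IsSeparable T K₂] (hc₂ : Subalgebra.center K₂ D₂ = ⊥) :
    ∃ (E : Type) (_ : DivisionRing E) (_ : Algebra T E), FiniteDimensional (Subring.center E) E ∧ Nonempty (D₁ →ₐ[T] E) ∧ Nonempty (D₂ →ₐ[T] E) := by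
  classical
  obtain ⟨M₁, _, h₁⟩ := exists_splitting (T := T) hc₁
  haveI : FiniteDimensional T D₂ᵐᵒᵖ := Module.Finite.equiv (MulOpposite.opLinearEquiv T)
  have hc₂' : Subalgebra.center K₂ D₂ᵐᵒᵖ = ⊥ := by
    rw [eq_bot_iff]
    intro x hx
    rw [Subalgebra.mem_center_iff] at hx
    have : x.unop ∈ Subalgebra.center K₂ D₂ := by
      rw [Subalgebra.mem_center_iff]
      intro y
      exact (congrArg MulOpposite.unop (hx (MulOpposite.op y))).symm
    rw [hc₂] at this
    obtain ⟨c, hc⟩ := this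
    exact ⟨c, MulOpposite.unop_injective hc⟩
  obtain ⟨M₂, _, h₂⟩ := exists_splitting (T := T) hc₂'
  let M := IntermediateField.normalClosure T ↥(M₁ ⊔ M₂) (SeparableClosure T)
  have hle : M₁ ⊔ M₂ ≤ M := IntermediateField.le_normalClosure _
  haveI : FiniteDimensional T M := inferInstance
  haveI : IsGalois T M := inferInstance
  obtain ⟨s₁⟩ := h₁ M (le_sup_left.trans hle) inferInstance inferInstance
  obtain ⟨s₂⟩ := h₂ M (le_sup_right.trans hle) inferInstance inferInstance
  haveI : Infinite M := Infinite.of_injective _ (algebraMap T M).injective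
  haveI : Fintype (M ≃ₐ[T] M) := Fintype.ofFinite _
  exact of_split s₁ s₂
end CE

namespace CE

set_option linter.unusedSectionVars false
set_option linter.unusedVariables false
set_option linter.style.longLine false

open Module
open scoped TensorProduct

section
variable {K D : Type} [Field K] [DivisionRing D] [Algebra K D] (J : Type)

/-- tensor of polynomial ring with `D` as polynomials with coefficients in `D` -/
noncomputable def polyTens : MvPolynomial J K ⊗[K] D →ₐ[K] AddMonoidAlgebra D (J →₀ ℕ) :=
  Algebra.TensorProduct.lift (AddMonoidAlgebra.mapAlgHom (J →₀ ℕ) (Algebra.ofId K D))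
    AddMonoidAlgebra.singleZeroAlgHom (by
      intro x y
      induction x using MvPolynomial.induction_on' with
      | monomial u a =>
        have h : (AddMonoidAlgebra.mapAlgHom (J →₀ ℕ) (Algebra.ofId K D)) (MvPolynomial.monomial u a)
            = AddMonoidAlgebra.single u (algebraMap K D a) := by
          simp [MvPolynomial.monomial]
        rw [h]
        change AddMonoidAlgebra.single u (algebraMap K D a) * AddMonoidAlgebra.single 0 y
          = AddMonoidAlgebra.single 0 y * AddMonoidAlgebra.single u (algebraMap K D a)
        rw [AddMonoidAlgebra.single_mul_single, AddMonoidAlgebra.single_mul_single, add_zero, zero_add,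
          Algebra.commutes]
      | add p q hp hq =>
        rw [map_add]
        exact hp.add_left hq)

theorem polyTens_coeff [DecidableEq (J →₀ ℕ)] (x : MvPolynomial J K ⊗[K] D) :
    (polyTens (K := K) (D := D) J x).coeff = TensorProduct.equivFinsuppOfBasisLeft (MvPolynomial.basisMonomials J K) x := by
  induction x using TensorProduct.induction_on with
  | zero => simp
  | add a b ha hb => rw [map_add, map_add, ← ha, ← hb]; rfl
  | tmul p d =>
    induction p using MvPolynomial.induction_on' with
    | add p q hp hq => rw [TensorProduct.add_tmul, map_add, map_add, ← hp, ← hq]; rfl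
    | monomial u a =>
      rw [TensorProduct.equivFinsuppOfBasisLeft_apply_tmul]
      have h : (AddMonoidAlgebra.mapAlgHom (J →₀ ℕ) (Algebra.ofId K D)) (MvPolynomial.monomial u a)
            = AddMonoidAlgebra.single u (algebraMap K D a) := by
          simp [MvPolynomial.monomial]
      rw [polyTens, Algebra.TensorProduct.lift_tmul, h]
      change (AddMonoidAlgebra.single u (algebraMap K D a) * AddMonoidAlgebra.single 0 d).coeff = _
      rw [AddMonoidAlgebra.single_mul_single, add_zero, AddMonoidAlgebra.coeff_single]
      have h2 : (MvPolynomial.basisMonomials J K).repr (MvPolynomial.monomial u a) = Finsupp.single u a := rfl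
      rw [h2, Finsupp.mapRange_single, Algebra.smul_def]

theorem polyTens_inj : Function.Injective (polyTens (K := K) (D := D) J) := by
  classical
  intro x y h
  apply (TensorProduct.equivFinsuppOfBasisLeft (MvPolynomial.basisMonomials J K)).injective
  rw [← polyTens_coeff, ← polyTens_coeff, h]

theorem polyTens_noZero (x y : MvPolynomial J K ⊗[K] D) (h : x * y = 0) : x = 0 ∨ y = 0 := by
  have h1 : polyTens (K := K) (D := D) J x * polyTens (K := K) (D := D) J y = 0 := by rw [← map_mul, h, map_zero]
  rcases mul_eq_zero.mp h1 with h1 | h1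
  · left; exact polyTens_inj J (by rw [h1, map_zero])
  · right; exact polyTens_inj J (by rw [h1, map_zero])

variable (K' : Type) [Field K'] [Algebra (MvPolynomial J K) K'] [IsFractionRing (MvPolynomial J K) K']
  [Algebra K K'] [IsScalarTower K (MvPolynomial J K) K']

theorem clear_denom (x : K' ⊗[K] D) : ∃ q : MvPolynomial J K, q ≠ 0 ∧ ∃ y : MvPolynomial J K ⊗[K] D,
    (algebraMap (MvPolynomial J K) K' q ⊗ₜ[K] (1 : D)) * x
      = Algebra.TensorProduct.map (IsScalarTower.toAlgHom K (MvPolynomial J K) K') (AlgHom.id K D) y := by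
  induction x using TensorProduct.induction_on with
  | zero => exact ⟨1, one_ne_zero, 0, by simp⟩
  | tmul a d =>
    obtain ⟨p, q, hq, rfl⟩ := IsFractionRing.div_surjective (A := MvPolynomial J K) a
    have hq0 := nonZeroDivisors.ne_zero hq
    refine ⟨q, hq0, p ⊗ₜ d, ?_⟩
    have : algebraMap (MvPolynomial J K) K' q ≠ 0 := by
      simpa using hq0
    rw [Algebra.TensorProduct.tmul_mul_tmul, mul_div_cancel₀ _ this]
    simp
  | add a b ha hb =>
    obtain ⟨q, hq, y, h⟩ := ha
    obtain ⟨r, hr, z, h'⟩ := hb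
    refine ⟨q * r, mul_ne_zero hq hr, (r ⊗ₜ 1) * y + (q ⊗ₜ 1) * z, ?_⟩
    rw [map_add, map_mul _ (r ⊗ₜ[K] (1 : D)) y, map_mul _ (q ⊗ₜ[K] (1 : D)) z, ← h, ← h', mul_add, ← mul_assoc, ← mul_assoc]
    simp [mul_comm]

theorem clear_inj : Function.Injective
    (Algebra.TensorProduct.map (IsScalarTower.toAlgHom K (MvPolynomial J K) K') (AlgHom.id K D)) := by
  exact Module.Flat.rTensor_preserves_injective_linearMap (M := D)
    (IsScalarTower.toAlgHom K (MvPolynomial J K) K').toLinearMap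
      (IsFractionRing.injective (MvPolynomial J K) K')

theorem fracTens_isDomain {K D : Type} [Field K] [DivisionRing D] [Algebra K D] (J : Type)
    (K' : Type) [Field K'] [Algebra (MvPolynomial J K) K'] [IsFractionRing (MvPolynomial J K) K']
    [Algebra K K'] [IsScalarTower K (MvPolynomial J K) K'] : IsDomain (K' ⊗[K] D) := by
  have : Nontrivial (K' ⊗[K] D) := inferInstance
  have : NoZeroDivisors (K' ⊗[K] D) := ⟨by
    intro x z hxz
    obtain ⟨q, hq, y, h⟩ := clear_denom J K' x
    obtain ⟨r, hr, w, h'⟩ := clear_denom J K' z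
    have key : ∀ (q : MvPolynomial J K), q ≠ 0 → ∀ x : K' ⊗[K] D,
        (algebraMap (MvPolynomial J K) K' q ⊗ₜ[K] (1 : D)) * x = 0 → x = 0 := by
      intro q hq x hx
      have h0 : algebraMap (MvPolynomial J K) K' q ≠ 0 := by simpa using hq
      have := congrArg (fun t => ((algebraMap (MvPolynomial J K) K' q)⁻¹ ⊗ₜ[K] (1 : D)) * t) hx
      simpa [← mul_assoc, h0, ← Algebra.TensorProduct.one_def] using this
    have hc : ∀ (a : K') (x : K' ⊗[K] D), x * (a ⊗ₜ[K] (1 : D)) = (a ⊗ₜ[K] (1 : D)) * x := by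
      intro a x
      exact (Algebra.commutes (A := K' ⊗[K] D) a x).symm
    have h1 : y * w = 0 := by
      apply clear_inj (D := D) J K'
      rw [map_mul, ← h, ← h', map_zero, mul_assoc, ← mul_assoc x, hc, mul_assoc _ x, hxz, mul_zero, mul_zero]
    rcases polyTens_noZero J y w h1 with h1 | h1
    · left; exact key q hq x (by rw [h, h1, map_zero])
    · right; exact key r hr z (by rw [h', h1, map_zero])⟩
  exact NoZeroDivisors.to_isDomain _

end

end CE

namespace CE

set_option linter.unusedSectionVars false
set_option linter.unusedVariables false
set_option linter.style.longLine false

open Module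
open scoped TensorProduct

theorem sep_ext {F K T K' : Type} [Field F] [Field K] [Field T] [Field K'] [Algebra F K] [Algebra F T]
    [Algebra T K'] [Algebra K K'] [Algebra F K'] [IsScalarTower F T K'] [IsScalarTower F K K']
    [FiniteDimensional F K] [Algebra.IsSeparable F K]
    (h : ∀ z : K', z ∈ IntermediateField.adjoin T (Set.range (algebraMap K K'))) :
    FiniteDimensional T K' ∧ Algebra.IsSeparable T K' := by
  obtain ⟨S, hS⟩ := (Module.finite_def.mp (inferInstance : Module.Finite F K))
  have hsep : ∀ a : K, IsSeparable T (algebraMap K K' a) := by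
    intro a
    have h1 : IsSeparable F a := Algebra.IsSeparable.isSeparable F a
    have h2 : IsSeparable F (algebraMap K K' a) :=
      IsSeparable.map (IsScalarTower.toAlgHom F K K') (algebraMap K K').injective h1
    exact h2.tower_top T
  let S' : Set K' := algebraMap K K' '' (S : Set K)
  have hS'f : Finite S' := (S.finite_toSet.image _).to_subtype
  have htop : IntermediateField.adjoin T S' = ⊤ := by
    rw [eq_top_iff]
    intro z _
    have : IntermediateField.adjoin T (Set.range (algebraMap K K')) ≤ IntermediateField.adjoin T S' := by
      rw [IntermediateField.adjoin_le_iff]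
      rintro _ ⟨a, rfl⟩
      have ha : a ∈ Submodule.span F (S : Set K) := by rw [hS]; trivial
      induction ha using Submodule.span_induction with
      | mem x hx => exact IntermediateField.subset_adjoin _ _ ⟨x, hx, rfl⟩
      | zero => rw [map_zero]; exact zero_mem _
      | add x y _ _ hx hy => rw [map_add]; exact add_mem hx hy
      | smul c x _ hx =>
        rw [Algebra.smul_def, map_mul, ← IsScalarTower.algebraMap_apply F K K',
          IsScalarTower.algebraMap_apply F T K']
        exact mul_mem (IntermediateField.algebraMap_mem _ _) hx
    exact this (h z)
  have hf : FiniteDimensional T (IntermediateField.adjoin T S') :=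
    IntermediateField.finiteDimensional_adjoin (by
      rintro _ ⟨a, _, rfl⟩
      exact (hsep a).isIntegral)
  have hs : Algebra.IsSeparable T (IntermediateField.adjoin T S') := by
    rw [IntermediateField.isSeparable_adjoin_iff_isSeparable]
    rintro _ ⟨a, _, rfl⟩
    exact hsep a
  rw [htop] at hf hs
  exact ⟨Module.Finite.equiv (IntermediateField.topEquiv (F := T) (E := K')).toLinearEquiv,
    AlgEquiv.Algebra.isSeparable (IntermediateField.topEquiv (F := T) (E := K'))⟩

/-- the base field of the reduction -/
abbrev TF (σ k : Type) [Field k] := FractionRing (MvPolynomial σ k)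

section
variable (k : Type) {K ι J σ : Type} [Field k] [Field K] [Algebra k K] (x : ι → K)
  (e : σ ≃ J ⊕ ι)

/-- the map of polynomial rings -/
noncomputable def gMap : MvPolynomial σ k →+* MvPolynomial J K :=
  (MvPolynomial.map (MvPolynomial.aeval (R := k) x).toRingHom).comp
    ((MvPolynomial.sumAlgEquiv k J ι).toAlgHom.toRingHom.comp (MvPolynomial.rename e).toRingHom)

theorem gMap_inj (hx : AlgebraicIndependent k x) : Function.Injective (gMap k x e) := by
  refine (MvPolynomial.map_injective _ hx).comp ?_
  exact (MvPolynomial.sumAlgEquiv k J ι).injective.comp (MvPolynomial.rename_injective _ e.injective)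

theorem gMap_C (c : k) : gMap k x e (MvPolynomial.C c) = MvPolynomial.C (algebraMap k K c) := by
  simp [gMap]

theorem gMap_inl (j : J) : gMap k x e (MvPolynomial.X (e.symm (.inl j))) = MvPolynomial.X j := by
  simp [gMap]

theorem gMap_inr (i : ι) : gMap k x e (MvPolynomial.X (e.symm (.inr i))) = MvPolynomial.C (x i) := by
  simp [gMap]

end

theorem reduction {k K ι J σ D : Type} [Field k] [Field K] [Algebra k K] (x : ι → K)
    (e : σ ≃ J ⊕ ι) (hx : AlgebraicIndependent k x)
    [FiniteDimensional (IntermediateField.adjoin k (Set.range x)) K]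
    [Algebra.IsSeparable (IntermediateField.adjoin k (Set.range x)) K]
    [DivisionRing D] [Algebra K D] [FiniteDimensional K D] (hc : Subalgebra.center K D = ⊥) :
    ∃ (K' D' : Type) (_ : Field K') (_ : Algebra (TF σ k) K') (_ : DivisionRing D') (_ : Algebra K' D')
      (_ : Algebra (TF σ k) D') (_ : IsScalarTower (TF σ k) K' D') (_ : FiniteDimensional (TF σ k) D')
      (_ : Algebra.IsSeparable (TF σ k) K') (_ : Subalgebra.center K' D' = ⊥) (j : D →+* D'),
      ∀ c : k, j (algebraMap K D (algebraMap k K c)) = algebraMap (TF σ k) D' (algebraMap k (TF σ k) c) := by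
  let K' := FractionRing (MvPolynomial J K)
  have hinj : Function.Injective ((algebraMap (MvPolynomial J K) K').comp (gMap k x e)) :=
    (IsFractionRing.injective (MvPolynomial J K) K').comp (gMap_inj k x e hx)
  let t : TF σ k →+* K' := IsFractionRing.lift hinj
  have ht : ∀ p, t (algebraMap _ _ p) = algebraMap (MvPolynomial J K) K' (gMap k x e p) := fun p =>
    IsFractionRing.lift_algebraMap hinj p
  have htk : ∀ c : k, t (algebraMap k _ c) = algebraMap K K' (algebraMap k K c) := by
    intro c
    rw [IsScalarTower.algebraMap_apply k (MvPolynomial σ k) (TF σ k), ht, MvPolynomial.algebraMap_eq, gMap_C,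
      IsScalarTower.algebraMap_apply K (MvPolynomial J K) K', MvPolynomial.algebraMap_eq]
  letI aT : Algebra (TF σ k) K' := t.toAlgebra
  have hF : ∀ y ∈ IntermediateField.adjoin k (Set.range x), algebraMap K K' y ∈ t.fieldRange := by
    intro y hy
    induction hy using IntermediateField.adjoin_induction with
    | mem y hy =>
      obtain ⟨i, rfl⟩ := hy
      refine ⟨algebraMap (MvPolynomial σ k) _ (MvPolynomial.X (e.symm (.inr i))), ?_⟩
      rw [ht, gMap_inr, IsScalarTower.algebraMap_apply K (MvPolynomial J K) K', MvPolynomial.algebraMap_eq]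
    | algebraMap c => exact ⟨algebraMap k _ c, htk c⟩
    | add a b _ _ ha hb => rw [map_add]; exact add_mem ha hb
    | inv a _ ha => rw [map_inv₀]; exact inv_mem ha
    | mul a b _ _ ha hb => rw [map_mul]; exact mul_mem ha hb
  let F := IntermediateField.adjoin k (Set.range x)
  choose h hh using fun y : F => hF y y.2
  let hr : F →+* TF σ k :=
    { toFun := h
      map_one' := t.injective (by rw [hh]; simp)
      map_zero' := t.injective (by rw [hh]; simp)
      map_mul' := fun a b => t.injective (by rw [map_mul, hh, hh, hh]; simp)
      map_add' := fun a b => t.injective (by rw [map_add, hh, hh, hh]; simp) }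
  letI aF : Algebra F (TF σ k) := hr.toAlgebra
  haveI : IsScalarTower F K K' := inferInstance
  haveI : IsScalarTower F (TF σ k) K' := IsScalarTower.of_algebraMap_eq fun y => (hh y).symm
  obtain ⟨hfin, hsep⟩ := sep_ext (F := F) (K := K) (T := TF σ k) (K' := K') (by
    have hp : ∀ p : MvPolynomial J K, algebraMap _ K' p ∈
        IntermediateField.adjoin (TF σ k) (Set.range (algebraMap K K')) := by
      intro p
      induction p using MvPolynomial.induction_on with
      | C a =>
        rw [← MvPolynomial.algebraMap_eq, ← IsScalarTower.algebraMap_apply K (MvPolynomial J K) K']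
        exact IntermediateField.subset_adjoin _ _ ⟨a, rfl⟩
      | add p q hp hq => rw [map_add]; exact add_mem hp hq
      | mul_X p j hp =>
        rw [map_mul]
        refine mul_mem hp ?_
        have : algebraMap (MvPolynomial J K) K' (MvPolynomial.X j)
          = algebraMap (TF σ k) K' (algebraMap (MvPolynomial σ k) _ (MvPolynomial.X (e.symm (.inl j)))) := by
          rw [← gMap_inl k x e j]
          exact (ht _).symm
        rw [this]
        exact IntermediateField.algebraMap_mem _ _
    intro z
    obtain ⟨p, q, hq, rfl⟩ := IsFractionRing.div_surjective (A := MvPolynomial J K) z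
    exact div_mem (hp p) (hp q))
  haveI hdom : IsDomain (K' ⊗[K] D) := fracTens_isDomain J K'
  have hcen : Subalgebra.center K' (K' ⊗[K] D) = ⊥ := (tens_central (M := K') hc).center_eq_bot
  letI aD : Algebra (TF σ k) (K' ⊗[K] D) := inferInstance
  haveI tow : IsScalarTower (TF σ k) K' (K' ⊗[K] D) := inferInstance
  letI dr : DivisionRing (K' ⊗[K] D) := divisionRingOfFiniteDimensional K' (K' ⊗[K] D)
  have fd : FiniteDimensional (TF σ k) (K' ⊗[K] D) := FiniteDimensional.trans (TF σ k) K' _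
  refine ⟨K', K' ⊗[K] D, inferInstance, aT, dr, inferInstance, aD, tow, fd, hsep, hcen,
    (Algebra.TensorProduct.includeRight : D →ₐ[K] K' ⊗[K] D).toRingHom, fun c => ?_⟩
  have h1 : algebraMap (TF σ k) (K' ⊗[K] D) (algebraMap k (TF σ k) c)
    = algebraMap K' (K' ⊗[K] D) (t (algebraMap k (TF σ k) c)) := rfl
  rw [h1, htk]
  change (1 : K') ⊗ₜ[K] (algebraMap K D _) = (algebraMap K K' _) ⊗ₜ[K] (1 : D)
  generalize algebraMap k K c = u
  rw [Algebra.algebraMap_eq_smul_one (A := D), Algebra.algebraMap_eq_smul_one (A := K'), TensorProduct.smul_tmul]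

end CE

namespace CE

open Module

theorem perfect_of_prime (k : Type) [Field k] (hk : ∀ s : Subfield k, s = ⊤) : PerfectField k := by
  obtain h0 | ⟨p, hp, hpk⟩ := CharP.exists' k
  · infer_instance
  · have : Function.Surjective (ZMod.castHom (dvd_refl p) k) := by
      intro y
      have : y ∈ (ZMod.castHom (dvd_refl p) k).fieldRange := by
        rw [hk (ZMod.castHom (dvd_refl p) k).fieldRange]; trivial
      exact this
    have : Finite k := Finite.of_surjective _ this
    infer_instance

theorem trans_basis (k K : Type) [Field k] [Field K] [Algebra k K] [PerfectField k]
    (hfg : (⊤ : IntermediateField k K).FG) :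
    ∃ s : Finset K, AlgebraicIndependent k ((↑) : s → K) ∧
      FiniteDimensional (IntermediateField.adjoin k (Set.range ((↑) : s → K))) K ∧
      Algebra.IsSeparable (IntermediateField.adjoin k (Set.range ((↑) : s → K))) K := by
  haveI := IntermediateField.fg_top_iff.mp hfg
  obtain ⟨s, hs, hsep⟩ := exists_isTranscendenceBasis_and_isSeparable_of_perfectField k K
  have hr : Set.range ((↑) : s → K) = (s : Set K) := Subtype.range_coe
  refine ⟨s, hs.1, ?_, ?_⟩
  · rw [hr]
    haveI : Algebra.EssFiniteType (IntermediateField.adjoin k (s : Set K)) K :=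
      Algebra.EssFiniteType.of_comp k _ K
    exact Algebra.finite_of_essFiniteType_of_isAlgebraic
  · rw [hr]; exact hsep

end CE

/-- Simultaneous embedding over the prime field.  Let `k` be a field with no proper
subfields.  If `D₁`, `D₂` are division rings, finite-dimensional over their centers
`K₁`, `K₂`, where each `Kᵢ` is a finitely generated field extension of `k`, then there
is a division ring `E`, finite-dimensional over its center, admitting injective
`k`-algebra homomorphisms of both `D₁` and `D₂`. -/
theorem exists_common_embedding_over_prime_field
    (k : Type) [Field k] (hk : ∀ s : Subfield k, s = ⊤)
    (K₁ K₂ : Type) [Field K₁] [Field K₂] [Algebra k K₁] [Algebra k K₂]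
    (hfg₁ : (⊤ : IntermediateField k K₁).FG) (hfg₂ : (⊤ : IntermediateField k K₂).FG)
    (D₁ D₂ : Type) [DivisionRing D₁] [DivisionRing D₂]
    [Algebra K₁ D₁] [Algebra K₂ D₂]
    [FiniteDimensional K₁ D₁] [FiniteDimensional K₂ D₂]
    (hc₁ : Subalgebra.center K₁ D₁ = ⊥) (hc₂ : Subalgebra.center K₂ D₂ = ⊥)
    [Algebra k D₁] [Algebra k D₂] [IsScalarTower k K₁ D₁] [IsScalarTower k K₂ D₂] :
    ∃ E : FinDimDivisionAlgebraOver k,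
      (∃ f₁ : D₁ →ₐ[k] E.carrier, Function.Injective f₁) ∧
      (∃ f₂ : D₂ →ₐ[k] E.carrier, Function.Injective f₂) := by
  haveI := CE.perfect_of_prime k hk
  obtain ⟨s₁, hs₁, hf₁, hp₁⟩ := CE.trans_basis k K₁ hfg₁
  obtain ⟨s₂, hs₂, hf₂, hp₂⟩ := CE.trans_basis k K₂ hfg₂
  let e₂ : ((s₂ ⊕ Unit) ⊕ s₁) ≃ ((s₁ ⊕ Unit) ⊕ s₂) :=
    ⟨fun a => match a with
      | .inl (.inl b) => .inr b
      | .inl (.inr u) => .inl (.inr u)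
      | .inr c => .inl (.inl c),
     fun a => match a with
      | .inr b => .inl (.inl b)
      | .inl (.inr u) => .inl (.inr u)
      | .inl (.inl c) => .inr c,
     by rintro ((a | a) | a) <;> rfl, by rintro ((a | a) | a) <;> rfl⟩
  obtain ⟨K₁', D₁', i1, i2, i3, i4, i5, i6, i7, i8, hc₁', j₁, hj₁⟩ :=
    CE.reduction (k := k) (D := D₁) ((↑) : s₁ → K₁) (Equiv.refl ((s₂ ⊕ Unit) ⊕ s₁)) hs₁ hc₁
  obtain ⟨K₂', D₂', l1, l2, l3, l4, l5, l6, l7, l8, hc₂', j₂, hj₂⟩ :=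
    CE.reduction (k := k) (D := D₂) ((↑) : s₂ → K₂) e₂ hs₂ hc₂
  haveI : Infinite (CE.TF ((s₂ ⊕ Unit) ⊕ s₁) k) := by
    haveI : Infinite (MvPolynomial ((s₂ ⊕ Unit) ⊕ s₁) k) := inferInstance
    exact Infinite.of_injective _ (IsFractionRing.injective (MvPolynomial ((s₂ ⊕ Unit) ⊕ s₁) k) _)
  obtain ⟨E, m1, m2, hE, ⟨f₁⟩, ⟨f₂⟩⟩ :=
    CE.main_over_T (T := CE.TF ((s₂ ⊕ Unit) ⊕ s₁) k) hc₁' hc₂'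
  letI aE : Algebra k E :=
    ((algebraMap (CE.TF ((s₂ ⊕ Unit) ⊕ s₁) k) E).comp (algebraMap k _)).toAlgebra'
      (fun c y => Algebra.commutes (R := CE.TF ((s₂ ⊕ Unit) ⊕ s₁) k) _ y)
  have haE : ∀ c : k, algebraMap k E c =
      algebraMap (CE.TF ((s₂ ⊕ Unit) ⊕ s₁) k) E (algebraMap k _ c) := fun _ => rfl
  let g₁ : D₁ →ₐ[k] E := { (f₁ : D₁' →+* E).comp j₁ with
    commutes' := by
      intro c
      change f₁ (j₁ (algebraMap k D₁ c)) = _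
      rw [IsScalarTower.algebraMap_apply k K₁ D₁, hj₁, AlgHom.commutes, haE] }
  let g₂ : D₂ →ₐ[k] E := { (f₂ : D₂' →+* E).comp j₂ with
    commutes' := by
      intro c
      change f₂ (j₂ (algebraMap k D₂ c)) = _
      rw [IsScalarTower.algebraMap_apply k K₂ D₂, hj₂, AlgHom.commutes, haE] }
  exact ⟨{ carrier := E }, ⟨g₁, g₁.toRingHom.injective⟩, ⟨g₂, g₂.toRingHom.injective⟩⟩
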